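/- Let d ≥ 5 and let P be a prime centrally symmetric simplicial d-polytope with g_2(P) = C(d,2) − d. Then there is no nonempty face τ of ∂P with |τ| ≤ d−2 whose link is the boundary of a simplex; that is, there exist no face τ of ∂P with 1 ≤ |τ| ≤ d−2 and set σ of d+1−|τ| vertices such that lk(τ) consists exactly of all proper subsets of σ. -/

import Mathlib

open Finset
open scoped Classical

noncomputable section

/-- A finite graph: a finite vertex set together with a finite set of edges,
where each edge is (intended to be) a 2-element subset of the vertex set. -/
structure FinGraph (ι : Type) where
  verts : Finset ι
  edges : Finset (Finset ι)

/-- Every edge is a 2-element subset of the vertex set. -/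
def FinGraph.Good {ι : Type} (G : FinGraph ι) : Prop :=
  ∀ e ∈ G.edges, e ⊆ G.verts ∧ e.card = 2

/-- The standard inner (dot) product on `ℝ^d`. -/
def dotR {d : ℕ} (x y : Fin d → ℝ) : ℝ := ∑ i, x i * y i

/-- An infinitesimal motion of the framework `(G, p)`. -/
def IsMotion {ι : Type} {d : ℕ} (G : FinGraph ι) (p m : ι → Fin d → ℝ) : Prop :=
  ∀ e ∈ G.edges, ∀ u ∈ e, ∀ v ∈ e, dotR (p u - p v) (m u - m v) = 0

/-- The framework `(G, p)` is infinitesimally rigid in `ℝ^d`: every infinitesimal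
motion is the restriction of a motion `x ↦ A x + b` of `ℝ^d` with `A` skew-symmetric. -/
def IsInfRigid {ι : Type} (d : ℕ) (G : FinGraph ι) (p : ι → Fin d → ℝ) : Prop :=
  ∀ m : ι → Fin d → ℝ, IsMotion G p m →
    ∃ (A : Matrix (Fin d) (Fin d) ℝ) (b : Fin d → ℝ),
      A.transpose = -A ∧ ∀ v ∈ G.verts, m v = A.mulVec (p v) + b

/-- A stress on the framework `(G, p)`. -/
def IsStress {ι : Type} {d : ℕ} (G : FinGraph ι) (p : ι → Fin d → ℝ)
    (ω : Finset ι → ℝ) : Prop :=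
  ∀ v ∈ G.verts,
    (∑ e ∈ G.edges.filter (fun e => v ∈ e), ∑ u ∈ e.erase v, ω e • (p v - p u)) = 0

/-- A centrally symmetric framework with free involution `ν` satisfying `p (ν v) = -(p v)`. -/
def IsCSFramework {ι : Type} {d : ℕ} (G : FinGraph ι) (p : ι → Fin d → ℝ) (ν : ι → ι) : Prop :=
  (∀ v ∈ G.verts, ν (ν v) = v) ∧
  (∀ v ∈ G.verts, ν v ∈ G.verts) ∧
  (∀ v ∈ G.verts, ν v ≠ v) ∧
  (∀ e ∈ G.edges, e.image ν ∈ G.edges) ∧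
  (∀ e ∈ G.edges, e.image ν ≠ e) ∧
  (∀ v ∈ G.verts, p (ν v) = -(p v))

/-- The convex body spanned by a finite point set. -/
def polyBody {d : ℕ} (V : Finset (Fin d → ℝ)) : Set (Fin d → ℝ) :=
  convexHull ℝ (V : Set (Fin d → ℝ))

/-- `(f, c)` is a supporting functional for `conv V` exposing the face `F`. -/
def IsSupport {d : ℕ} (V : Finset (Fin d → ℝ)) (f : (Fin d → ℝ) →ₗ[ℝ] ℝ) (c : ℝ)
    (F : Set (Fin d → ℝ)) : Prop :=
  (∀ y ∈ polyBody V, f y ≤ c) ∧ F = {y ∈ polyBody V | f y = c}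

/-- A proper face of the polytope `conv V`. -/
def IsProperFace {d : ℕ} (V : Finset (Fin d → ℝ)) (F : Set (Fin d → ℝ)) : Prop :=
  (∃ f c, IsSupport V f c F) ∧ F ≠ polyBody V

/-- A simplicial `d`-polytope in `ℝ^d`, recorded by its vertex set `V`: the polytope is
`conv V`, it is `d`-dimensional, every element of `V` is a vertex, and every proper face
is a simplex (the convex hull of its affinely independent vertex set). -/
structure SPolytope (d : ℕ) where
  V : Finset (Fin d → ℝ)
  span_top : affineSpan ℝ (V : Set (Fin d → ℝ)) = ⊤
  extreme : ∀ v ∈ V, v ∉ convexHull ℝ ((V.erase v : Finset (Fin d → ℝ)) : Set (Fin d → ℝ))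
  simplicial : ∀ F : Set (Fin d → ℝ), IsProperFace V F →
    AffineIndependent ℝ
      (fun x : {y : Fin d → ℝ // y ∈ (V : Set (Fin d → ℝ)) ∩ F} => (x : Fin d → ℝ)) ∧
    F = convexHull ℝ ((V : Set (Fin d → ℝ)) ∩ F)

/-- `s` is a face of the boundary complex `∂P`. -/
def BFace {d : ℕ} (P : SPolytope d) (s : Finset (Fin d → ℝ)) : Prop :=
  s ⊆ P.V ∧ ∃ F : Set (Fin d → ℝ), IsProperFace P.V F ∧ (s : Set (Fin d → ℝ)) ⊆ F

/-- The number of vertices of `∂P`. -/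
def f0 {d : ℕ} (P : SPolytope d) : ℕ := P.V.card

/-- The edges of `∂P`. -/
def edgeFinset {d : ℕ} (P : SPolytope d) : Finset (Finset (Fin d → ℝ)) :=
  P.V.powerset.filter fun e => e.card = 2 ∧ BFace P e

/-- The number of edges of `∂P`. -/
def f1 {d : ℕ} (P : SPolytope d) : ℕ := (edgeFinset P).card

/-- `g₂(P) = f₁ - d f₀ + C(d+1, 2)`. -/
def g2 {d : ℕ} (P : SPolytope d) : ℤ :=
  (f1 P : ℤ) - (d : ℤ) * (f0 P : ℤ) + ((d + 1).choose 2 : ℤ)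

/-- `P` is centrally symmetric. -/
def IsCS {d : ℕ} (P : SPolytope d) : Prop := ∀ v ∈ P.V, -v ∈ P.V

/-- A missing face of `∂P`. -/
def IsMissingFace {d : ℕ} (P : SPolytope d) (σ : Finset (Fin d → ℝ)) : Prop :=
  σ ⊆ P.V ∧ ¬ BFace P σ ∧ ∀ τ ⊂ σ, BFace P τ

/-- `P` is prime: `∂P` has no missing facet, i.e. no missing face of cardinality `d`. -/
def IsPrimePoly {d : ℕ} (P : SPolytope d) : Prop :=
  ¬ ∃ σ : Finset (Fin d → ℝ), IsMissingFace P σ ∧ σ.card = d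

/-- The graph (1-skeleton) of `∂P` as a framework graph. -/
def fullGraph {d : ℕ} (P : SPolytope d) : FinGraph (Fin d → ℝ) :=
  ⟨P.V, edgeFinset P⟩

/-- The graph (1-skeleton) of the star of the face `τ` in `∂P`. -/
def starGraph {d : ℕ} (P : SPolytope d) (τ : Finset (Fin d → ℝ)) : FinGraph (Fin d → ℝ) :=
  ⟨P.V.filter fun v => BFace P (insert v τ),
   P.V.powerset.filter fun e => e.card = 2 ∧ BFace P (e ∪ τ)⟩

/-- Adjacency in the graph of `∂P`. -/
def Adj {d : ℕ} (P : SPolytope d) (u v : Fin d → ℝ) : Prop :=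
  u ≠ v ∧ BFace P {u, v}

/-- `σ` is a face of the link of the face `τ` in `∂P`. -/
def LinkFace {d : ℕ} (P : SPolytope d) (τ σ : Finset (Fin d → ℝ)) : Prop :=
  Disjoint σ τ ∧ BFace P (σ ∪ τ)

/-- `P` is a `d`-dimensional cross-polytope: its vertex set is `{±b₁, …, ±b_d}`
for some basis `b₁, …, b_d` of `ℝ^d`. -/
def IsCrossPolytope {d : ℕ} (P : SPolytope d) : Prop :=
  ∃ b : Fin d → (Fin d → ℝ), LinearIndependent ℝ b ∧
    (P.V : Set (Fin d → ℝ)) = Set.range b ∪ Set.range (fun i => -(b i))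

/-- A facet of `P`: a proper face with `d` vertices. -/
def IsFacet {d : ℕ} (P : SPolytope d) (F : Set (Fin d → ℝ)) : Prop :=
  IsProperFace P.V F ∧ ((P.V : Set (Fin d → ℝ)) ∩ F).ncard = d

/-- `x` lies beyond exactly one facet of `P`: it is strictly separated from `P` by the
affine hull of one facet `F`, and not separated from `P` by the affine hull of any
other facet. -/
def BeyondExactlyOne {d : ℕ} (P : SPolytope d) (x : Fin d → ℝ) : Prop :=
  ∃ F : Set (Fin d → ℝ), IsFacet P F ∧
    (∀ f c, IsSupport P.V f c F → c < f x) ∧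
    (∀ F' : Set (Fin d → ℝ), IsFacet P F' → F' ≠ F →
      ∀ f c, IsSupport P.V f c F' → f x < c)

/-- `P` is obtained from a `d`-dimensional cross-polytope by symmetric stacking: there is
a sequence of cs simplicial `d`-polytopes starting at a cross-polytope and ending at `P`,
each obtained from the previous one as `conv (P_k ∪ {v, -v})` for a point `v` lying
beyond exactly one facet of `P_k`. -/
def SymmetricStackingFrom {d : ℕ} (P : SPolytope d) : Prop :=
  ∃ (m : ℕ) (Q : Fin (m + 1) → SPolytope d),
    (∀ k, IsCS (Q k)) ∧
    IsCrossPolytope (Q 0) ∧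
    Q (Fin.last m) = P ∧
    ∀ k : Fin m, ∃ v : Fin d → ℝ,
      BeyondExactlyOne (Q (Fin.castSucc k)) v ∧
      polyBody (Q (Fin.succ k)).V =
        convexHull ℝ (polyBody (Q (Fin.castSucc k)).V ∪ {v, -v})

/-- `P` is a stacked `d`-polytope: obtained from a `d`-simplex by repeatedly adding a
point beyond exactly one facet. -/
def IsStacked {d : ℕ} (P : SPolytope d) : Prop :=
  ∃ (m : ℕ) (R : Fin (m + 1) → SPolytope d),
    (R 0).V.card = d + 1 ∧
    R (Fin.last m) = P ∧
    ∀ k : Fin m, ∃ v : Fin d → ℝ,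
      BeyondExactlyOne (R (Fin.castSucc k)) v ∧
      polyBody (R (Fin.succ k)).V =
        convexHull ℝ (polyBody (R (Fin.castSucc k)).V ∪ {v})

/-- Every `d` vertices of `P`, no two of which are antipodal, are affinely independent. -/
def GenPos {d : ℕ} (P : SPolytope d) : Prop :=
  ∀ S : Finset (Fin d → ℝ), S ⊆ P.V → S.card = d →
    (∀ x ∈ S, ∀ y ∈ S, x ≠ -y) →
    AffineIndependent ℝ (fun s : {x : Fin d → ℝ // x ∈ S} => (s : Fin d → ℝ))

/-- The graph of the cone `v₀ * S` over a simplicial complex `S` (a set of finsets):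
the vertices of `S` together with `v₀`, and the edges of `S` together with all edges
from `v₀` to vertices of `S`. -/
def coneGraph {d : ℕ} (P : SPolytope d) (v0 : Fin d → ℝ)
    (S : Set (Finset (Fin d → ℝ))) : FinGraph (Fin d → ℝ) :=
  ⟨insert v0 (P.V.filter fun u => ({u} : Finset (Fin d → ℝ)) ∈ S),
   (P.V.powerset.filter fun e => e.card = 2 ∧ e ∈ S) ∪
     (P.V.filter fun u => ({u} : Finset (Fin d → ℝ)) ∈ S).image
       fun u => ({v0, u} : Finset (Fin d → ℝ))⟩

set_option linter.unusedSectionVars false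

structure Cfg {ι W : Type} [AddCommGroup W] [Module ℝ W] (V : Finset ι) (p : ι → W) : Prop where
  sp : ∀ φ : Module.Dual ℝ W, (∀ v ∈ V, φ (p v) = 0) → φ = 0
  simp : ∀ φ : Module.Dual ℝ W, (∀ v ∈ V, 0 ≤ φ (p v)) → φ ≠ 0 → ∀ v ∈ V, φ (p v) = 0 →
    ∃ α : Module.Dual ℝ W, α (p v) = 1 ∧ ∀ u ∈ V, u ≠ v → φ (p u) = 0 → α (p u) = 0

/-- faces of a configuration -/
def Fc {ι W : Type} [AddCommGroup W] [Module ℝ W] (V : Finset ι) (p : ι → W) (s : Finset ι) : Prop :=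
  s ⊆ V ∧ ∃ φ : Module.Dual ℝ W, φ ≠ 0 ∧ (∀ v ∈ V, 0 ≤ φ (p v)) ∧ ∀ v ∈ s, φ (p v) = 0

section basics
variable {ι W : Type} [DecidableEq ι] [AddCommGroup W] [Module ℝ W] {V : Finset ι} {p : ι → W}

theorem Fc.mono {s t : Finset ι} (h : Fc V p t) (hst : s ⊆ t) : Fc V p s := by
  obtain ⟨h1, φ, h2, h3, h4⟩ := h
  exact ⟨hst.trans h1, φ, h2, h3, fun v hv => h4 v (hst hv)⟩

theorem exists_eps_aux {ι : Type} (S : Finset ι) (a b : ι → ℝ) (h : ∀ v ∈ S, 0 < a v) :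
    ∃ ε : ℝ, 0 < ε ∧ ∀ v ∈ S, 0 < a v + ε * b v := by
  induction S using Finset.induction_on with
  | empty => exact ⟨1, one_pos, by simp⟩
  | insert x S hx ih =>
    obtain ⟨ε, he, h2⟩ := ih (fun v hv => h v (Finset.mem_insert_of_mem hv))
    have hax := h x (Finset.mem_insert_self _ _)
    have hb : 0 < |b x| + 1 := by positivity
    refine ⟨min ε (a x / (|b x| + 1)), lt_min he (by positivity), ?_⟩
    set δ := min ε (a x / (|b x| + 1)) with hδ
    have hδ0 : 0 < δ := lt_min he (by positivity)
    have hδ1 : δ ≤ ε := min_le_left _ _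
    have hδ2 : δ * (|b x| + 1) ≤ a x := by
      have := min_le_right ε (a x / (|b x| + 1))
      rwa [← hδ, le_div_iff₀ hb] at this
    intro v hv
    rcases Finset.mem_insert.1 hv with rfl | hv
    · have := neg_abs_le (b v)
      nlinarith
    · have h3 := h2 v hv
      have h4 := h v (Finset.mem_insert_of_mem hv)
      by_cases hb0 : 0 ≤ b v
      · have : 0 ≤ δ * b v := mul_nonneg hδ0.le hb0
        linarith
      · push Not at hb0
        nlinarith

theorem Cfg.strict (hC : Cfg V p) {s : Finset ι} (hs : Fc V p s) :
    ∃ φ : Module.Dual ℝ W, φ ≠ 0 ∧ (∀ v ∈ V, 0 ≤ φ (p v)) ∧ (∀ v ∈ s, φ (p v) = 0) ∧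
      ∀ v ∈ V, v ∉ s → 0 < φ (p v) := by
  obtain ⟨hsV, φ, h0, hpos, hz⟩ := hs
  have hα := hC.simp φ hpos h0
  choose! α hα1 hα2 using hα
  set Z := V.filter (fun v => φ (p v) = 0 ∧ v ∉ s) with hZ
  set ψ : Module.Dual ℝ W := ∑ z ∈ Z, α z with hψ
  have hψ1 : ∀ v ∈ V, φ (p v) = 0 → v ∉ s → ψ (p v) = 1 := by
    intro v hv h1 h2
    have hvZ : v ∈ Z := by simp [hZ, hv, h1, h2]
    rw [hψ, LinearMap.sum_apply, Finset.sum_eq_single v, hα1 v hv h1]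
    · intro z hzZ hne
      have hz' := Finset.mem_filter.1 hzZ
      exact hα2 z hz'.1 hz'.2.1 v hv hne.symm h1
    · intro h; exact absurd hvZ h
  have hψ0 : ∀ v ∈ s, ψ (p v) = 0 := by
    intro v hv
    rw [hψ, LinearMap.sum_apply]
    refine Finset.sum_eq_zero fun z hzZ => ?_
    have hz' := Finset.mem_filter.1 hzZ
    exact hα2 z hz'.1 hz'.2.1 v (hsV hv) (fun h => hz'.2.2 (h ▸ hv)) (hz v hv)
  obtain ⟨ε, he, heps⟩ := exists_eps_aux (V.filter (fun v => 0 < φ (p v))) (fun v => φ (p v))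
    (fun v => ψ (p v)) (fun v hv => (Finset.mem_filter.1 hv).2)
  have key : ∀ v ∈ V, v ∉ s → 0 < (φ + ε • ψ) (p v) := by
    intro v hv hvs
    simp only [LinearMap.add_apply, LinearMap.smul_apply, smul_eq_mul]
    rcases (hpos v hv).lt_or_eq with h | h
    · exact heps v (by simp [hv, h])
    · rw [← h, hψ1 v hv h.symm hvs]; linarith
  have key0 : ∀ v ∈ s, (φ + ε • ψ) (p v) = 0 := by
    intro v hv
    simp [hz v hv, hψ0 v hv]
  refine ⟨φ + ε • ψ, ?_, ?_, key0, key⟩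
  · have : ∃ v ∈ V, φ (p v) ≠ 0 := by
      by_contra hcon
      push Not at hcon
      exact h0 (hC.sp φ hcon)
    obtain ⟨v, hv, hne⟩ := this
    intro h
    have hvs : v ∉ s := fun hvs => hne (hz v hvs)
    have := key v hv hvs
    rw [h] at this
    simp at this
  · intro v hv
    by_cases hvs : v ∈ s
    · rw [key0 v hvs]
    · exact (key v hv hvs).le

/-- facet lemma -/
theorem Cfg.facet (hC : Cfg V p) {s : Finset ι} (hs : Fc V p s) :
    ∃ Z : Finset ι, s ⊆ Z ∧ Z ⊆ V ∧ ∃ φ : Module.Dual ℝ W, φ ≠ 0 ∧ (∀ v ∈ V, 0 ≤ φ (p v)) ∧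
      (∀ v ∈ Z, φ (p v) = 0) ∧ ∀ χ : Module.Dual ℝ W, (∀ v ∈ Z, χ (p v) = 0) → ∃ c : ℝ, χ = c • φ := by
  have hne : (V.powerset.filter (fun Z => s ⊆ Z ∧ Fc V p Z)).Nonempty :=
    ⟨s, by simp [hs.1, hs]⟩
  obtain ⟨Z, hZ, hmax⟩ := Finset.exists_max_image _ (fun Z => Z.card) hne
  simp only [Finset.mem_filter, Finset.mem_powerset] at hZ hmax
  obtain ⟨hZV, hsZ, hFZ⟩ := hZ
  obtain ⟨_, φ, h0, hpos, hz⟩ := hFZ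
  refine ⟨Z, hsZ, hZV, φ, h0, hpos, hz, ?_⟩
  by_contra hcon
  push Not at hcon
  obtain ⟨χ, hχ, hc⟩ := hcon
  have main : ∀ χ : Module.Dual ℝ W, (∀ v ∈ Z, χ (p v) = 0) → (∀ c : ℝ, χ ≠ c • φ) →
      (∃ v ∈ V, χ (p v) < 0) → False := by
    intro χ hχ hc ⟨v0, hv0, hlt⟩
    obtain ⟨v, hv, hmin⟩ := Finset.exists_min_image (V.filter (fun v => χ (p v) < 0))
      (fun v => φ (p v) / (-χ (p v))) ⟨v0, by simp [hv0, hlt]⟩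
    simp only [Finset.mem_filter] at hv hmin
    set t := φ (p v) / (-χ (p v)) with ht
    have ht0 : 0 ≤ t := div_nonneg (hpos v hv.1) (by linarith [hv.2])
    have htv : φ (p v) + t * χ (p v) = 0 := by
      have : χ (p v) ≠ 0 := hv.2.ne
      rw [ht]; field_simp; ring
    have hF : Fc V p (insert v Z) := by
      refine ⟨Finset.insert_subset hv.1 hZV, φ + t • χ, ?_, ?_, ?_⟩
      · intro h
        by_cases ht1 : t = 0
        · rw [ht1, zero_smul, add_zero] at h; exact h0 h
        · apply hc (-t⁻¹)
          have h2 : t • χ = -φ := by rw [eq_neg_iff_add_eq_zero, add_comm]; exact h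
          
          ext y
          have h3 := LinearMap.congr_fun h2 y
          simp only [LinearMap.smul_apply, LinearMap.neg_apply, smul_eq_mul] at h3 ⊢
          field_simp
          linarith
      · intro w hw
        simp only [LinearMap.add_apply, LinearMap.smul_apply, smul_eq_mul]
        by_cases hw0 : χ (p w) < 0
        · have := hmin w ⟨hw, hw0⟩
          rw [le_div_iff₀ (by linarith)] at this
          linarith
        · push Not at hw0
          have := hpos w hw
          nlinarith [mul_nonneg ht0 hw0]
      · intro w hw
        simp only [LinearMap.add_apply, LinearMap.smul_apply, smul_eq_mul]
        rcases Finset.mem_insert.1 hw with rfl | hw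
        · exact htv
        · rw [hz w hw, hχ w hw]; ring
    have hvZ : v ∉ Z := fun h => by
      have := hχ v h
      linarith [hv.2]
    have := hmax (insert v Z) ⟨hF.1, hsZ.trans (Finset.subset_insert _ _), hF⟩
    rw [Finset.card_insert_of_notMem hvZ] at this
    omega
  have hχ0 : ∃ v ∈ V, χ (p v) ≠ 0 := by
    by_contra h
    push Not at h
    exact hc 0 (by rw [hC.sp χ h, zero_smul])
  obtain ⟨v, hv, hne⟩ := hχ0
  rcases lt_or_gt_of_ne hne with h | h
  · exact main χ hχ hc ⟨v, hv, h⟩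
  · refine main (-χ) (fun v hv => by simp [hχ v hv]) ?_ ⟨v, hv, by simpa using h⟩
    intro c hcc
    exact hc (-c) (by
      ext y
      have h3 := LinearMap.congr_fun hcc y
      simp only [LinearMap.smul_apply, LinearMap.neg_apply, smul_eq_mul] at h3 ⊢
      linarith)

/-- an alternating form that kills a facet vanishes -/
theorem alt_zero_of_facet {Z : Finset ι} {φ : Module.Dual ℝ W} (h0 : φ ≠ 0)
    (hann : ∀ χ : Module.Dual ℝ W, (∀ v ∈ Z, χ (p v) = 0) → ∃ c : ℝ, χ = c • φ)
    (B : W →ₗ[ℝ] Module.Dual ℝ W) (hB : ∀ x, B x x = 0) (hBZ : ∀ v ∈ Z, B (p v) = 0) : B = 0 := by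
  have hskew : ∀ x y, B x y = - B y x := by
    intro x y
    have := hB (x + y)
    simp only [map_add, LinearMap.add_apply, hB] at this
    linarith
  have h1 : ∀ x, ∃ c : ℝ, B x = c • φ := fun x =>
    hann (B x) (fun v hv => by rw [hskew, hBZ v hv]; simp)
  have h2 : ∃ y, φ y ≠ 0 := by
    by_contra h
    push Not at h
    exact h0 (LinearMap.ext h)
  obtain ⟨y, hy⟩ := h2
  have hy0 : B y = 0 := by
    obtain ⟨c, hc⟩ := h1 y
    have := hB y
    rw [hc] at this
    simp only [LinearMap.smul_apply, smul_eq_mul, mul_eq_zero] at this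
    rcases this with h | h
    · rw [hc, h, zero_smul]
    · exact absurd h hy
  refine LinearMap.ext fun x => ?_
  obtain ⟨c, hc⟩ := h1 x
  have := hskew x y
  rw [hy0, hc] at this
  simp only [LinearMap.smul_apply, smul_eq_mul, LinearMap.zero_apply, neg_zero, mul_eq_zero] at this
  rcases this with h | h
  · rw [hc, h, zero_smul]; rfl
  · exact absurd h hy

theorem Cfg.exists_link [FiniteDimensional ℝ W] (hC : Cfg V p) {s : Finset ι} (hs : Fc V p s)
    (hcard : s.card + 2 ≤ Module.finrank ℝ W) : ∃ v, v ∉ s ∧ Fc V p (insert v s) := by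
  obtain ⟨Z, hsZ, hZV, φ, h0, hpos, hz, hann⟩ := hC.facet hs
  by_cases h : ∃ v ∈ Z, v ∉ s
  · obtain ⟨v, hv, hvs⟩ := h
    exact ⟨v, hvs, Finset.insert_subset (hZV hv) hs.1, φ, h0, hpos, fun w hw => by
      rcases Finset.mem_insert.1 hw with rfl | hw
      · exact hz _ hv
      · exact hz _ (hsZ hw)⟩
  · exfalso
    push Not at h
    let f : Module.Dual ℝ W →ₗ[ℝ] (s → ℝ) := LinearMap.pi (fun v => Module.Dual.eval ℝ W (p v))
    have hk : LinearMap.ker f ≤ Submodule.span ℝ {φ} := by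
      intro χ hχ
      rw [LinearMap.mem_ker] at hχ
      obtain ⟨c, hc⟩ := hann χ (fun v hv => congrFun hχ ⟨v, h v hv⟩)
      rw [hc]
      exact Submodule.smul_mem _ _ (Submodule.mem_span_singleton_self _)
    have h1 := LinearMap.finrank_range_add_finrank_ker f
    have h2 : Module.finrank ℝ (LinearMap.range f) ≤ s.card := by
      calc _ ≤ Module.finrank ℝ (s → ℝ) := Submodule.finrank_le _
        _ = s.card := by simp
    have h3 := Submodule.finrank_mono hk
    have h4 := finrank_span_singleton (K := ℝ) h0
    rw [Subspace.dual_finrank_eq] at h1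
    omega

/-- cone lemma -/
theorem Cfg.cone (hC : Cfg V p) {s : Finset ι} (hs : Fc V p s)
    (hne : ∃ v, v ∉ s ∧ Fc V p (insert v s)) (f : Module.Dual ℝ W) (hf : ∀ v ∈ s, f (p v) = 0)
    (hpos : ∀ v, v ∉ s → Fc V p (insert v s) → 0 ≤ f (p v)) : ∀ v ∈ V, 0 ≤ f (p v) := by
  obtain ⟨ψ, hψ0, hψ, hψs, hψp⟩ := hC.strict hs
  by_contra hcon
  push Not at hcon
  obtain ⟨w, hw, hlt⟩ := hcon
  have hws : w ∉ s := fun h => by linarith [hf w h]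
  obtain ⟨v, hv, hmin⟩ := Finset.exists_min_image (V \ s) (fun v => f (p v) / ψ (p v))
    ⟨w, by simp [hw, hws]⟩
  simp only [Finset.mem_sdiff] at hv hmin
  set c := f (p v) / ψ (p v) with hc
  have hψv := hψp v hv.1 hv.2
  have hc0 : c < 0 := lt_of_le_of_lt (hmin w ⟨hw, hws⟩) (div_neg_of_neg_of_pos hlt (hψp w hw hws))
  have hfv : f (p v) = c * ψ (p v) := by rw [hc]; field_simp
  have hge : ∀ u ∈ V, 0 ≤ (f - c • ψ) (p u) := by
    intro u hu
    simp only [LinearMap.sub_apply, LinearMap.smul_apply, smul_eq_mul]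
    by_cases hus : u ∈ s
    · rw [hf u hus, hψs u hus]; simp
    · have := hmin u ⟨hu, hus⟩
      rw [le_div_iff₀ (hψp u hu hus)] at this
      linarith
  by_cases hz : f - c • ψ = 0
  · obtain ⟨u, hus, hu⟩ := hne
    have h1 := hpos u hus hu
    have h2 : f = c • ψ := sub_eq_zero.1 hz
    rw [h2] at h1
    simp only [LinearMap.smul_apply, smul_eq_mul] at h1
    have := hψp u (hu.1 (Finset.mem_insert_self _ _)) hus
    nlinarith
  · have hF : Fc V p (insert v s) := by
      refine ⟨Finset.insert_subset hv.1 hs.1, _, hz, hge, ?_⟩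
      intro u hu
      simp only [LinearMap.sub_apply, LinearMap.smul_apply, smul_eq_mul]
      rcases Finset.mem_insert.1 hu with rfl | hu
      · rw [hfv]; ring
      · rw [hf u hu, hψs u hu]; ring
    have := hpos v hv.2 hF
    nlinarith

/-- connectivity inside a half space -/
theorem Cfg.climb (hC : Cfg V p) {s : Finset ι} (hs : Fc V p s) (f : Module.Dual ℝ W)
    (hf : ∀ v ∈ s, f (p v) = 0) (hx : ∃ x ∈ V, x ∉ s ∧ f (p x) = 0)
    (hne : ∀ v, v ∉ s → Fc V p (insert v s) → ∃ u, u ∉ insert v s ∧ Fc V p (insert u (insert v s)))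
    (S : ι → Prop)
    (hS : ∀ v w, v ∉ s → w ∉ s → v ≠ w → Fc V p (insert w (insert v s)) → 0 < f (p v) → 0 < f (p w) →
      S v → S w)
    {a b : ι} (ha : a ∉ s) (hb : b ∉ s) (hFa : Fc V p (insert a s)) (hFb : Fc V p (insert b s))
    (hfa : 0 < f (p a)) (hfb : 0 < f (p b)) (hSa : S a) : S b := by
  obtain ⟨ψ, hψ0, hψ, hψs, hψp⟩ := hC.strict hs
  -- symmetric main step
  have main : ∀ S : ι → Prop, (∀ v w, v ∉ s → w ∉ s → v ≠ w → Fc V p (insert w (insert v s)) →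
      0 < f (p v) → 0 < f (p w) → S v → S w) →
      ∀ u u', u ∉ s → u' ∉ s → Fc V p (insert u s) → Fc V p (insert u' s) → 0 < f (p u) →
      0 < f (p u') → S u → ¬ S u' →
      (∀ w, w ∉ s → Fc V p (insert w s) → 0 < f (p w) → S w →
        f (p w) / ψ (p w) ≤ f (p u) / ψ (p u)) →
      f (p u) / ψ (p u) ≤ f (p u') / ψ (p u') → False := by
    intro S hS u u' hus hus' hFu hFu' hfu hfu' hSu hSu' hmax hle
    have huV := hFu.1 (Finset.mem_insert_self _ _)
    have huV' := hFu'.1 (Finset.mem_insert_self _ _)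
    set c := f (p u) / ψ (p u) with hc
    have hψu := hψp u huV hus
    have hψu' := hψp u' huV' hus'
    have hc0 : 0 < c := div_pos hfu hψu
    have hfu2 : f (p u) = c * ψ (p u) := by rw [hc]; field_simp
    have hge : ∀ v ∈ V, 0 ≤ (c • ψ - f) (p v) := by
      refine hC.cone hFu (hne u hus hFu) _ ?_ ?_
      · intro v hv
        simp only [LinearMap.sub_apply, LinearMap.smul_apply, smul_eq_mul]
        rcases Finset.mem_insert.1 hv with rfl | hv
        · linarith
        · rw [hf v hv, hψs v hv]; ring
      · intro w hw hFw
        simp only [LinearMap.sub_apply, LinearMap.smul_apply, smul_eq_mul]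
        have hwV := hFw.1 (Finset.mem_insert_self _ _)
        have hws : w ∉ s := fun h => hw (Finset.mem_insert_of_mem h)
        have hwu : u ≠ w := fun h => hw (h ▸ Finset.mem_insert_self _ _)
        have hψw := hψp w hwV hws
        by_cases hfw : 0 < f (p w)
        · have h1 := hS u w hus hws hwu hFw hfu hfw hSu
          have h2 := hmax w hws (hFw.mono (Finset.insert_subset_insert _ (Finset.subset_insert _ _))) hfw h1
          rw [div_le_iff₀ hψw] at h2
          linarith
        · nlinarith
    have h1 := hge u' huV'
    simp only [LinearMap.sub_apply, LinearMap.smul_apply, smul_eq_mul] at h1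
    rw [le_div_iff₀ hψu'] at hle
    have hne0 : c • ψ - f ≠ 0 := by
      obtain ⟨x, hxV, hxs, hfx⟩ := hx
      intro h
      have h2 := congrArg (fun g : Module.Dual ℝ W => g (p x)) h
      simp only [LinearMap.sub_apply, LinearMap.smul_apply, smul_eq_mul, LinearMap.zero_apply, hfx] at h2
      have := mul_pos hc0 (hψp x hxV hxs)
      linarith
    apply hSu'
    refine hS u u' hus hus' (fun h => hSu' (h ▸ hSu)) ?_ hfu hfu' hSu
    refine ⟨Finset.insert_subset huV' hFu.1, _, hne0, hge, ?_⟩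
    intro v hv
    simp only [LinearMap.sub_apply, LinearMap.smul_apply, smul_eq_mul]
    rcases Finset.mem_insert.1 hv with rfl | hv
    · linarith
    · rcases Finset.mem_insert.1 hv with rfl | hv
      · linarith
      · rw [hf v hv, hψs v hv]; ring
  by_contra hSb
  set D := V.filter (fun v => v ∉ s ∧ Fc V p (insert v s) ∧ 0 < f (p v)) with hD
  have hmemD : ∀ v, v ∈ D ↔ v ∉ s ∧ Fc V p (insert v s) ∧ 0 < f (p v) := by
    intro v
    rw [hD, Finset.mem_filter]
    exact ⟨fun h => h.2, fun h => ⟨h.2.1.1 (Finset.mem_insert_self _ _), h⟩⟩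
  obtain ⟨u, hu, humax⟩ := Finset.exists_max_image (D.filter S) (fun v => f (p v) / ψ (p v))
    ⟨a, by simp [hmemD, ha, hFa, hfa, hSa]⟩
  obtain ⟨u', hu', humax'⟩ := Finset.exists_max_image (D.filter (fun v => ¬ S v)) (fun v => f (p v) / ψ (p v))
    ⟨b, by simp [hmemD, hb, hFb, hfb, hSb]⟩
  simp only [Finset.mem_filter, hmemD] at hu humax hu' humax'
  rcases le_total (f (p u) / ψ (p u)) (f (p u') / ψ (p u')) with h | h
  · exact main S hS u u' hu.1.1 hu'.1.1 hu.1.2.1 hu'.1.2.1 hu.1.2.2 hu'.1.2.2 hu.2 hu'.2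
      (fun w h1 h2 h3 h4 => humax w ⟨⟨h1, h2, h3⟩, h4⟩) h
  · refine main (fun v => ¬ S v) ?_ u' u hu'.1.1 hu.1.1 hu'.1.2.1 hu.1.2.1 hu'.1.2.2 hu.1.2.2 hu'.2
      (by simpa using hu.2) (fun w h1 h2 h3 h4 => humax' w ⟨⟨h1, h2, h3⟩, h4⟩) h
    intro v w hv hw hvw hF hfv hfw hSv hSw
    exact hSv (hS w v hw hv hvw.symm (by rwa [Finset.insert_comm]) hfw hfv hSw)

/-- the graph of a link is connected -/
theorem Cfg.conn (hC : Cfg V p) {s : Finset ι} (hs : Fc V p s)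
    (hne : ∀ v, v ∉ s → Fc V p (insert v s) → ∃ u, u ∉ insert v s ∧ Fc V p (insert u (insert v s)))
    (S : ι → Prop)
    (hS : ∀ v w, v ∉ s → w ∉ s → v ≠ w → Fc V p (insert w (insert v s)) → S v → S w)
    {a b : ι} (ha : a ∉ s) (hb : b ∉ s) (hFa : Fc V p (insert a s)) (hFb : Fc V p (insert b s))
    (hSa : S a) : S b := by
  by_contra hSb
  obtain ⟨ψ, hψ0, hψ, hψs, hψp⟩ := hC.strict hs
  obtain ⟨f, hf0, hf, hfs, hfp⟩ := hC.strict hFb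
  have haV := hFa.1 (Finset.mem_insert_self _ _)
  have hbV := hFb.1 (Finset.mem_insert_self _ _)
  obtain ⟨u, hu, hmin⟩ := Finset.exists_min_image
    (V.filter (fun v => v ∉ s ∧ Fc V p (insert v s) ∧ S v)) (fun v => f (p v) / ψ (p v))
    ⟨a, by simp [haV, ha, hFa, hSa]⟩
  simp only [Finset.mem_filter] at hu hmin
  obtain ⟨huV, hus, hFu, hSu⟩ := hu
  have hub : u ≠ b := fun h => hSb (h ▸ hSu)
  set c := f (p u) / ψ (p u) with hc
  have hψu := hψp u huV hus
  have hfu : 0 < f (p u) := hfp u huV (by simp [hub, hus])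
  have hc0 : 0 < c := div_pos hfu hψu
  have hfu2 : f (p u) = c * ψ (p u) := by rw [hc]; field_simp
  have hge : ∀ v ∈ V, 0 ≤ (f - c • ψ) (p v) := by
    refine hC.cone hFu (hne u hus hFu) _ ?_ ?_
    · intro v hv
      simp only [LinearMap.sub_apply, LinearMap.smul_apply, smul_eq_mul]
      rcases Finset.mem_insert.1 hv with rfl | hv
      · linarith
      · rw [hfs v (Finset.mem_insert_of_mem hv), hψs v hv]; ring
    · intro w hw hFw
      simp only [LinearMap.sub_apply, LinearMap.smul_apply, smul_eq_mul]
      have hwV := hFw.1 (Finset.mem_insert_self _ _)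
      have hws : w ∉ s := fun h => hw (Finset.mem_insert_of_mem h)
      have hwu : u ≠ w := fun h => hw (h ▸ Finset.mem_insert_self _ _)
      have h1 := hS u w hus hws hwu hFw hSu
      have h2 := hmin w ⟨hwV, hws, (hFw.mono (Finset.insert_subset_insert _ (Finset.subset_insert _ _))), h1⟩
      rw [le_div_iff₀ (hψp w hwV hws)] at h2
      linarith
  have h1 := hge b hbV
  simp only [LinearMap.sub_apply, LinearMap.smul_apply, smul_eq_mul, hfs b (Finset.mem_insert_self _ _)] at h1
  have := mul_pos hc0 (hψp b hbV hb)
  linarith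

/-- extension lemma: skew data on an independent set comes from an alternating form -/
theorem exists_alt (s : Finset ι) (hind : ∀ v ∈ s, ∃ α : Module.Dual ℝ W, α (p v) = 1 ∧
      ∀ u ∈ s, u ≠ v → α (p u) = 0)
    (m : ι → Module.Dual ℝ W) (hm : ∀ u ∈ s, ∀ w ∈ s, m u (p w) + m w (p u) = 0) :
    ∃ A : W →ₗ[ℝ] Module.Dual ℝ W, (∀ x, A x x = 0) ∧ ∀ v ∈ s, A (p v) = m v := by
  induction s using Finset.induction_on with
  | empty => exact ⟨0, by simp, by simp⟩
  | insert v s hv ih =>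
    obtain ⟨A, hA, hA2⟩ := ih
      (fun u hu => by
        obtain ⟨α, h1, h2⟩ := hind u (Finset.mem_insert_of_mem hu)
        exact ⟨α, h1, fun w hw => h2 w (Finset.mem_insert_of_mem hw)⟩)
      (fun u hu w hw => hm u (Finset.mem_insert_of_mem hu) w (Finset.mem_insert_of_mem hw))
    obtain ⟨α, hα1, hα2⟩ := hind v (Finset.mem_insert_self _ _)
    have hskew : ∀ x y, A x y = - A y x := by
      intro x y
      have := hA (x + y)
      simp only [map_add, LinearMap.add_apply, hA] at this
      linarith
    set n : Module.Dual ℝ W := m v - A (p v) with hn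
    have hnv : n (p v) = 0 := by
      have := hm v (Finset.mem_insert_self _ _) v (Finset.mem_insert_self _ _)
      rw [hn, LinearMap.sub_apply, hA]; linarith
    have hns : ∀ u ∈ s, n (p u) = 0 := by
      intro u hu
      have h1 := hm v (Finset.mem_insert_self _ _) u (Finset.mem_insert_of_mem hu)
      rw [hn, LinearMap.sub_apply, hskew, hA2 u hu]; linarith
    refine ⟨A + (α.smulRight n - n.smulRight α), ?_, ?_⟩
    · intro x
      simp [hA]; ring
    · intro u hu
      rcases Finset.mem_insert.1 hu with rfl | hu
      · ext y
        have e1 : m u y = n y + A (p u) y := by rw [hn]; simp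
        rw [e1]
        simp only [LinearMap.add_apply, LinearMap.sub_apply, LinearMap.smulRight_apply,
          LinearMap.smul_apply, smul_eq_mul, hα1, hnv]
        ring
      · ext y
        have : u ≠ v := fun h => hv (h ▸ hu)
        simp [hα2 u (Finset.mem_insert_of_mem hu) this, hns u hu, hA2 u hu]

theorem Cfg.face_ind (hC : Cfg V p) {s : Finset ι} (hs : Fc V p s) :
    ∀ v ∈ s, ∃ α : Module.Dual ℝ W, α (p v) = 1 ∧ ∀ u ∈ s, u ≠ v → α (p u) = 0 := by
  obtain ⟨hsV, φ, h0, hpos, hz⟩ := hs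
  intro v hv
  obtain ⟨α, h1, h2⟩ := hC.simp φ hpos h0 v (hsV hv) (hz v hv)
  exact ⟨α, h1, fun u hu hne => h2 u (hsV hu) hne (hz u hu)⟩

end basics

theorem matQ_id {ι : Type} (N : Finset ι) (M : ι → ι → ℝ) (t x : ι → ℝ)
    (hsym : ∀ u ∈ N, ∀ w ∈ N, M u w = M w u)
    (hMt : ∀ u ∈ N, ∑ w ∈ N, M u w * t w = 0) :
    2 * ∑ u ∈ N, (t u * x u) * ∑ w ∈ N, M u w * (t w * x w) =
      - ∑ u ∈ N, ∑ w ∈ N, M u w * t u * t w * (x u - x w) ^ 2 := by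
  have h1 : ∑ u ∈ N, ∑ w ∈ N, M u w * t u * t w * (x u) ^ 2 = 0 := by
    refine Finset.sum_eq_zero fun u hu => ?_
    have : ∑ w ∈ N, M u w * t u * t w * (x u) ^ 2 = (t u * x u ^ 2) * ∑ w ∈ N, M u w * t w := by
      rw [Finset.mul_sum]; refine Finset.sum_congr rfl fun w _ => by ring
    rw [this, hMt u hu, mul_zero]
  have h2 : ∑ u ∈ N, ∑ w ∈ N, M u w * t u * t w * (x w) ^ 2 = 0 := by
    rw [Finset.sum_comm]
    rw [← h1]
    refine Finset.sum_congr rfl fun u hu => Finset.sum_congr rfl fun w hw => ?_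
    rw [hsym u hu w hw]; ring
  have h3 : ∑ u ∈ N, ∑ w ∈ N, M u w * t u * t w * (x u - x w) ^ 2 =
      ∑ u ∈ N, ∑ w ∈ N, M u w * t u * t w * (x u) ^ 2 + ∑ u ∈ N, ∑ w ∈ N, M u w * t u * t w * (x w) ^ 2
      - 2 * ∑ u ∈ N, (t u * x u) * ∑ w ∈ N, M u w * (t w * x w) := by
    simp only [Finset.mul_sum]
    rw [← Finset.sum_add_distrib, ← Finset.sum_sub_distrib]
    refine Finset.sum_congr rfl fun u hu => ?_
    rw [← Finset.sum_add_distrib, ← Finset.sum_sub_distrib]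
    refine Finset.sum_congr rfl fun w hw => ?_
    ring
  rw [h3, h1, h2]; ring

theorem three_two (a b c a' b' c' : ℝ) : ∃ α β γ : ℝ, ¬ (α = 0 ∧ β = 0 ∧ γ = 0) ∧
    α * a + β * b + γ * c = 0 ∧ α * a' + β * b' + γ * c' = 0 := by
  let f : (Fin 3 → ℝ) →ₗ[ℝ] (Fin 2 → ℝ) := Matrix.mulVecLin !![a, b, c; a', b', c']
  have h := LinearMap.ker_ne_bot_of_finrank_lt (f := f) (by simp)
  obtain ⟨v, hv, hv0⟩ := Submodule.exists_mem_ne_zero_of_ne_bot h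
  have hv1 : f v = 0 := hv
  refine ⟨v 0, v 1, v 2, ?_, ?_, ?_⟩
  · rintro ⟨h0, h1, h2⟩
    apply hv0
    ext i
    fin_cases i <;> simp [h0, h1, h2]
  · have := congrFun hv1 0
    simp [f, Matrix.mulVec, dotProduct, Fin.sum_univ_three] at this
    linarith
  · have := congrFun hv1 1
    simp [f, Matrix.mulVec, dotProduct, Fin.sum_univ_three] at this
    linarith

theorem matrix_lemma {ι : Type} (N : Finset ι) (M : ι → ι → ℝ) (t t' g k : ι → ℝ)
    (hsym : ∀ u ∈ N, ∀ w ∈ N, M u w = M w u)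
    (hoff : ∀ u ∈ N, ∀ w ∈ N, u ≠ w → 0 ≤ M u w)
    (hconn : ∀ S : ι → Prop, (∀ u ∈ N, ∀ w ∈ N, u ≠ w → M u w ≠ 0 → S u → S w) →
      ∀ a ∈ N, ∀ b ∈ N, S a → S b)
    (ht : ∀ u ∈ N, t u ≠ 0)
    (hMt : ∀ u ∈ N, ∑ w ∈ N, M u w * t w = 0)
    (hcross : ∃ u1 w1 u2 w2 : ι, ∀ u ∈ N, ∀ w ∈ N, u ≠ w → M u w ≠ 0 → 0 < t u → t w < 0 →
      (u = u1 ∧ w = w1) ∨ (u = u2 ∧ w = w2))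
    (hMt' : ∀ u ∈ N, ∑ w ∈ N, M u w * t' w = 0)
    (ht' : ∀ c : ℝ, ¬ ∀ u ∈ N, t' u = c * t u)
    (hg : 0 < ∑ u ∈ N, g u * ∑ w ∈ N, M u w * g w)
    (hgk : ∑ u ∈ N, g u * ∑ w ∈ N, M u w * k w = 0)
    (hk : 0 ≤ ∑ u ∈ N, k u * ∑ w ∈ N, M u w * k w) :
    ∀ u ∈ N, ∑ w ∈ N, M u w * k w = 0 := by
  obtain ⟨u1, w1, u2, w2, hcr⟩ := hcross
  obtain ⟨α, β, γ, hne, e1, e2⟩ := three_two (g u1 / t u1 - g w1 / t w1) (k u1 / t u1 - k w1 / t w1)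
    (t' u1 / t u1 - t' w1 / t w1) (g u2 / t u2 - g w2 / t w2) (k u2 / t u2 - k w2 / t w2)
    (t' u2 / t u2 - t' w2 / t w2)
  set f : ι → ℝ := fun u => α * g u + β * k u + γ * t' u with hf
  set x : ι → ℝ := fun u => f u / t u with hx
  have hfx : ∀ u ∈ N, f u = t u * x u := fun u hu => by
    simp only [hx]; have := ht u hu; field_simp
  have hx1 : x u1 = x w1 := by
    simp only [hx, hf, add_div, mul_div_assoc]; linarith
  have hx2 : x u2 = x w2 := by
    simp only [hx, hf, add_div, mul_div_assoc]; linarith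
  have hterm : ∀ u ∈ N, ∀ w ∈ N, 0 ≤ M u w * t u * t w * (x u - x w) ^ 2 ∧
      (M u w * t u * t w * (x u - x w) ^ 2 = 0 → u ≠ w → M u w ≠ 0 → x u = x w) := by
    intro u hu w hw
    by_cases huw : u = w
    · subst huw; simp
    by_cases hM : M u w = 0
    · simp [hM]
    have hM0 : 0 < M u w := lt_of_le_of_ne (hoff u hu w hw huw) (Ne.symm hM)
    have htu := ht u hu
    have htw := ht w hw
    by_cases hxx : x u = x w
    · simp [hxx]
    have hpos : 0 < t u * t w := by
      rcases lt_or_gt_of_ne htu with h1 | h1 <;> rcases lt_or_gt_of_ne htw with h2 | h2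
      · exact mul_pos_of_neg_of_neg h1 h2
      · exfalso
        rcases hcr w hw u hu (Ne.symm huw) (by rwa [hsym w hw u hu]) h2 h1 with ⟨rfl, rfl⟩ | ⟨rfl, rfl⟩
        · exact hxx hx1.symm
        · exact hxx hx2.symm
      · exfalso
        rcases hcr u hu w hw huw hM h1 h2 with ⟨rfl, rfl⟩ | ⟨rfl, rfl⟩
        · exact hxx hx1
        · exact hxx hx2
      · exact mul_pos h1 h2
    have h3 : 0 < (x u - x w) ^ 2 := by
      have : x u - x w ≠ 0 := sub_ne_zero.2 hxx
      positivity
    have h4 : 0 < M u w * t u * t w * (x u - x w) ^ 2 := by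
      have := mul_pos (mul_pos hM0 hpos) h3
      linarith [this]
    exact ⟨h4.le, fun h => absurd h h4.ne'⟩
  have hBsym : ∀ a b : ι → ℝ, ∑ u ∈ N, a u * ∑ w ∈ N, M u w * b w = ∑ u ∈ N, b u * ∑ w ∈ N, M u w * a w := by
    intro a b
    simp only [Finset.mul_sum]
    rw [Finset.sum_comm]
    refine Finset.sum_congr rfl fun u hu => Finset.sum_congr rfl fun w hw => ?_
    rw [hsym w hw u hu]; ring
  have hMf : ∀ u ∈ N, ∑ w ∈ N, M u w * f w = α * (∑ w ∈ N, M u w * g w) + β * ∑ w ∈ N, M u w * k w := by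
    intro u hu
    have : ∑ w ∈ N, M u w * f w = α * (∑ w ∈ N, M u w * g w) + β * (∑ w ∈ N, M u w * k w)
      + γ * ∑ w ∈ N, M u w * t' w := by
      simp only [Finset.mul_sum, ← Finset.sum_add_distrib]
      refine Finset.sum_congr rfl fun w _ => by simp only [hf]; ring
    rw [this, hMt' u hu]; ring
  have hkg : ∑ u ∈ N, k u * ∑ w ∈ N, M u w * g w = 0 := by rw [hBsym, hgk]
  have htg : ∀ b : ι → ℝ, ∑ u ∈ N, t' u * ∑ w ∈ N, M u w * b w = 0 := by
    intro b
    rw [hBsym]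
    exact Finset.sum_eq_zero fun u hu => by rw [hMt' u hu, mul_zero]
  have hQ : ∑ u ∈ N, f u * ∑ w ∈ N, M u w * f w =
      α ^ 2 * (∑ u ∈ N, g u * ∑ w ∈ N, M u w * g w) + β ^ 2 * ∑ u ∈ N, k u * ∑ w ∈ N, M u w * k w := by
    have e : ∑ u ∈ N, f u * ∑ w ∈ N, M u w * f w =
       α ^ 2 * (∑ u ∈ N, g u * ∑ w ∈ N, M u w * g w) + β ^ 2 * (∑ u ∈ N, k u * ∑ w ∈ N, M u w * k w)
       + α * β * (∑ u ∈ N, g u * ∑ w ∈ N, M u w * k w) + α * β * (∑ u ∈ N, k u * ∑ w ∈ N, M u w * g w)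
       + γ * α * (∑ u ∈ N, t' u * ∑ w ∈ N, M u w * g w) + γ * β * (∑ u ∈ N, t' u * ∑ w ∈ N, M u w * k w) := by
      rw [Finset.sum_congr rfl fun u hu => by rw [hMf u hu]]
      rw [Finset.mul_sum, Finset.mul_sum N, Finset.mul_sum N, Finset.mul_sum N, Finset.mul_sum N,
        Finset.mul_sum N]
      simp only [← Finset.sum_add_distrib]
      refine Finset.sum_congr rfl fun u _ => by simp only [hf]; ring
    rw [e, hgk, hkg, htg, htg]; ring
  have hid := matQ_id N M t x hsym hMt
  have hQx : ∑ u ∈ N, (t u * x u) * ∑ w ∈ N, M u w * (t w * x w) = ∑ u ∈ N, f u * ∑ w ∈ N, M u w * f w := by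
    refine Finset.sum_congr rfl fun u hu => ?_
    rw [hfx u hu]
    congr 1
    refine Finset.sum_congr rfl fun w hw => by rw [hfx w hw]
  have hnn : 0 ≤ ∑ u ∈ N, ∑ w ∈ N, M u w * t u * t w * (x u - x w) ^ 2 :=
    Finset.sum_nonneg fun u hu => Finset.sum_nonneg fun w hw => (hterm u hu w hw).1
  rw [hQx, hQ] at hid
  have hb2 := mul_nonneg (sq_nonneg β) hk
  have ha2 := mul_nonneg (sq_nonneg α) hg.le
  have hα : α = 0 := by
    have : α ^ 2 * (∑ u ∈ N, g u * ∑ w ∈ N, M u w * g w) = 0 := by linarith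
    rcases mul_eq_zero.1 this with h | h
    · exact pow_eq_zero_iff (two_ne_zero) |>.1 h
    · exact absurd h hg.ne'
  have hz : ∑ u ∈ N, ∑ w ∈ N, M u w * t u * t w * (x u - x w) ^ 2 = 0 := by linarith
  have hz2 : ∀ u ∈ N, ∀ w ∈ N, u ≠ w → M u w ≠ 0 → x u = x w := by
    intro u hu w hw
    refine (hterm u hu w hw).2 ?_
    have h1 := (Finset.sum_eq_zero_iff_of_nonneg (fun u hu => Finset.sum_nonneg fun w hw => (hterm u hu w hw).1)).1 hz u hu
    exact (Finset.sum_eq_zero_iff_of_nonneg (fun w hw => (hterm u hu w hw).1)).1 h1 w hw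
  intro u hu
  have hxc : ∀ w ∈ N, x w = x u := fun w hw =>
    hconn (fun w => x w = x u) (fun a ha b hb hab hM h => (hz2 a ha b hb hab hM).symm.trans h) u hu w hw rfl
  have hfc : ∀ w ∈ N, β * k w + γ * t' w = x u * t w := by
    intro w hw
    have h1 := hfx w hw
    rw [hxc w hw] at h1
    simp only [hf, hα] at h1
    linarith
  have hβ : β ≠ 0 := by
    intro hβ
    have hγ : γ ≠ 0 := fun h => hne ⟨hα, hβ, h⟩
    refine ht' (x u / γ) fun w hw => ?_
    have := hfc w hw
    rw [hβ] at this
    field_simp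
    linarith
  have h1 : β * ∑ w ∈ N, M u w * k w = 0 := by
    have : β * ∑ w ∈ N, M u w * k w = x u * (∑ w ∈ N, M u w * t w) - γ * ∑ w ∈ N, M u w * t' w := by
      simp only [Finset.mul_sum, ← Finset.sum_sub_distrib]
      refine Finset.sum_congr rfl fun w hw => ?_
      have := hfc w hw
      linear_combination M u w * this
    rw [this, hMt u hu, hMt' u hu]; ring
  exact (mul_eq_zero.1 h1).resolve_left hβ

/-- the volume form rules -/
structure D4 {U : Type} [AddCommGroup U] [Module ℝ U]
    (D : U →ₗ[ℝ] U →ₗ[ℝ] U →ₗ[ℝ] U →ₗ[ℝ] ℝ) : Prop where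
  a1 : ∀ a b c, D a a b c = 0
  a2 : ∀ a b c, D a b b c = 0
  a3 : ∀ a b c, D a b c c = 0
  cr : ∀ a b c e x, D a b c e • x = D x b c e • a + D a x c e • b + D a b x e • c + D a b c x • e
  dep : ∀ a b c e, D a b c e = 0 → ∃ r : Fin 4 → ℝ, r ≠ 0 ∧ r 0 • a + r 1 • b + r 2 • c + r 3 • e = 0

theorem exists_D4 {U : Type} [AddCommGroup U] [Module ℝ U] [FiniteDimensional ℝ U]
    (h4 : Module.finrank ℝ U = 4) : ∃ D : U →ₗ[ℝ] U →ₗ[ℝ] U →ₗ[ℝ] U →ₗ[ℝ] ℝ, D4 D := by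
  let b := Module.finBasisOfFinrankEq ℝ U h4
  let D : U →ₗ[ℝ] U →ₗ[ℝ] U →ₗ[ℝ] U →ₗ[ℝ] ℝ := ∑ σ : Equiv.Perm (Fin 4), ((Equiv.Perm.sign σ : ℤ) : ℝ) •
    (b.coord (σ 0)).smulRight ((b.coord (σ 1)).smulRight ((b.coord (σ 2)).smulRight (b.coord (σ 3))))
  let MM : U → U → U → U → Matrix (Fin 4) (Fin 4) ℝ := fun a c e f => Matrix.of (fun i j => b.coord i ((![a, c, e, f] : Fin 4 → U) j))
  have hD : ∀ a c e f, D a c e f = Matrix.det (MM a c e f) := by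
    intro a c e f
    rw [Matrix.det_apply]
    simp only [D, LinearMap.sum_apply, LinearMap.smul_apply, LinearMap.smulRight_apply, Fin.prod_univ_four]
    refine Finset.sum_congr rfl fun σ _ => ?_
    simp [MM, Units.smul_def, mul_assoc]
  have hext : ∀ x y : U, (∀ i, b.coord i x = b.coord i y) → x = y := fun x y h =>
    b.ext_elem (fun i => by simpa using h i)
  refine ⟨D, ?_, ?_, ?_, ?_, ?_⟩
  · intro a c e
    rw [hD]
    exact Matrix.det_zero_of_column_eq (i := 0) (j := 1) (by decide) (fun k => rfl)
  · intro a c e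
    rw [hD]
    exact Matrix.det_zero_of_column_eq (i := 1) (j := 2) (by decide) (fun k => rfl)
  · intro a c e
    rw [hD]
    exact Matrix.det_zero_of_column_eq (i := 2) (j := 3) (by decide) (fun k => rfl)
  · intro a c e f x
    apply hext
    intro i
    have := congrFun (Matrix.mulVec_cramer (MM a c e f) (fun i => b.coord i x)) i
    simp only [Matrix.mulVec, dotProduct, Fin.sum_univ_four, Matrix.cramer_apply, Pi.smul_apply] at this
    have e0 : (MM a c e f).updateCol 0 (fun i => b.coord i x) = MM x c e f := by
      ext i j; fin_cases j <;> simp [MM, Matrix.updateCol_apply]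
    have e1 : (MM a c e f).updateCol 1 (fun i => b.coord i x) = MM a x e f := by
      ext i j; fin_cases j <;> simp [MM, Matrix.updateCol_apply]
    have e2 : (MM a c e f).updateCol 2 (fun i => b.coord i x) = MM a c x f := by
      ext i j; fin_cases j <;> simp [MM, Matrix.updateCol_apply]
    have e3 : (MM a c e f).updateCol 3 (fun i => b.coord i x) = MM a c e x := by
      ext i j; fin_cases j <;> simp [MM, Matrix.updateCol_apply]
    rw [e0, e1, e2, e3, ← hD, ← hD, ← hD, ← hD, ← hD] at this
    simp only [map_add, map_smul, smul_eq_mul] at this ⊢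
    simp [MM] at this ⊢
    linarith
  · intro a c e f h
    rw [hD] at h
    obtain ⟨r, hr, hr2⟩ := Matrix.exists_mulVec_eq_zero_iff.2 h
    refine ⟨r, hr, hext _ _ fun i => ?_⟩
    have := congrFun hr2 i
    simp only [Matrix.mulVec, dotProduct, Fin.sum_univ_four] at this
    simp only [map_add, map_smul, smul_eq_mul]
    simp [MM] at this ⊢
    linarith

section dehn
variable {ι U : Type} [DecidableEq ι] [AddCommGroup U] [Module ℝ U] {V : Finset ι} {p : ι → U}
  {D : U →ₗ[ℝ] U →ₗ[ℝ] U →ₗ[ℝ] U →ₗ[ℝ] ℝ} {o : U}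

theorem D4.s12 (h : D4 D) (a b c e : U) : D b a c e = - D a b c e := by
  have := h.a1 (a + b) c e
  simp only [map_add, LinearMap.add_apply, h.a1] at this
  linarith

theorem D4.s23 (h : D4 D) (a b c e : U) : D a c b e = - D a b c e := by
  have := h.a2 a (b + c) e
  simp only [map_add, LinearMap.add_apply, h.a2] at this
  linarith

theorem D4.s34 (h : D4 D) (a b c e : U) : D a b e c = - D a b c e := by
  have := h.a3 a b (c + e)
  simp only [map_add, LinearMap.add_apply, h.a3] at this
  linarith

theorem D4.a13 (h : D4 D) (a b c : U) : D a b a c = 0 := by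
  rw [h.s23, h.a1, neg_zero]

theorem D4.a14 (h : D4 D) (a b c : U) : D a b c a = 0 := by
  rw [h.s34, h.a13, neg_zero]

theorem D4.a24 (h : D4 D) (a b c : U) : D a b c b = 0 := by
  rw [h.s34, h.a2, neg_zero]

structure DCfg (V : Finset ι) (p : ι → U) (D : U →ₗ[ℝ] U →ₗ[ℝ] U →ₗ[ℝ] U →ₗ[ℝ] ℝ) (o : U) : Prop where
  hC : Cfg V p
  hD : D4 D
  fin : FiniteDimensional ℝ U
  h4 : Module.finrank ℝ U = 4
  hsum : ∑ v ∈ V, p v = o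

/-- a triangle -/
def Tr (V : Finset ι) (p : ι → U) (v u w : ι) : Prop := v ≠ u ∧ v ≠ w ∧ u ≠ w ∧ Fc V p {v, u, w}

theorem Tr.rot {v u w : ι} (h : Tr V p v u w) : Tr V p v w u :=
  ⟨h.2.1, h.1, h.2.2.1.symm, by rw [show ({v, w, u} : Finset ι) = {v, u, w} by ext; simp; tauto]; exact h.2.2.2⟩

theorem Tr.swap {v u w : ι} (h : Tr V p v u w) : Tr V p u v w :=
  ⟨h.1.symm, h.2.2.1, h.2.1, by rw [show ({u, v, w} : Finset ι) = {v, u, w} by ext; simp; tauto]; exact h.2.2.2⟩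

theorem DCfg.ho (h : DCfg V p D o) (φ : Module.Dual ℝ U) (h0 : φ ≠ 0) (hp : ∀ v ∈ V, 0 ≤ φ (p v)) : 0 < φ o := by
  rw [← h.hsum, map_sum]
  refine lt_of_le_of_ne (Finset.sum_nonneg hp) (fun hz => h0 (h.hC.sp φ ?_))
  exact (Finset.sum_eq_zero_iff_of_nonneg hp).1 hz.symm

theorem DCfg.ne (h : DCfg V p D o) {v u w : ι} (hT : Tr V p v u w) : D (p v) (p u) (p w) o ≠ 0 := by
  intro h0
  obtain ⟨r, hr, hr2⟩ := h.hD.dep _ _ _ _ h0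
  obtain ⟨h1, h2, h3, hF⟩ := hT
  have hF' := hF
  obtain ⟨_, φ, hφ0, hφ, hφz⟩ := hF'
  have ho := h.ho φ hφ0 hφ
  have e := congrArg φ hr2
  simp only [map_add, map_smul, smul_eq_mul, map_zero, hφz v (by simp), hφz u (by simp), hφz w (by simp)] at e
  have r3 : r 3 = 0 := by
    have : r 3 * φ o = 0 := by linarith
    exact (mul_eq_zero.1 this).resolve_right ho.ne'
  have hind := h.hC.face_ind hF
  obtain ⟨α, ha1, ha2⟩ := hind v (by simp)
  obtain ⟨β, hb1, hb2⟩ := hind u (by simp)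
  obtain ⟨γ, hc1, hc2⟩ := hind w (by simp)
  have ea := congrArg α hr2
  have eb := congrArg β hr2
  have ec := congrArg γ hr2
  simp only [map_add, map_smul, smul_eq_mul, map_zero, ha1, ha2 u (by simp) h1.symm, ha2 w (by simp) h2.symm, r3] at ea
  simp only [map_add, map_smul, smul_eq_mul, map_zero, hb1, hb2 v (by simp) h1, hb2 w (by simp) h3.symm, r3] at eb
  simp only [map_add, map_smul, smul_eq_mul, map_zero, hc1, hc2 v (by simp) h2, hc2 u (by simp) h3, r3] at ec
  apply hr
  ext i
  fin_cases i <;> simp <;> linarith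

theorem DCfg.K (h : DCfg V p D o) {a b c : U} {φ : Module.Dual ℝ U} (ha : φ a = 0) (hb : φ b = 0)
    (hc : φ c = 0) (x : U) : D a b c o * φ x = D a b c x * φ o := by
  have := congrArg φ (h.hD.cr a b c o x)
  simp only [map_add, map_smul, smul_eq_mul, ha, hb, hc] at this
  linarith

theorem DCfg.exTr (h : DCfg V p D o) {v u : ι} (hvu : v ≠ u) (hF : Fc V p {v, u}) : ∃ w, Tr V p v u w := by
  have := h.fin
  obtain ⟨w, hw, hFw⟩ := h.hC.exists_link hF (by rw [h.h4, Finset.card_pair hvu])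
  simp only [Finset.mem_insert, Finset.mem_singleton, not_or] at hw
  exact ⟨w, hvu, Ne.symm hw.1, Ne.symm hw.2, by
    rw [show ({v, u, w} : Finset ι) = {w, v, u} by ext; simp; tauto]; exact hFw⟩

theorem DCfg.two_pos (h : DCfg V p D o) {v u : ι} (hvu : v ≠ u) (hF : Fc V p {v, u}) :
    ∃ w, Tr V p v u w ∧ 0 < D (p v) (p u) (p w) o := by
  obtain ⟨φ, h0, hp, hz, hpos⟩ := h.hC.strict hF
  obtain ⟨w0, hw0⟩ := h.exTr hvu hF
  have hw0V : w0 ∈ V := hw0.2.2.2.1 (by simp)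
  have hne := h.ne hw0
  have hex : ∃ x ∈ V, 0 < D (p v) (p u) (p x) o := by
    by_contra hcon
    push Not at hcon
    have hs : ∑ x ∈ V, D (p v) (p u) (p x) o = 0 := by
      have : ∑ x ∈ V, D (p v) (p u) (p x) o = D (p v) (p u) (∑ x ∈ V, p x) o := by
        rw [map_sum, LinearMap.sum_apply]
      rw [this, h.hsum, h.hD.a3]
    exact hne ((Finset.sum_eq_zero_iff_of_nonpos hcon).1 hs w0 hw0V)
  obtain ⟨x0, hx0, hx0p⟩ := hex
  obtain ⟨w, hw, hmin⟩ := Finset.exists_min_image (V.filter (fun x => 0 < D (p v) (p u) (p x) o))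
    (fun x => φ (p x) / D (p v) (p u) (p x) o) ⟨x0, by simp [hx0, hx0p]⟩
  simp only [Finset.mem_filter] at hw hmin
  set c := φ (p w) / D (p v) (p u) (p w) o with hc
  have hwv : w ≠ v := by rintro rfl; have := hw.2; rw [h.hD.a13] at this; exact lt_irrefl _ this
  have hwu : w ≠ u := by rintro rfl; have := hw.2; rw [h.hD.a2] at this; exact lt_irrefl _ this
  have hφw := hpos w hw.1 (by simp [hwv, hwu])
  have hc0 : 0 < c := div_pos hφw hw.2
  refine ⟨w, ⟨hvu, hwv.symm, hwu.symm, ?_, φ - c • (D (p v) (p u)).flip o, ?_, ?_, ?_⟩, hw.2⟩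
  · intro a ha
    simp only [Finset.mem_insert, Finset.mem_singleton] at ha
    rcases ha with rfl | rfl | rfl
    · exact hF.1 (by simp)
    · exact hF.1 (by simp)
    · exact hw.1
  · intro hcon
    have := LinearMap.congr_fun hcon o
    simp only [LinearMap.sub_apply, LinearMap.smul_apply, LinearMap.flip_apply, h.hD.a3, smul_eq_mul,
      LinearMap.zero_apply] at this
    have := h.ho φ h0 hp
    linarith
  · intro x hx
    simp only [LinearMap.sub_apply, LinearMap.smul_apply, LinearMap.flip_apply, smul_eq_mul]
    by_cases hx2 : 0 < D (p v) (p u) (p x) o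
    · have := hmin x ⟨hx, hx2⟩
      rw [le_div_iff₀ hx2] at this
      linarith
    · have := hp x hx
      push Not at hx2
      nlinarith
  · intro x hx
    simp only [LinearMap.sub_apply, LinearMap.smul_apply, LinearMap.flip_apply, smul_eq_mul]
    simp only [Finset.mem_insert, Finset.mem_singleton] at hx
    rcases hx with rfl | rfl | rfl
    · rw [hz _ (by simp), h.hD.a13]; ring
    · rw [hz _ (by simp), h.hD.a2]; ring
    · rw [hc]; have := hw.2.ne'; field_simp; ring

theorem DCfg.two_uniq (h : DCfg V p D o) {v u w w' : ι} (hT : Tr V p v u w) (hT' : Tr V p v u w')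
    (hp : 0 < D (p v) (p u) (p w) o) (hp' : 0 < D (p v) (p u) (p w') o) : w = w' := by
  by_contra hne
  have main : ∀ w w', Tr V p v u w → Tr V p v u w' → w ≠ w' → 0 < D (p v) (p u) (p w) o →
      0 < D (p v) (p u) (p w) (p w') := by
    intro w w' hT hT' hne hp
    obtain ⟨φ, h0, hp0, hz, hpos⟩ := h.hC.strict hT.2.2.2
    have h1 := h.K (hz v (by simp)) (hz u (by simp)) (hz w (by simp)) (p w')
    have h2 := hpos w' (hT'.2.2.2.1 (by simp)) (by
      simp only [Finset.mem_insert, Finset.mem_singleton, not_or]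
      exact ⟨hT'.2.1.symm, hT'.2.2.1.symm, Ne.symm hne⟩)
    have h3 := h.ho φ h0 hp0
    have h4 := mul_pos hp h2
    rw [h1] at h4
    exact (pos_iff_pos_of_mul_pos h4).2 h3
  have h1 := main w w' hT hT' hne hp
  have h2 := main w' w hT' hT (Ne.symm hne) hp'
  rw [h.hD.s34] at h2
  linarith

/-- the two triangles at an edge -/
theorem DCfg.two (h : DCfg V p D o) {v u : ι} (hvu : v ≠ u) (hF : Fc V p {v, u}) :
    ∃ w w', 0 < D (p v) (p u) (p w) o ∧ D (p v) (p u) (p w') o < 0 ∧ w ≠ w' ∧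
      ∀ x, Tr V p v u x ↔ (x = w ∨ x = w') := by
  obtain ⟨w, hw, hwp⟩ := h.two_pos hvu hF
  obtain ⟨w', hw', hwp'⟩ := h.two_pos hvu.symm (by rwa [Finset.pair_comm])
  refine ⟨w, w', hwp, ?_, ?_, ?_⟩
  · rw [h.hD.s12] at hwp'; linarith
  · rintro rfl; rw [h.hD.s12] at hwp'; linarith
  · intro x
    constructor
    · intro hx
      rcases lt_or_gt_of_ne (h.ne hx) with h1 | h1
      · right
        refine h.two_uniq hx.swap hw' ?_ hwp'
        rw [h.hD.s12]; linarith
      · left; exact h.two_uniq hx hw h1 hwp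
    · rintro (rfl | rfl)
      · exact hw
      · exact hw'.swap

theorem DCfg.TrV {v u w : ι} (hT : Tr V p v u w) : v ∈ V ∧ u ∈ V ∧ w ∈ V :=
  ⟨hT.2.2.2.1 (by simp), hT.2.2.2.1 (by simp), hT.2.2.2.1 (by simp)⟩

theorem sum_two {X : Type} [AddCommMonoid X] {Q : ι → Prop} {w w' : ι} (hw : w ∈ V) (hw' : w' ∈ V)
    (hne : w ≠ w') (hQ : ∀ x, Q x ↔ (x = w ∨ x = w')) (F : ι → X) :
    ∑ x ∈ V, (if Q x then F x else 0) = F w + F w' := by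
  have h1 : ∀ x ∈ V, (if Q x then F x else 0) = (if x = w then F x else 0) + (if x = w' then F x else 0) := by
    intro x _
    by_cases h1 : x = w
    · subst h1; simp [hQ, hne]
    · by_cases h2 : x = w'
      · subst h2; simp [hQ, h1]
      · simp [hQ, h1, h2]
  rw [Finset.sum_congr rfl h1, Finset.sum_add_distrib]
  simp [hw, hw']

/-- a form killing two independent vectors is a multiple of the volume form -/
theorem DCfg.bform (h : DCfg V p D o) {a b c : U} (hne : D a b c o ≠ 0) (B : U →ₗ[ℝ] Module.Dual ℝ U)
    (hB : ∀ x, B x x = 0) (ha : B a = 0) (hb : B b = 0) :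
    ∃ l : ℝ, ∀ x y, B x y = l * D a b x y := by
  have hskew : ∀ (B : U →ₗ[ℝ] Module.Dual ℝ U), (∀ x, B x x = 0) → ∀ x y, B x y = - B y x := by
    intro B hB x y
    have := hB (x + y)
    simp only [map_add, LinearMap.add_apply, hB] at this
    linarith
  have gen : ∀ (B : U →ₗ[ℝ] Module.Dual ℝ U), (∀ x, B x x = 0) → B a = 0 → B b = 0 → ∀ x y,
      D a b c o * (D a b c o * B x y) = (D a b x o * D a b c y - D a b c x * D a b y o) * B c o := by
    intro B hB ha hb x y
    have hs := hskew B hB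
    have h1 : ∀ z, B z a = 0 := fun z => by rw [hs, ha]; simp
    have h2 : ∀ z, B z b = 0 := fun z => by rw [hs, hb]; simp
    have e1 : ∀ x z, D a b c o * B x z = D a b x o * B c z + D a b c x * B o z := by
      intro x z
      have := LinearMap.congr_fun (congrArg B (h.hD.cr a b c o x)) z
      simp only [map_add, map_smul, LinearMap.add_apply, LinearMap.smul_apply, smul_eq_mul, ha, hb,
        LinearMap.zero_apply] at this
      linarith
    have e2 : D a b c o * B c y = D a b c y * B c o := by
      have := e1 y c
      rw [hB c, hs y c, hs o c] at this
      linarith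
    have e3 : D a b c o * B o y = - D a b y o * B c o := by
      have := e1 y o
      rw [hB o, hs y o] at this
      linarith
    rw [e1, mul_add]
    linear_combination (D a b x o) * e2 + (D a b c x) * e3
  refine ⟨B c o / D a b c o, fun x y => ?_⟩
  have g1 := gen B hB ha hb x y
  have g2 := gen (D a b) (h.hD.a3 a b) (by ext z; simpa using h.hD.a13 a b z) (by ext z; simpa using h.hD.a2 a b z) x y
  field_simp
  have : D a b c o * (D a b c o * B x y) = D a b x y * B c o * D a b c o := by
    rw [g1]
    have : (D a b x o * D a b c y - D a b c x * D a b y o) = D a b x y * D a b c o := by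
      have := mul_right_cancel₀ hne (g2.symm.trans (by ring : _ = (D a b x y * D a b c o) * D a b c o))
      exact this
    rw [this]; ring
  have := mul_left_cancel₀ hne (this.trans (by ring : _ = D a b c o * (D a b x y * B c o)))
  linarith

end dehn

section dehn
variable {ι U : Type} [DecidableEq ι] [AddCommGroup U] [Module ℝ U] {V : Finset ι} {p : ι → U}
  {D : U →ₗ[ℝ] U →ₗ[ℝ] U →ₗ[ℝ] U →ₗ[ℝ] ℝ} {o : U}

theorem DCfg.ycomb (h : DCfg V p D o) {v u : ι} (hvu : v ≠ u) (hF : Fc V p {v, u}) :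
    ∃ a κ c : ℝ, 0 < c ∧
      ∑ w ∈ V, (if Tr V p v u w then |D (p v) (p u) (p w) o|⁻¹ • p w else 0) = a • p v + κ • p u + c • o := by
  obtain ⟨w, w', hp, hn, hne, hQ⟩ := h.two hvu hF
  have hT := (hQ w).2 (Or.inl rfl)
  have hT' := (hQ w').2 (Or.inr rfl)
  rw [sum_two (DCfg.TrV hT).2.2 (DCfg.TrV hT').2.2 hne hQ, abs_of_pos hp, abs_of_neg hn]
  set y := (D (p v) (p u) (p w) o)⁻¹ • p w + (-D (p v) (p u) (p w') o)⁻¹ • p w' with hy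
  have hcr := h.hD.cr (p v) (p u) (p w) o y
  have h1 : D (p v) (p u) y o = 0 := by
    rw [hy]
    simp only [map_add, map_smul, LinearMap.add_apply, LinearMap.smul_apply, smul_eq_mul]
    have := hp.ne'
    have := hn.ne
    field_simp
    ring
  have h2 : 0 < D (p v) (p u) (p w) y := by
    rw [hy]
    simp only [map_add, map_smul, smul_eq_mul, h.hD.a3]
    obtain ⟨φ, h0, hp0, hz, hpos⟩ := h.hC.strict hT.2.2.2
    have h1 := h.K (hz v (by simp)) (hz u (by simp)) (hz w (by simp)) (p w')
    have h2 := hpos w' (hT'.2.2.2.1 (by simp)) (by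
      simp only [Finset.mem_insert, Finset.mem_singleton, not_or]
      exact ⟨hT'.2.1.symm, hT'.2.2.1.symm, Ne.symm hne⟩)
    have h3 := h.ho φ h0 hp0
    have h4 := mul_pos hp h2
    rw [h1] at h4
    have h5 := (pos_iff_pos_of_mul_pos h4).2 h3
    have : 0 < (-D (p v) (p u) (p w') o)⁻¹ := inv_pos.2 (by linarith)
    have := mul_pos this h5
    linarith
  rw [h1, zero_smul, add_zero] at hcr
  refine ⟨D y (p u) (p w) o / D (p v) (p u) (p w) o, D (p v) y (p w) o / D (p v) (p u) (p w) o,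
    D (p v) (p u) (p w) y / D (p v) (p u) (p w) o, div_pos h2 hp, ?_⟩
  have : y = (D (p v) (p u) (p w) o)⁻¹ • (D (p v) (p u) (p w) o • y) := by
    rw [smul_smul, inv_mul_cancel₀ hp.ne', one_smul]
  conv_lhs => rw [this, hcr]
  simp only [smul_add, smul_smul, div_eq_inv_mul]

/-- crossing uniqueness -/
theorem DCfg.cross (h : DCfg V p D o) {v u w u' w' : ι} (hT : Tr V p v u w) (hT' : Tr V p v u' w')
    (ℓ : Module.Dual ℝ U) (y : U)
    (h1 : 0 < ℓ (p u)) (h2 : ℓ (p w) < 0) (h1' : 0 < ℓ (p u')) (h2' : ℓ (p w') < 0)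
    {a b c a' b' c' : ℝ} (hb : 0 < b) (hb' : 0 < b')
    (hz : ℓ (p u) • p w - ℓ (p w) • p u = a • p v + b • y + c • o)
    (hz' : ℓ (p u') • p w' - ℓ (p w') • p u' = a' • p v + b' • y + c' • o) : u = u' ∧ w = w' := by
  have gen : ∀ (u w u' w' : ι) (a b c a' b' c' : ℝ), Tr V p v u w → Tr V p v u' w' →
      0 < ℓ (p u) → ℓ (p w) < 0 → 0 < ℓ (p u') → ℓ (p w') < 0 → 0 < b → 0 < b' →
      ℓ (p u) • p w - ℓ (p w) • p u = a • p v + b • y + c • o →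
      ℓ (p u') • p w' - ℓ (p w') • p u' = a' • p v + b' • y + c' • o →
      b * c' - b' * c ≤ 0 → u = u' ∧ w = w' := by
    intro u w u' w' a b c a' b' c' hT hT' h1 h2 h1' h2' hb hb' hz hz' hle
    obtain ⟨φ, h0, hp0, hz0, hpos⟩ := h.hC.strict hT.2.2.2
    have e1 := congrArg φ hz
    have e2 := congrArg φ hz'
    simp only [map_sub, map_add, map_smul, smul_eq_mul, hz0 v (by simp), hz0 u (by simp), hz0 w (by simp)] at e1 e2
    have ho := h.ho φ h0 hp0
    have pu := hp0 u' (DCfg.TrV hT').2.1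
    have pw := hp0 w' (DCfg.TrV hT').2.2
    have e3 : b * (ℓ (p u') * φ (p w') - ℓ (p w') * φ (p u')) = (b * c' - b' * c) * φ o := by
      rw [e2]; linear_combination (-b') * e1
    have q1 : 0 ≤ ℓ (p u') * φ (p w') := mul_nonneg h1'.le pw
    have q2 : 0 ≤ - ℓ (p w') * φ (p u') := mul_nonneg (by linarith) pu
    have q3 : b * (ℓ (p u') * φ (p w') - ℓ (p w') * φ (p u')) ≤ 0 := by
      rw [e3]; exact mul_nonpos_of_nonpos_of_nonneg hle ho.le
    have q4 : (ℓ (p u') * φ (p w') - ℓ (p w') * φ (p u')) ≤ 0 := by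
      by_contra hcon
      push Not at hcon
      have := mul_pos hb hcon
      linarith
    have r1 : φ (p w') = 0 := by
      have : ℓ (p u') * φ (p w') = 0 := by linarith
      exact (mul_eq_zero.1 this).resolve_left h1'.ne'
    have r2 : φ (p u') = 0 := by
      have : ℓ (p w') * φ (p u') = 0 := by linarith
      exact (mul_eq_zero.1 this).resolve_left h2'.ne
    have s1 : w' ∈ ({v, u, w} : Finset ι) := by
      by_contra hcon
      have := hpos w' (DCfg.TrV hT').2.2 hcon
      linarith
    have s2 : u' ∈ ({v, u, w} : Finset ι) := by
      by_contra hcon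
      have := hpos u' (DCfg.TrV hT').2.1 hcon
      linarith
    simp only [Finset.mem_insert, Finset.mem_singleton] at s1 s2
    constructor
    · rcases s2 with rfl | rfl | rfl
      · exact absurd rfl hT'.1
      · rfl
      · linarith
    · rcases s1 with rfl | rfl | rfl
      · exact absurd rfl hT'.2.1
      · linarith
      · rfl
  rcases le_total (b * c' - b' * c) 0 with hle | hle
  · exact gen u w u' w' a b c a' b' c' hT hT' h1 h2 h1' h2' hb hb' hz hz' hle
  · have := gen u' w' u w a' b' c' a b c hT' hT h1' h2' h1 h2 hb' hb hz' hz (by linarith)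
    exact ⟨this.1.symm, this.2.symm⟩

theorem DCfg.loc (h : DCfg V p D o) {v : ι} (hv : Fc V p {v}) (lam hh : ι → ℝ) (μ : ℝ)
    (th : ι → ι → Module.Dual ℝ U)
    (hth : ∀ u w, Tr V p v u w → th u w (p v) = hh v ∧ th u w (p u) = hh u ∧ th u w (p w) = hh w ∧
      th u w o = 0)
    (hlam0 : ∀ u, ¬ (v ≠ u ∧ Fc V p {v, u}) → lam u = 0)
    (hlam : ∀ u, v ≠ u → Fc V p {v, u} → ∀ x,
      ∑ w ∈ V, (if Tr V p v u w then (D (p v) (p u) (p w) o / |D (p v) (p u) (p w) o|) * th u w x else 0)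
        = lam u * D (p v) (p u) x o)
    (hμ : ∑ u ∈ V, lam u • p u = μ • p v)
    (hq : 0 ≤ ∑ u ∈ V, lam u * hh u - μ * hh v) :
    (∀ u, lam u = 0) := by
  have := h.fin
  have hvV : v ∈ V := hv.1 (by simp)
  -- base point
  obtain ⟨u0, hu0, hFu0⟩ := h.hC.exists_link hv (by rw [h.h4]; simp)
  have hvu0 : v ≠ u0 := by
    intro h; apply hu0; simp [h]
  have hFu0' : Fc V p {v, u0} := by rw [Finset.pair_comm]; exact hFu0
  obtain ⟨w0, hT0⟩ := h.exTr hvu0 hFu0'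
  set θ := th u0 w0 with hθ
  obtain ⟨hθv, -, -, hθo⟩ := hth u0 w0 hT0
  rw [← hθ] at hθv hθo
  set N := V.filter (fun u => v ≠ u ∧ Fc V p {v, u}) with hN
  have memN : ∀ u, u ∈ N ↔ v ≠ u ∧ Fc V p {v, u} := by
    intro u
    rw [hN, Finset.mem_filter]
    exact ⟨fun h => h.2, fun h => ⟨h.2.1 (by simp), h⟩⟩
  have hTN : ∀ {u w}, Tr V p v u w → u ∈ N ∧ w ∈ N := by
    intro u w hT
    rw [memN, memN]
    exact ⟨⟨hT.1, hT.2.2.2.mono (by intro x; simp; tauto)⟩, hT.2.1, hT.2.2.2.mono (by intro x; simp; tauto)⟩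
  have hy : ∀ u, v ≠ u ∧ Fc V p {v, u} → ∃ a κ c : ℝ, 0 < c ∧
      ∑ w ∈ V, (if Tr V p v u w then |D (p v) (p u) (p w) o|⁻¹ • p w else 0) = a • p v + κ • p u + c • o :=
    fun u hu => h.ycomb hu.1 hu.2
  choose! a κ c hc hy using hy
  let M : ι → ι → ℝ := fun u w => if u = w then - κ u else if Tr V p v u w then |D (p v) (p u) (p w) o|⁻¹ else 0
  have hMsum : ∀ (f : ι → ℝ), ∀ u ∈ N, ∑ w ∈ N, M u w * f w =
      ∑ w ∈ V, (if Tr V p v u w then |D (p v) (p u) (p w) o|⁻¹ * f w else 0) - κ u * f u := by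
    intro f u hu
    have e1 : ∑ w ∈ V, (if Tr V p v u w then |D (p v) (p u) (p w) o|⁻¹ * f w else 0) =
        ∑ w ∈ N, (if Tr V p v u w then |D (p v) (p u) (p w) o|⁻¹ * f w else 0) := by
      symm
      apply Finset.sum_subset (Finset.filter_subset _ _)
      intro w _ hw
      rw [if_neg]
      intro hT
      exact hw (hTN hT).2
    have e2 : κ u * f u = ∑ w ∈ N, if u = w then κ u * f w else 0 := by
      rw [Finset.sum_ite_eq, if_pos hu]
    rw [e1, e2, ← Finset.sum_sub_distrib]
    refine Finset.sum_congr rfl fun w _ => ?_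
    simp only [M]
    by_cases huw : u = w
    · subst huw
      have : ¬ Tr V p v u u := fun hT => hT.2.2.1 rfl
      simp [this]
    · simp only [huw, if_false, sub_zero]
      split_ifs <;> simp
  have hlin : ∀ (ℓ : Module.Dual ℝ U), ∀ u ∈ N, ∑ w ∈ N, M u w * ℓ (p w) = a u * ℓ (p v) + c u * ℓ o := by
    intro ℓ u hu
    rw [hMsum _ u hu]
    have := congrArg ℓ (hy u ((memN u).1 hu))
    simp only [map_add, map_smul, smul_eq_mul, map_sum, apply_ite ℓ, map_zero] at this
    rw [this]; ring
  set k : ι → ℝ := fun u => hh u - θ (p u) with hk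
  have hMk : ∀ u ∈ N, ∑ w ∈ N, M u w * k w = lam u := by
    intro u hu
    rw [hMsum _ u hu]
    have huN := (memN u).1 hu
    obtain ⟨w, w', hp, hn, hne, hQ⟩ := h.two huN.1 huN.2
    have hT := (hQ w).2 (Or.inl rfl)
    have hT' := (hQ w').2 (Or.inr rfl)
    have hwV := (DCfg.TrV hT).2.2
    have hwV' := (DCfg.TrV hT').2.2
    have l1 := hlam u huN.1 huN.2 (p w)
    have y1 := congrArg (fun z => D (p v) (p w) z o) (hy u huN)
    rw [sum_two hwV hwV' hne hQ] at l1 ⊢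
    simp only [sum_two hwV hwV' hne hQ, abs_of_pos hp, abs_of_neg hn, map_add, map_smul, LinearMap.add_apply,
      LinearMap.smul_apply, smul_eq_mul, h.hD.a13, h.hD.a3, h.hD.a2] at y1
    rw [abs_of_pos hp, abs_of_neg hn] at l1 ⊢
    -- values of th
    obtain ⟨t1, t2, t3, t4⟩ := hth u w hT
    obtain ⟨t1', t2', t3', t4'⟩ := hth u w' hT'
    have cr := congrArg (th u w' - θ) (h.hD.cr (p v) (p u) (p w') o (p w))
    simp only [map_add, map_smul, LinearMap.sub_apply, smul_eq_mul, t1', t2', t3', t4', hθv, hθo] at cr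
    rw [t3] at l1
    have s1 := h.hD.s23 (p v) (p u) (p w) o
    simp only [hk]
    rw [s1] at y1
    set d := D (p v) (p u) (p w) o with hd
    set d' := D (p v) (p u) (p w') o with hd'
    set e := D (p v) (p w) (p w') o with he
    have hd0 : d ≠ 0 := hp.ne'
    have hd0' : d' ≠ 0 := hn.ne
    apply mul_right_cancel₀ hd0
    rw [← l1]
    have y2 : e = κ u * d * d' := by
      have y3 : (-d')⁻¹ * e = - (κ u * d) := by linarith
      have y4 : e = (-d') * ((-d')⁻¹ * e) := by
        rw [← mul_assoc, mul_inv_cancel₀ (neg_ne_zero.2 hd0'), one_mul]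
      rw [y4, y3]; ring
    have cr2 : th u w' (p w) = θ (p w) + (e * (hh u - θ (p u)) + d * (hh w' - θ (p w'))) / d' := by
      field_simp
      linarith
    rw [cr2, y2]
    field_simp
    ring
  -- generic functional
  have hgen : ∃ y : U, ∀ u : N, ((D (p v)).flip (p u)).flip o y ≠ 0 := by
    apply Module.Dual.exists_forall_ne_zero_of_forall_exists (fun u : N => ((D (p v)).flip (p u)).flip o)
    rintro ⟨u, hu⟩
    have huN := (memN u).1 hu
    obtain ⟨w, hT⟩ := h.exTr huN.1 huN.2
    refine ⟨p w, ?_⟩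
    simp only [LinearMap.flip_apply]
    rw [h.hD.s23]
    exact neg_ne_zero.2 (h.ne hT)
  obtain ⟨y, hygen⟩ := hgen
  have hygen' : ∀ u ∈ N, D (p v) y (p u) o ≠ 0 := fun u hu => hygen ⟨u, hu⟩
  set ℓ : Module.Dual ℝ U := (D (p v) y).flip o with hℓ
  set ℓ' : Module.Dual ℝ U := (D (p v) (p u0)).flip o with hℓ'
  have hℓa : ∀ x, ℓ x = D (p v) y x o := fun x => rfl
  have hℓa' : ∀ x, ℓ' x = D (p v) (p u0) x o := fun x => rfl
  obtain ⟨ψ, hψ0, hψp, hψz, hψpos⟩ := h.hC.strict hv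
  have hψv : ψ (p v) = 0 := hψz v (by simp)
  have hψo := h.ho ψ hψ0 hψp
  have hψN : ∀ u ∈ N, 0 < ψ (p u) := fun u hu =>
    hψpos u (Finset.mem_filter.1 hu).1 (by simpa using ((memN u).1 hu).1.symm)
  have hsumN : ∀ f : ι → ℝ, ∑ u ∈ V, lam u * f u = ∑ u ∈ N, lam u * f u := by
    intro f
    symm
    apply Finset.sum_subset (Finset.filter_subset _ _)
    intro w _ hw
    rw [hlam0 w (fun hh => hw ((memN w).2 hh)), zero_mul]
  have hsumφ : ∀ φ : Module.Dual ℝ U, ∑ u ∈ N, lam u * φ (p u) = μ * φ (p v) := by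
    intro φ
    rw [← hsumN]
    have := congrArg φ hμ
    simpa only [map_sum, map_smul, smul_eq_mul] using this
  have hu0N : u0 ∈ N := (memN u0).2 ⟨hvu0, hFu0'⟩
  have concl : ∀ u ∈ N, ∑ w ∈ N, M u w * k w = 0 := by
    refine matrix_lemma N M (fun u => ℓ (p u)) (fun u => ℓ' (p u)) (fun u => ψ (p u)) k
      ?_ ?_ ?_ ?_ ?_ ?_ ?_ ?_ ?_ ?_ ?_
    · intro u _ w _
      simp only [M]
      by_cases huw : u = w
      · subst huw; rfl
      · have huw' : ¬ w = u := fun h => huw h.symm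
        simp only [huw, huw', if_false]
        by_cases hT : Tr V p v u w
        · rw [if_pos hT, if_pos hT.rot, h.hD.s23, abs_neg]
        · rw [if_neg hT, if_neg (fun hT' => hT hT'.rot)]
    · intro u _ w _ huw
      simp only [M, huw, if_false]
      split_ifs
      · positivity
      · exact le_rfl
    · intro S hS a ha b hb hSa
      have haN := (memN a).1 ha
      have hbN := (memN b).1 hb
      refine h.hC.conn hv ?_ (fun x => S x) ?_ (a := a) (b := b) ?_ ?_ ?_ ?_ hSa
      · intro x hx hFx
        exact h.hC.exists_link hFx (by rw [h.h4, Finset.card_insert_of_notMem hx]; simp)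
      · intro x z hx hz hxz hF hSx
        have hT : Tr V p v x z := by
          refine ⟨fun h => hx (by simp [h]), fun h => hz (by simp [h]), hxz, ?_⟩
          rw [show ({v, x, z} : Finset ι) = {z, x, v} by ext; simp; tauto]
          exact hF
        refine hS x (hTN hT).1 z (hTN hT).2 hxz ?_ hSx
        simp only [M, hxz, if_false, if_pos hT]
        exact inv_ne_zero (abs_ne_zero.2 (h.ne hT))
      · simpa using haN.1.symm
      · simpa using hbN.1.symm
      · rw [show (insert a {v} : Finset ι) = {v, a} by ext; simp; tauto]; exact haN.2
      · rw [show (insert b {v} : Finset ι) = {v, b} by ext; simp; tauto]; exact hbN.2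
    · intro u hu
      exact hygen' u hu
    · intro u hu
      rw [hlin ℓ u hu, hℓa, hℓa, h.hD.a13, h.hD.a3]; ring
    · -- crossings
      have hcomb : ∀ u w, Tr V p v u w → 0 < ℓ (p u) → ℓ (p w) < 0 → ∃ a b c : ℝ, b ≠ 0 ∧
          ℓ (p u) • p w - ℓ (p w) • p u = a • p v + b • y + c • o := by
        intro u w hT hu hw
        have hcr := h.hD.cr (p v) y (p u) o (ℓ (p u) • p w - ℓ (p w) • p u)
        have hz0 : D (p v) y (ℓ (p u) • p w - ℓ (p w) • p u) o = 0 := by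
          simp only [map_sub, map_smul, LinearMap.sub_apply, LinearMap.smul_apply, smul_eq_mul]
          rw [← hℓa, ← hℓa]; ring
        rw [hz0, zero_smul, add_zero] at hcr
        have hΔ : D (p v) y (p u) o ≠ 0 := hygen' u (hTN hT).1
        set z := ℓ (p u) • p w - ℓ (p w) • p u with hz
        refine ⟨D z y (p u) o / D (p v) y (p u) o, D (p v) z (p u) o / D (p v) y (p u) o,
          D (p v) y (p u) z / D (p v) y (p u) o, ?_, ?_⟩
        · refine div_ne_zero ?_ hΔ
          rw [hz]
          simp only [map_sub, map_smul, LinearMap.sub_apply, LinearMap.smul_apply, smul_eq_mul, h.hD.a2]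
          rw [h.hD.s23]
          have := mul_ne_zero hu.ne' (h.ne hT)
          intro hcon
          apply this
          linarith
        · have : z = (D (p v) y (p u) o)⁻¹ • (D (p v) y (p u) o • z) := by
            rw [smul_smul, inv_mul_cancel₀ hΔ, one_smul]
          conv_lhs => rw [this, hcr]
          simp only [smul_add, smul_smul, div_eq_inv_mul]
      have hex : ∀ y : U, ∃ u1 w1 : ι, ∀ u w, Tr V p v u w → 0 < ℓ (p u) → ℓ (p w) < 0 →
          (∃ a b c : ℝ, 0 < b ∧ ℓ (p u) • p w - ℓ (p w) • p u = a • p v + b • y + c • o) →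
          u = u1 ∧ w = w1 := by
        intro y
        by_cases hE : ∃ u w, Tr V p v u w ∧ 0 < ℓ (p u) ∧ ℓ (p w) < 0 ∧
          (∃ a b c : ℝ, 0 < b ∧ ℓ (p u) • p w - ℓ (p w) • p u = a • p v + b • y + c • o)
        · obtain ⟨u1, w1, hT1, hu1, hw1, a1, b1, c1, hb1, hz1⟩ := hE
          refine ⟨u1, w1, ?_⟩
          rintro u w hT hu hw ⟨a, b, c, hb, hz⟩
          exact h.cross hT hT1 ℓ y hu hw hu1 hw1 hb hb1 hz hz1
        · refine ⟨v, v, fun u w hT hu hw hz => absurd ⟨u, w, hT, hu, hw, hz⟩ hE⟩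
      obtain ⟨u1, w1, hx1⟩ := hex y
      obtain ⟨u2, w2, hx2⟩ := hex (-y)
      refine ⟨u1, w1, u2, w2, ?_⟩
      intro u hu w hw huw hM hlu hlw
      have hT : Tr V p v u w := by
        by_contra hT
        apply hM
        simp only [M, huw, hT, if_false]
      obtain ⟨a, b, c, hb, hz⟩ := hcomb u w hT hlu hlw
      rcases lt_or_gt_of_ne hb with hb | hb
      · right
        exact hx2 u w hT hlu hlw ⟨a, -b, c, by linarith, by rw [hz]; simp⟩
      · left
        exact hx1 u w hT hlu hlw ⟨a, b, c, hb, hz⟩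
    · intro u hu
      rw [hlin ℓ' u hu, hℓa', hℓa', h.hD.a13, h.hD.a3]; ring
    · intro c hcon
      have e1 := hcon u0 hu0N
      simp only [hℓa', h.hD.a2] at e1
      have hc0 : c = 0 := by
        rcases mul_eq_zero.1 e1.symm with h | h
        · exact h
        · exact absurd h (hygen' u0 hu0N)
      have e2 := hcon w0 (hTN hT0).2
      rw [hc0, zero_mul] at e2
      exact h.ne hT0 e2
    · refine Finset.sum_pos (fun u hu => ?_) ⟨u0, hu0N⟩
      rw [hlin ψ u hu, hψv]
      have := hc u ((memN u).1 hu)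
      have := mul_pos (hψN u hu) (mul_pos this hψo)
      linarith
    · rw [Finset.sum_congr rfl fun u hu => by rw [hMk u hu, mul_comm]]
      rw [hsumφ ψ, hψv, mul_zero]
    · rw [Finset.sum_congr rfl fun u hu => by rw [hMk u hu, mul_comm]]
      have e := hsumφ θ
      rw [hsumN, ← hθv] at hq
      simp only [hk, mul_sub, Finset.sum_sub_distrib]
      linarith
  intro u
  by_cases hu : u ∈ N
  · rw [← hMk u hu, concl u hu]
  · exact hlam0 u (fun hcon => hu ((memN u).2 hcon))

end dehn

section dehn
variable {ι U : Type} [DecidableEq ι] [AddCommGroup U] [Module ℝ U] {V : Finset ι} {p : ι → U}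
  {D : U →ₗ[ℝ] U →ₗ[ℝ] U →ₗ[ℝ] U →ₗ[ℝ] ℝ} {o : U}

theorem antisum {ι : Type} (V : Finset ι) (F : ι → ι → ℝ) (hF : ∀ u w, F u w = - F w u) :
    ∑ u ∈ V, ∑ w ∈ V, F u w = 0 := by
  have h1 : ∑ u ∈ V, ∑ w ∈ V, F u w = - ∑ u ∈ V, ∑ w ∈ V, F u w := by
    conv_lhs => rw [Finset.sum_comm]
    rw [← Finset.sum_neg_distrib]
    refine Finset.sum_congr rfl fun u _ => ?_
    rw [← Finset.sum_neg_distrib]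
    exact Finset.sum_congr rfl fun w _ => hF w u
  linarith

theorem Tr.e1 {v u w : ι} (h : Tr V p v u w) : Fc V p {v, u} :=
  h.2.2.2.mono (by intro x; simp; tauto)

theorem DCfg.vtri (h : DCfg V p D o) {v : ι} (hv : Fc V p {v}) : ∃ u w, Tr V p v u w := by
  have := h.fin
  obtain ⟨u0, hu0, hFu0⟩ := h.hC.exists_link hv (by rw [h.h4]; simp)
  have hvu0 : v ≠ u0 := by
    intro h; apply hu0; simp [h]
  have hFu0' : Fc V p {v, u0} := by rw [Finset.pair_comm]; exact hFu0
  obtain ⟨w0, hT0⟩ := h.exTr hvu0 hFu0'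
  exact ⟨u0, w0, hT0⟩

theorem DCfg.dehn (h : DCfg V p D o) (he : Fc V p ∅) (m : ι → Module.Dual ℝ U)
    (hm : ∀ u w, Fc V p {u, w} → m u (p w) + m w (p u) = 0) :
    ∃ A : U →ₗ[ℝ] Module.Dual ℝ U, (∀ x, A x x = 0) ∧ ∀ u, Fc V p {u} → A (p u) = m u := by
  have hfin := h.fin
  have hA : ∀ s, Fc V p s → ∃ A : U →ₗ[ℝ] Module.Dual ℝ U, (∀ x, A x x = 0) ∧ ∀ v ∈ s, A (p v) = m v := by
    intro s hs
    refine exists_alt s (h.hC.face_ind hs) m (fun u hu w hw => hm u w (hs.mono ?_))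
    intro x hx
    simp only [Finset.mem_insert, Finset.mem_singleton] at hx
    rcases hx with rfl | rfl <;> assumption
  choose! A hA1 hA2 using hA
  let F : U → U → ι → ι → ι → ℝ := fun x y v u w =>
    if Tr V p v u w then (D (p v) (p u) (p w) o / |D (p v) (p u) (p w) o|) * A {v, u, w} x y else 0
  have hF1 : ∀ x y v u w, F x y v u w = - F x y v w u := by
    intro x y v u w
    simp only [F]
    by_cases hT : Tr V p v u w
    · rw [if_pos hT, if_pos hT.rot, h.hD.s23 (p v) (p w) (p u), abs_neg,
        show ({v, w, u} : Finset ι) = {v, u, w} by ext; simp; tauto]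
      ring
    · rw [if_neg hT, if_neg (fun h => hT h.rot), neg_zero]
  have hF2 : ∀ x y v u w, F x y v u w = - F x y u v w := by
    intro x y v u w
    simp only [F]
    by_cases hT : Tr V p v u w
    · rw [if_pos hT, if_pos hT.swap, h.hD.s12 (p u) (p v) (p w), abs_neg,
        show ({u, v, w} : Finset ι) = {v, u, w} by ext; simp; tauto]
      ring
    · rw [if_neg hT, if_neg (fun h => hT h.swap), neg_zero]
  have hlam : ∀ v u, ∃ l : ℝ, (¬ (v ≠ u ∧ Fc V p {v, u}) → l = 0) ∧
      ∀ x y, ∑ w ∈ V, F x y v u w = l * D (p v) (p u) x y := by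
    intro v u
    by_cases hvu : v ≠ u ∧ Fc V p {v, u}
    · obtain ⟨w, w', hp, hn, hne, hQ⟩ := h.two hvu.1 hvu.2
      have hT := (hQ w).2 (Or.inl rfl)
      have hT' := (hQ w').2 (Or.inr rfl)
      obtain ⟨l, hl⟩ := h.bform (h.ne hT) (A {v, u, w} - A {v, u, w'})
        (fun x => by simp [hA1 _ hT.2.2.2 x, hA1 _ hT'.2.2.2 x])
        (by rw [LinearMap.sub_apply, hA2 _ hT.2.2.2 v (by simp), hA2 _ hT'.2.2.2 v (by simp), sub_self])
        (by rw [LinearMap.sub_apply, hA2 _ hT.2.2.2 u (by simp), hA2 _ hT'.2.2.2 u (by simp), sub_self])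
      refine ⟨l, fun h => absurd hvu h, fun x y => ?_⟩
      simp only [F]
      rw [sum_two (DCfg.TrV hT).2.2 (DCfg.TrV hT').2.2 hne hQ, ← hl, abs_of_pos hp, abs_of_neg hn,
        div_self hp.ne', div_neg, div_self hn.ne]
      simp only [LinearMap.sub_apply]
      ring
    · refine ⟨0, fun _ => rfl, fun x y => ?_⟩
      rw [zero_mul]
      refine Finset.sum_eq_zero fun w _ => ?_
      simp only [F]
      rw [if_neg]
      intro hT
      exact hvu ⟨hT.1, hT.e1⟩
  choose lam hlam0 hlam using hlam
  have hsym : ∀ v u, lam v u = lam u v := by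
    intro v u
    by_cases hvu : v ≠ u ∧ Fc V p {v, u}
    · obtain ⟨w, hT⟩ := h.exTr hvu.1 hvu.2
      have e1 := hlam v u (p w) o
      have e2 := hlam u v (p w) o
      have e3 : ∑ x ∈ V, F (p w) o v u x = - ∑ x ∈ V, F (p w) o u v x := by
        rw [← Finset.sum_neg_distrib]
        exact Finset.sum_congr rfl fun x _ => hF2 _ _ _ _ _
      rw [e1, e2, h.hD.s12 (p v) (p u)] at e3
      apply mul_right_cancel₀ (h.ne hT)
      linarith
    · rw [hlam0 v u hvu, hlam0 u v (fun hc => hvu ⟨hc.1.symm, by rw [Finset.pair_comm]; exact hc.2⟩)]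
  have hz : ∀ v x y, D (p v) (∑ u ∈ V, lam v u • p u) x y = 0 := by
    intro v x y
    have e : D (p v) (∑ u ∈ V, lam v u • p u) x y = ∑ u ∈ V, ∑ w ∈ V, F x y v u w := by
      simp only [map_sum, LinearMap.sum_apply, map_smul, LinearMap.smul_apply, smul_eq_mul]
      exact Finset.sum_congr rfl fun u _ => (hlam v u x y).symm
    rw [e]
    exact antisum V _ (hF1 x y v)
  have hmu : ∀ v, ∃ μ : ℝ, ∑ u ∈ V, lam v u • p u = μ • p v := by
    intro v
    by_cases hv : Fc V p {v}
    · obtain ⟨a, b, hT⟩ := h.vtri hv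
      set z := ∑ u ∈ V, lam v u • p u with hzd
      have hcr := h.hD.cr (p v) (p a) (p b) o z
      have z1 : D (p v) (p a) z o = 0 := by rw [h.hD.s23, hz, neg_zero]
      have z2 : D (p v) (p a) (p b) z = 0 := by rw [h.hD.s34, h.hD.s23, hz, neg_zero, neg_zero]
      rw [hz, z1, z2] at hcr
      simp only [zero_smul, add_zero] at hcr
      refine ⟨(D (p v) (p a) (p b) o)⁻¹ * D z (p a) (p b) o, ?_⟩
      rw [mul_smul, ← hcr, smul_smul, inv_mul_cancel₀ (h.ne hT), one_smul]
    · refine ⟨0, ?_⟩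
      rw [zero_smul]
      refine Finset.sum_eq_zero fun u _ => ?_
      rw [hlam0 v u, zero_smul]
      rintro ⟨_, hc⟩
      exact hv (hc.mono (by simp))
  choose μ hμ using hmu
  obtain ⟨ψ, hψ0, hψp, -, hψpos⟩ := h.hC.strict he
  have hψ : ∀ v ∈ V, 0 < ψ (p v) := fun v hv => hψpos v hv (by simp)
  let q : ι → ℝ := fun v => ∑ u ∈ V, lam v u * m u o - μ v * m v o
  have hq0 : ∀ v ∈ V, 0 ≤ q v → (∀ u, lam v u = 0) ∧ q v = 0 := by
    intro v hvV hq
    have hl : ∀ u, lam v u = 0 := by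
      by_cases hv : Fc V p {v}
      · refine h.loc hv (lam v) (fun u => m u o) (μ v) (fun u w => (A {v, u, w}).flip o) ?_ (hlam0 v) ?_ (hμ v) hq
        · intro u w hT
          simp only [LinearMap.flip_apply]
          rw [hA2 _ hT.2.2.2 v (by simp), hA2 _ hT.2.2.2 u (by simp), hA2 _ hT.2.2.2 w (by simp)]
          exact ⟨rfl, rfl, rfl, hA1 _ hT.2.2.2 o⟩
        · intro u _ _ x
          exact hlam v u x o
      · intro u
        apply hlam0
        rintro ⟨_, hc⟩
        exact hv (hc.mono (by simp))
    refine ⟨hl, ?_⟩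
    have e := congrArg ψ (hμ v)
    simp only [hl, zero_smul, Finset.sum_const_zero, map_zero, map_smul, smul_eq_mul] at e
    have e2 : μ v = 0 := (mul_eq_zero.1 e.symm).resolve_right (hψ v hvV).ne'
    simp [q, hl, e2]
  have hqs : ∑ v ∈ V, ψ (p v) * q v = 0 := by
    have e : ∀ v ∈ V, ψ (p v) * q v = ∑ u ∈ V, lam v u * (ψ (p v) * m u o - ψ (p u) * m v o) := by
      intro v _
      have e1 := congrArg ψ (hμ v)
      simp only [map_sum, map_smul, smul_eq_mul] at e1
      simp only [q, mul_sub, Finset.mul_sum, Finset.sum_sub_distrib]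
      rw [show ψ (p v) * (μ v * m v o) = (μ v * ψ (p v)) * m v o by ring, ← e1, Finset.sum_mul]
      congr 1
      · exact Finset.sum_congr rfl fun u _ => by ring
      · exact Finset.sum_congr rfl fun u _ => by ring
    rw [Finset.sum_congr rfl e]
    apply antisum
    intro u w
    rw [hsym u w]; ring
  have hqn : ∀ v ∈ V, ψ (p v) * q v ≤ 0 := by
    intro v hv
    have : q v ≤ 0 := by
      by_contra hc
      push Not at hc
      rw [(hq0 v hv hc.le).2] at hc
      exact lt_irrefl _ hc
    exact mul_nonpos_of_nonneg_of_nonpos (hψ v hv).le this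
  have hl0 : ∀ v ∈ V, ∀ u, lam v u = 0 := by
    intro v hv
    have := (Finset.sum_eq_zero_iff_of_nonpos hqn).1 hqs v hv
    have := (mul_eq_zero.1 this).resolve_left (hψ v hv).ne'
    exact (hq0 v hv this.ge).1
  have Aeq : ∀ v u w w', Tr V p v u w → Tr V p v u w' → A {v, u, w} = A {v, u, w'} := by
    intro v u w w' hT hT'
    obtain ⟨x, x', hp, hn, hne, hQ⟩ := h.two hT.1 hT.e1
    have hX := (hQ x).2 (Or.inl rfl)
    have hX' := (hQ x').2 (Or.inr rfl)
    have key : A {v, u, x} = A {v, u, x'} := by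
      ext a b
      have := hlam v u a b
      simp only [F] at this
      rw [sum_two (DCfg.TrV hX).2.2 (DCfg.TrV hX').2.2 hne hQ, hl0 v (DCfg.TrV hT).1, abs_of_pos hp,
        abs_of_neg hn, div_self hp.ne', div_neg, div_self hn.ne] at this
      linarith
    rcases (hQ w).1 hT with rfl | rfl <;> rcases (hQ w').1 hT' with rfl | rfl
    · rfl
    · exact key
    · exact key.symm
    · rfl
  have loc1 : ∀ v u w, Tr V p v u w → ∀ u' w', Tr V p v u' w' → A {v, u', w'} = A {v, u, w} := by
    intro v u0 w0 hT0 u1 w1 hT1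
    have hv : Fc V p {v} := hT0.e1.mono (by simp)
    refine h.hC.conn hv ?_ (fun u => ∀ w, Tr V p v u w → A {v, u, w} = A {v, u0, w0}) ?_ (a := u0) (b := u1)
      ?_ ?_ ?_ ?_ ?_ w1 hT1
    · intro x hx hFx
      exact h.hC.exists_link hFx (by rw [h.h4, Finset.card_insert_of_notMem hx]; simp)
    · intro x z hx hz hxz hF hSx w hw
      have hT : Tr V p v x z := by
        refine ⟨fun h => hx (by simp [h]), fun h => hz (by simp [h]), hxz, ?_⟩
        rw [show ({v, x, z} : Finset ι) = {z, x, v} by ext; simp; tauto]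
        exact hF
      rw [← hSx z hT, Aeq v z w x hw hT.rot]
      congr 1
      ext; simp; tauto
    · simpa using hT0.1.symm
    · simpa using hT1.1.symm
    · rw [show (insert u0 {v} : Finset ι) = {v, u0} by ext; simp; tauto]; exact hT0.e1
    · rw [show (insert u1 {v} : Finset ι) = {v, u1} by ext; simp; tauto]; exact hT1.e1
    · intro w hw
      exact Aeq v u0 w w0 hw hT0
  obtain ⟨v0, -, hv0⟩ := h.hC.exists_link he (by rw [h.h4]; simp)
  obtain ⟨u0, w0, hT0⟩ := h.vtri hv0
  refine ⟨A {v0, u0, w0}, hA1 _ hT0.2.2.2, fun v hv => ?_⟩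
  have key : ∀ u w, Tr V p v u w → A {v, u, w} = A {v0, u0, w0} := by
    refine h.hC.conn he ?_ (fun v => ∀ u w, Tr V p v u w → A {v, u, w} = A {v0, u0, w0}) ?_ (a := v0) (b := v)
      (by simp) (by simp) hv0 hv ?_
    · intro x hx hFx
      exact h.hC.exists_link hFx (by rw [h.h4, Finset.card_insert_of_notMem hx]; simp)
    · intro x z hx hz hxz hF hSx u w hT
      have hF' : Fc V p {x, z} := by rw [Finset.pair_comm]; exact hF
      obtain ⟨y, hY⟩ := h.exTr hxz hF'
      rw [← hSx z y hY, loc1 z x y hY.swap u w hT]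
      congr 1
      ext; simp; tauto
    · intro u w hT
      exact loc1 v0 u0 w0 hT0 u w hT
  obtain ⟨u, w, hT⟩ := h.vtri hv
  rw [← key u w hT, hA2 _ hT.2.2.2 v (by simp)]

/-- Dehn's theorem in dimension four -/
theorem Cfg.dehn (hC : Cfg V p) [FiniteDimensional ℝ U] (h4 : Module.finrank ℝ U = 4) (he : Fc V p ∅)
    (m : ι → Module.Dual ℝ U) (hm : ∀ u w, Fc V p {u, w} → m u (p w) + m w (p u) = 0) :
    ∃ A : U →ₗ[ℝ] Module.Dual ℝ U, (∀ x, A x x = 0) ∧ ∀ u, Fc V p {u} → A (p u) = m u := by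
  obtain ⟨D, hD⟩ := exists_D4 h4
  exact DCfg.dehn (D := D) (o := ∑ v ∈ V, p v) ⟨hC, hD, inferInstance, h4, rfl⟩ he m hm

end dehn

section rigid
variable {ι W : Type} [DecidableEq ι] [AddCommGroup W] [Module ℝ W] {V : Finset ι} {p : ι → W}

theorem descend {S : Finset ι} (φ : Module.Dual ℝ W) (hφ : ∀ v ∈ S, φ (p v) = 0) :
    ∃ φ' : Module.Dual ℝ (W ⧸ Submodule.span ℝ (p '' (S : Set ι))), ∀ x,
      φ' (Submodule.Quotient.mk x) = φ x := by
  refine ⟨Submodule.liftQ _ φ ?_, fun x => rfl⟩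
  rw [Submodule.span_le]
  rintro _ ⟨v, hv, rfl⟩
  exact hφ v hv

theorem mk_zero {S : Finset ι} {v : ι} (hv : v ∈ S) :
    (Submodule.Quotient.mk (p v) : W ⧸ Submodule.span ℝ (p '' (S : Set ι))) = 0 := by
  rw [Submodule.Quotient.mk_eq_zero]
  exact Submodule.subset_span ⟨v, hv, rfl⟩

theorem Cfg.quot (hC : Cfg V p) (ρ : Finset ι) (hρ : ρ ⊆ V) :
    Cfg (V \ ρ) (fun v => (Submodule.Quotient.mk (p v) : W ⧸ Submodule.span ℝ (p '' (ρ : Set ι)))) := by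
  have zz : ∀ φ : Module.Dual ℝ (W ⧸ Submodule.span ℝ (p '' (ρ : Set ι))), ∀ v ∈ ρ,
      (φ.comp (Submodule.mkQ _)) (p v) = 0 := by
    intro φ v hv
    rw [LinearMap.comp_apply, Submodule.mkQ_apply, mk_zero hv, map_zero]
  constructor
  · intro φ hφ
    have : φ.comp (Submodule.mkQ _) = 0 := by
      apply hC.sp
      intro v hv
      by_cases hvr : v ∈ ρ
      · exact zz φ v hvr
      · exact hφ v (by simp [hv, hvr])
    ext x
    exact LinearMap.congr_fun this x
  · intro φ hφ h0 v hv hz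
    have hv' := Finset.mem_sdiff.1 hv
    obtain ⟨α, h1, h2⟩ := hC.simp (φ.comp (Submodule.mkQ _)) (by
        intro u hu
        by_cases hur : u ∈ ρ
        · exact (zz φ u hur).ge
        · exact hφ u (by simp [hu, hur])) (by
        intro hcon
        apply h0
        ext x
        exact LinearMap.congr_fun hcon x) v hv'.1 hz
    obtain ⟨α', ha⟩ := descend (S := ρ) α (fun u hu => h2 u (hρ hu) (by rintro rfl; exact hv'.2 hu) (zz φ u hu))
    refine ⟨α', by rw [ha, h1], fun u hu hne hzu => ?_⟩
    rw [ha]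
    exact h2 u (Finset.mem_sdiff.1 hu).1 hne hzu

theorem Fc.of_quot {ρ : Finset ι} (hρ : ρ ⊆ V) {s : Finset ι} (hs : Fc (V \ ρ)
    (fun v => (Submodule.Quotient.mk (p v) : W ⧸ Submodule.span ℝ (p '' (ρ : Set ι)))) s) :
    Fc V p (s ∪ ρ) := by
  obtain ⟨h1, φ, h0, hp, hz⟩ := hs
  have zz : ∀ v ∈ ρ, (φ.comp (Submodule.mkQ _)) (p v) = 0 := by
    intro v hv
    rw [LinearMap.comp_apply, Submodule.mkQ_apply, mk_zero hv, map_zero]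
  refine ⟨Finset.union_subset (h1.trans Finset.sdiff_subset) hρ, φ.comp (Submodule.mkQ _), ?_, ?_, ?_⟩
  · intro hcon
    apply h0
    ext x
    exact LinearMap.congr_fun hcon x
  · intro v hv
    by_cases hvr : v ∈ ρ
    · exact (zz v hvr).ge
    · exact hp v (by simp [hv, hvr])
  · intro v hv
    rcases Finset.mem_union.1 hv with h | h
    · exact hz v h
    · exact zz v h

theorem Fc.to_quot {ρ : Finset ι} {s : Finset ι} (hs : Fc V p (s ∪ ρ)) (hd : Disjoint s ρ) :
    Fc (V \ ρ) (fun v => (Submodule.Quotient.mk (p v) : W ⧸ Submodule.span ℝ (p '' (ρ : Set ι)))) s := by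
  obtain ⟨h1, φ, h0, hp, hz⟩ := hs
  obtain ⟨φ', hφ⟩ := descend (S := ρ) φ (fun u hu => hz u (Finset.mem_union_right _ hu))
  refine ⟨?_, φ', ?_, ?_, ?_⟩
  · intro x hx
    exact Finset.mem_sdiff.2 ⟨h1 (Finset.mem_union_left _ hx), Finset.disjoint_left.1 hd hx⟩
  · rintro rfl
    apply h0
    ext x
    rw [← hφ x]; rfl
  · intro v hv
    rw [hφ]; exact hp v (Finset.mem_sdiff.1 hv).1
  · intro v hv
    rw [hφ]; exact hz v (Finset.mem_union_left _ hv)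

theorem Cfg.face_li (hC : Cfg V p) {s : Finset ι} (hs : Fc V p s) :
    Module.finrank ℝ (Submodule.span ℝ (p '' (s : Set ι))) = s.card := by
  have hli : LinearIndependent ℝ (fun v : s => p v) := by
    rw [linearIndependent_iff']
    intro t g hg i hi
    obtain ⟨α, h1, h2⟩ := hC.face_ind hs i i.2
    have := congrArg α hg
    simp only [map_sum, map_smul, smul_eq_mul, map_zero] at this
    rw [Finset.sum_eq_single i] at this
    · simpa [h1] using this
    · intro b _ hb
      rw [h2 b b.2 (fun h => hb (Subtype.ext h)), mul_zero]
    · intro h; exact absurd hi h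
  have := finrank_span_eq_card hli
  rw [Fintype.card_coe] at this
  have e : p '' (s : Set ι) = Set.range (fun v : s => p v) := by
    ext x
    simp
  rw [e, this]

theorem Cfg.rigid_base [FiniteDimensional ℝ W] (hC : Cfg V p) {ρ : Finset ι} (hρ : Fc V p ρ)
    (hcard : Module.finrank ℝ W = ρ.card + 4) (m : ι → Module.Dual ℝ W)
    (hm : ∀ u w, Fc V p (insert u (insert w ρ)) → m u (p w) + m w (p u) = 0) :
    ∃ A : W →ₗ[ℝ] Module.Dual ℝ W, (∀ x, A x x = 0) ∧ ∀ u, Fc V p (insert u ρ) → A (p u) = m u := by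
  obtain ⟨B, hB1, hB2⟩ := exists_alt ρ (hC.face_ind hρ) m (fun u hu w hw => hm u w (by
    rw [Finset.insert_eq_of_mem hw, Finset.insert_eq_of_mem hu]; exact hρ))
  have hBs : ∀ x y, B x y + B y x = 0 := by
    intro x y
    have := hB1 (x + y)
    simp only [map_add, LinearMap.add_apply, hB1] at this
    linarith
  have hd : ∀ u, ∃ m' : Module.Dual ℝ (W ⧸ Submodule.span ℝ (p '' (ρ : Set ι))), Fc V p (insert u ρ) → ∀ x,
      m' (Submodule.Quotient.mk x) = m u x - B (p u) x := by
    intro u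
    by_cases hu : Fc V p (insert u ρ)
    · obtain ⟨m', hm'⟩ := descend (S := ρ) (p := p) (m u - B (p u)) (by
        intro r hr
        rw [LinearMap.sub_apply]
        have e1 := hm u r (by rw [Finset.insert_eq_of_mem hr]; exact hu)
        have e2 := hBs (p u) (p r)
        rw [hB2 r hr] at e2
        linarith)
      exact ⟨m', fun _ x => by rw [hm']; rfl⟩
    · exact ⟨0, fun h => absurd h hu⟩
  choose m' hm' using hd
  have hfr : Module.finrank ℝ (W ⧸ Submodule.span ℝ (p '' (ρ : Set ι))) = 4 := by
    have := Submodule.finrank_quotient_add_finrank (Submodule.span ℝ (p '' (ρ : Set ι)))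
    rw [hC.face_li hρ] at this
    omega
  obtain ⟨A, hA1, hA2⟩ := (hC.quot ρ hρ.1).dehn hfr (Fc.to_quot (by simpa using hρ) (by simp)) m' (by
    intro u w huw
    have hF := Fc.of_quot hρ.1 huw
    have e1 : ({u, w} ∪ ρ : Finset ι) = insert u (insert w ρ) := by ext; simp
    rw [e1] at hF
    rw [hm' u (hF.mono (by intro x; simp; tauto)), hm' w (hF.mono (by intro x; simp; tauto))]
    have := hm u w hF
    have := hBs (p u) (p w)
    linarith)
  refine ⟨A.compl₁₂ (Submodule.mkQ _) (Submodule.mkQ _) + B, ?_, ?_⟩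
  · intro x
    simp [hA1, hB1]
  · intro u hu
    ext x
    simp only [LinearMap.add_apply, LinearMap.compl₁₂_apply, Submodule.mkQ_apply]
    by_cases hur : u ∈ ρ
    · rw [mk_zero hur, hB2 u hur]; simp
    · rw [hA2 u (Fc.to_quot (by rwa [← Finset.insert_eq]) (by simpa using hur)), hm' u hu]
      ring

/-- rigidity of stars -/
theorem Cfg.rigid [FiniteDimensional ℝ W] (hC : Cfg V p) {ρ : Finset ι} (hρ : Fc V p ρ)
    (hcard : ρ.card + 4 ≤ Module.finrank ℝ W) (m : ι → Module.Dual ℝ W)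
    (hm : ∀ u w, Fc V p (insert u (insert w ρ)) → m u (p w) + m w (p u) = 0) :
    ∃ A : W →ₗ[ℝ] Module.Dual ℝ W, (∀ x, A x x = 0) ∧ ∀ u, Fc V p (insert u ρ) → A (p u) = m u := by
  obtain ⟨k, hk⟩ : ∃ k, ρ.card + 4 + k = Module.finrank ℝ W := ⟨_, Nat.add_sub_cancel' hcard⟩
  induction k generalizing ρ with
  | zero => exact hC.rigid_base hρ (by omega) m hm
  | succ k ih =>
    have h1 : ∀ v, v ∉ ρ ∧ Fc V p (insert v ρ) → ∃ A : W →ₗ[ℝ] Module.Dual ℝ W, (∀ x, A x x = 0) ∧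
        ∀ u, Fc V p (insert u (insert v ρ)) → A (p u) = m u := by
      rintro v ⟨hv, hF⟩
      have hc := Finset.card_insert_of_notMem hv
      refine ih hF (by omega) (fun u w huw => hm u w (huw.mono ?_)) (by omega)
      exact Finset.insert_subset_insert _ (Finset.insert_subset_insert _ (Finset.subset_insert _ _))
    choose! A hA1 hA2 using h1
    have hadj : ∀ v w, v ∉ ρ → w ∉ ρ → v ≠ w → Fc V p (insert w (insert v ρ)) → A v = A w := by
      intro v w hv hw hvw hF
      have hFv : Fc V p (insert v ρ) := hF.mono (by intro x; simp; tauto)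
      have hFw : Fc V p (insert w ρ) := hF.mono (by intro x; simp; tauto)
      obtain ⟨Z, hsZ, hZV, φ, h0, hpos, hz, hann⟩ := hC.facet hF
      have hFZ : Fc V p Z := ⟨hZV, φ, h0, hpos, hz⟩
      rw [← sub_eq_zero]
      refine alt_zero_of_facet h0 hann (A v - A w) ?_ ?_
      · intro x
        simp [hA1 v ⟨hv, hFv⟩, hA1 w ⟨hw, hFw⟩]
      · intro z hzZ
        rw [LinearMap.sub_apply, hA2 v ⟨hv, hFv⟩ z, hA2 w ⟨hw, hFw⟩ z, sub_self]
        · refine hFZ.mono (Finset.insert_subset hzZ (Finset.Subset.trans ?_ hsZ))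
          intro x; simp; tauto
        · refine hFZ.mono (Finset.insert_subset hzZ (Finset.Subset.trans ?_ hsZ))
          intro x; simp; tauto
    obtain ⟨v0, hv0, hFv0⟩ := hC.exists_link hρ (by omega)
    refine ⟨A v0, hA1 v0 ⟨hv0, hFv0⟩, fun u hu => ?_⟩
    by_cases hur : u ∈ ρ
    · exact hA2 v0 ⟨hv0, hFv0⟩ u (by
        rw [Finset.insert_eq_of_mem (Finset.mem_insert_of_mem hur)]; exact hFv0)
    · have : A u = A v0 := by
        refine hC.conn hρ ?_ (fun v => A v = A v0) ?_ hv0 hur hFv0 hu rfl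
        · intro x hx hFx
          exact hC.exists_link hFx (by rw [Finset.card_insert_of_notMem hx]; omega)
        · intro v w hv hw hvw hF hS
          rw [← hadj v w hv hw hvw hF]; exact hS
      rw [← this]
      exact hA2 u ⟨hur, hu⟩ u (by simpa using hu)

end rigid

section lemB
variable {ι W : Type} [DecidableEq ι] [AddCommGroup W] [Module ℝ W] {V : Finset ι} {p : ι → W}

theorem exists_interp {C : Finset ι}
    (hb : ∀ c ∈ C, ∃ α : Module.Dual ℝ W, α (p c) = 1 ∧ ∀ c' ∈ C, c' ≠ c → α (p c') = 0) (f : ι → ℝ) :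
    ∃ φ : Module.Dual ℝ W, ∀ c ∈ C, φ (p c) = f c := by
  choose! α h1 h2 using hb
  refine ⟨∑ c ∈ C, f c • α c, fun c hc => ?_⟩
  rw [LinearMap.sum_apply, Finset.sum_eq_single c]
  · rw [LinearMap.smul_apply, h1 c hc, smul_eq_mul, mul_one]
  · intro b hb hbc
    rw [LinearMap.smul_apply, h2 b hb c hc (Ne.symm hbc), smul_zero]
  · intro h; exact absurd hc h

/-- coordinate functional of a facet-opposite vertex is positive off the facet -/
theorem Cfg.coord_pos (hC : Cfg V p) {C : Finset ι} (hCV : C ⊆ V)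
    (hsp : ∀ φ : Module.Dual ℝ W, (∀ c ∈ C, φ (p c) = 0) → φ = 0) {x : ι} (hx : x ∈ C)
    (hF : Fc V p (C.erase x)) {X : Module.Dual ℝ W} (h1 : X (p x) = 1)
    (h2 : ∀ c ∈ C, c ≠ x → X (p c) = 0) : ∀ v ∈ V, v ∉ C → 0 < X (p v) := by
  obtain ⟨φ, h0, hp, hz, hpos⟩ := hC.strict hF
  have hφx : 0 < φ (p x) := hpos x (hCV hx) (by simp)
  have e : φ = φ (p x) • X := by
    rw [← sub_eq_zero]
    apply hsp
    intro c hc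
    rw [LinearMap.sub_apply, LinearMap.smul_apply, smul_eq_mul]
    by_cases hcx : c = x
    · subst hcx; rw [h1]; ring
    · rw [h2 c hc hcx, hz c (Finset.mem_erase.2 ⟨hcx, hc⟩)]; ring
  intro v hv hvC
  have h3 := hpos v hv (fun h => hvC (Finset.mem_of_mem_erase h))
  rw [e, LinearMap.smul_apply, smul_eq_mul] at h3
  exact (pos_iff_pos_of_mul_pos h3).1 hφx

set_option maxHeartbeats 2000000 in
theorem Cfg.lemB [FiniteDimensional ℝ W] (hC : Cfg V p) {C ρ : Finset ι} {x y z s t : ι} (hCV : C ⊆ V)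
    (hsp : ∀ φ : Module.Dual ℝ W, (∀ c ∈ C, φ (p c) = 0) → φ = 0)
    (hb : ∀ c ∈ C, ∃ α : Module.Dual ℝ W, α (p c) = 1 ∧ ∀ c' ∈ C, c' ≠ c → α (p c') = 0)
    (hfr : Module.finrank ℝ W = ρ.card + 5)
    (hx : x ∈ C) (hy : y ∈ C) (hz : z ∈ C) (hs : s ∈ C) (ht : t ∈ C)
    (nd : [x, y, z, s, t].Nodup) (hρ : ∀ c, c ∈ ρ ↔ c ∈ C ∧ c ≠ x ∧ c ≠ y ∧ c ≠ z ∧ c ≠ s ∧ c ≠ t)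
    (hFx : Fc V p (C.erase x)) (hFy : Fc V p (C.erase y)) (hFz : Fc V p (C.erase z))
    (hnF : ¬ Fc V p (C \ {s, t})) (m : ι → Module.Dual ℝ W)
    (hm : ∀ u w, Fc V p (insert u (insert w ρ)) → ¬ (u = s ∧ w = t) → ¬ (u = t ∧ w = s) →
      m u (p w) + m w (p u) = 0) : m s (p t) + m t (p s) = 0 := by
  simp only [List.nodup_cons, List.mem_cons, List.not_mem_nil, or_false, not_or] at nd
  obtain ⟨⟨hxy, hxz, hxs, hxt⟩, ⟨hyz, hys, hyt⟩, ⟨hzs, hzt⟩, hst, -⟩ := nd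
  have hrC : ∀ c ∈ ρ, c ∈ C := fun c hc => ((hρ c).1 hc).1
  have hxr : x ∉ ρ := fun h => ((hρ x).1 h).2.1 rfl
  have hyr : y ∉ ρ := fun h => ((hρ y).1 h).2.2.1 rfl
  have hzr : z ∉ ρ := fun h => ((hρ z).1 h).2.2.2.1 rfl
  have hsr : s ∉ ρ := fun h => ((hρ s).1 h).2.2.2.2.1 rfl
  have htr : t ∉ ρ := fun h => ((hρ t).1 h).2.2.2.2.2 rfl
  have hCc : ∀ c ∈ C, c ∈ ρ ∨ c = x ∨ c = y ∨ c = z ∨ c = s ∨ c = t := by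
    intro c hc
    by_contra hcon
    push Not at hcon
    exact hcon.1 ((hρ c).2 ⟨hc, hcon.2⟩)
  have hFρ : Fc V p ρ := hFx.mono (by
    intro c hc
    exact Finset.mem_erase.2 ⟨((hρ c).1 hc).2.1, hrC c hc⟩)
  obtain ⟨X, hX1, hX2⟩ := hb x hx
  obtain ⟨Y, hY1, hY2⟩ := hb y hy
  obtain ⟨Z, hZ1, hZ2⟩ := hb z hz
  obtain ⟨S, hS1, hS2⟩ := hb s hs
  obtain ⟨T, hT1, hT2⟩ := hb t ht
  have hXp := hC.coord_pos hCV hsp hx hFx hX1 hX2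
  have hYp := hC.coord_pos hCV hsp hy hFy hY1 hY2
  have hZp := hC.coord_pos hCV hsp hz hFz hZ1 hZ2
  -- step 1
  have step1 : ∀ F : Finset ι, Fc V p F → ρ ⊆ F → s ∈ F → t ∈ F → ∀ v ∈ F, v ∈ C := by
    rintro F ⟨hFV, φ, h0, hp, hz0⟩ hρF hsF htF v hv
    by_contra hvC
    have e : φ = φ (p x) • X + φ (p y) • Y + φ (p z) • Z := by
      rw [← sub_eq_zero]
      apply hsp
      intro c hc
      simp only [LinearMap.sub_apply, LinearMap.add_apply, LinearMap.smul_apply, smul_eq_mul]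
      rcases hCc c hc with h | rfl | rfl | rfl | rfl | rfl
      · have h' := (hρ c).1 h
        rw [hz0 c (hρF h), hX2 c hc h'.2.1, hY2 c hc h'.2.2.1, hZ2 c hc h'.2.2.2.1]; ring
      · rw [hX1, hY2 c hc hxy, hZ2 c hc hxz]; ring
      · rw [hY1, hX2 c hc (Ne.symm hxy), hZ2 c hc hyz]; ring
      · rw [hZ1, hX2 c hc (Ne.symm hxz), hY2 c hc (Ne.symm hyz)]; ring
      · rw [hz0 c hsF, hX2 c hc (Ne.symm hxs), hY2 c hc (Ne.symm hys), hZ2 c hc (Ne.symm hzs)]; ring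
      · rw [hz0 c htF, hX2 c hc (Ne.symm hxt), hY2 c hc (Ne.symm hyt), hZ2 c hc (Ne.symm hzt)]; ring
    have ev := hz0 v hv
    have hvV := hFV hv
    have e2 := LinearMap.congr_fun e (p v)
    simp only [LinearMap.add_apply, LinearMap.smul_apply, smul_eq_mul] at e2
    rw [ev] at e2
    have q1 := mul_nonneg (hp x (hCV hx)) (hXp v hvV hvC).le
    have q2 := mul_nonneg (hp y (hCV hy)) (hYp v hvV hvC).le
    have q3 := mul_nonneg (hp z (hCV hz)) (hZp v hvV hvC).le
    have r1 : φ (p x) = 0 := (mul_eq_zero.1 (by linarith)).resolve_right (hXp v hvV hvC).ne'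
    have r2 : φ (p y) = 0 := (mul_eq_zero.1 (by linarith)).resolve_right (hYp v hvV hvC).ne'
    have r3 : φ (p z) = 0 := (mul_eq_zero.1 (by linarith)).resolve_right (hZp v hvV hvC).ne'
    apply h0
    rw [e, r1, r2, r3]
    ext a
    simp
  -- step 2
  have step2 : ∀ v, v ∉ ρ ∧ v ≠ x ∧ v ≠ y ∧ v ≠ z ∧ Fc V p (insert v ρ) → ∃ A : W →ₗ[ℝ] Module.Dual ℝ W,
      (∀ x, A x x = 0) ∧ ∀ u, Fc V p (insert u (insert v ρ)) → (v = s → u ≠ t) → (v = t → u ≠ s) → A (p u) = m u := by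
    rintro v ⟨hvr, hvx, hvy, hvz, hvF⟩
    have hfr' : Module.finrank ℝ W = (insert v ρ).card + 4 := by
      rw [Finset.card_insert_of_notMem hvr]; omega
    have special : ∀ a b, a ∉ ρ → a ≠ b → b ∈ C →
        (∀ u w, Fc V p (insert u (insert w ρ)) → ¬ (u = a ∧ w = b) → ¬ (u = b ∧ w = a) →
          m u (p w) + m w (p u) = 0) →
        (∀ F : Finset ι, Fc V p F → ρ ⊆ F → a ∈ F → b ∈ F → ∀ v ∈ F, v ∈ C) → Fc V p (insert a ρ) →
        Module.finrank ℝ W = (insert a ρ).card + 4 →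
        ∃ A : W →ₗ[ℝ] Module.Dual ℝ W, (∀ x, A x x = 0) ∧
          ∀ u, Fc V p (insert u (insert a ρ)) → u ≠ b → A (p u) = m u := by
      intro a b har hab hbC hm st haF hfra
      obtain ⟨n, hn⟩ := exists_interp hb (fun c => if c = b then 0 else - m c (p b))
      obtain ⟨A, hA1, hA2⟩ := hC.rigid_base haF hfra (Function.update m b n) (by
        intro u w huw
        have hmono : Fc V p (insert u (insert w ρ)) := huw.mono (by
          exact Finset.insert_subset_insert _ (Finset.insert_subset_insert _ (Finset.subset_insert _ _)))
        have hst' : b ∈ insert u (insert w (insert a ρ)) → ∀ v ∈ insert u (insert w (insert a ρ)), v ∈ C := by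
          intro hb
          exact st _ huw (by intro c hc; simp [hc]) (by simp) hb
        by_cases hub : u = b
        · subst hub
          by_cases hwb : w = u
          · subst hwb
            simp [hn w hbC]
          · rw [Function.update_self, Function.update_of_ne hwb, hn w (hst' (by simp) w (by simp)), if_neg hwb]
            ring
        · rw [Function.update_of_ne hub]
          by_cases hwb : w = b
          · subst hwb
            rw [Function.update_self, hn u (hst' (by simp) u (by simp)), if_neg hub]
            ring
          · rw [Function.update_of_ne hwb]
            exact hm u w hmono (fun h => hwb h.2) (fun h => hub h.1))
      refine ⟨A, hA1, fun u hu hub => ?_⟩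
      rw [hA2 u hu, Function.update_of_ne hub]
    by_cases hvs : v = s
    · subst hvs
      obtain ⟨A, h1, h2⟩ := special v t hvr hst ht hm step1 hvF hfr'
      exact ⟨A, h1, fun u hu h3 _ => h2 u hu (h3 rfl)⟩
    · by_cases hvt : v = t
      · subst hvt
        obtain ⟨A, h1, h2⟩ := special v s hvr (Ne.symm hst) hs (fun u w h h1 h2 => hm u w h h2 h1)
          (fun F h1 h2 h3 h4 => step1 F h1 h2 h4 h3) hvF hfr'
        exact ⟨A, h1, fun u hu _ h3 => h2 u hu (h3 rfl)⟩
      · have hvC : v ∉ C := by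
          intro h
          rcases hCc v h with h | h | h | h | h | h <;> contradiction
        obtain ⟨A, h1, h2⟩ := hC.rigid_base hvF hfr' m (by
          intro u w huw
          have hmono : Fc V p (insert u (insert w ρ)) := huw.mono (by
            exact Finset.insert_subset_insert _ (Finset.insert_subset_insert _ (Finset.subset_insert _ _)))
          refine hm u w hmono ?_ ?_
          · rintro ⟨rfl, rfl⟩
            exact hvC (step1 _ huw (by intro c hc; simp [hc]) (by simp) (by simp) v (by simp))
          · rintro ⟨rfl, rfl⟩
            exact hvC (step1 _ huw (by intro c hc; simp [hc]) (by simp) (by simp) v (by simp)))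
        exact ⟨A, h1, fun u hu _ _ => h2 u hu⟩
  choose! A hA1 hA2 using step2
  -- step 3
  have step3 : ∀ v w, v ∉ ρ → w ∉ ρ → v ≠ w → Fc V p (insert w (insert v ρ)) → v ≠ x → v ≠ y → v ≠ z →
      w ≠ x → w ≠ y → w ≠ z → ¬ (v = s ∧ w = t) → ¬ (v = t ∧ w = s) → A v = A w := by
    intro v w hv hw hvw hF v1 v2 v3 w1 w2 w3 n1 n2
    have hFv : Fc V p (insert v ρ) := hF.mono (by intro x; simp; tauto)
    have hFw : Fc V p (insert w ρ) := hF.mono (by intro x; simp; tauto)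
    obtain ⟨Q, hsQ, hQV, φ, h0, hpos, hz, hann⟩ := hC.facet hF
    have hFQ : Fc V p Q := ⟨hQV, φ, h0, hpos, hz⟩
    have hnot : s ∈ Q → t ∈ Q → False := by
      intro h1 h2
      have st := step1 Q hFQ (fun c hc => hsQ (by simp [hc])) h1 h2
      have hvC := hCc v (st v (hsQ (by simp)))
      have hwC := hCc w (st w (hsQ (by simp)))
      simp only [hv, v1, v2, v3, false_or] at hvC
      simp only [hw, w1, w2, w3, false_or] at hwC
      rcases hvC with rfl | rfl <;> rcases hwC with rfl | rfl
      · exact hvw rfl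
      · exact n1 ⟨rfl, rfl⟩
      · exact n2 ⟨rfl, rfl⟩
      · exact hvw rfl
    have hvQ : v ∈ Q := hsQ (by simp)
    have hwQ : w ∈ Q := hsQ (by simp)
    rw [← sub_eq_zero]
    refine alt_zero_of_facet h0 hann (A v - A w) ?_ ?_
    · intro a
      simp [hA1 v ⟨hv, v1, v2, v3, hFv⟩, hA1 w ⟨hw, w1, w2, w3, hFw⟩]
    · intro q hq
      rw [LinearMap.sub_apply, hA2 v ⟨hv, v1, v2, v3, hFv⟩ q, hA2 w ⟨hw, w1, w2, w3, hFw⟩ q, sub_self]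
      · refine hFQ.mono (Finset.insert_subset hq (Finset.Subset.trans ?_ hsQ))
        intro x; simp; tauto
      · rintro rfl rfl; exact hnot hwQ hq
      · rintro rfl rfl; exact hnot hq hwQ
      · refine hFQ.mono (Finset.insert_subset hq (Finset.Subset.trans ?_ hsQ))
        intro x; simp; tauto
      · rintro rfl rfl; exact hnot hvQ hq
      · rintro rfl rfl; exact hnot hq hvQ
  -- step 4
  have hlink : ∀ v, v ∉ ρ → Fc V p (insert v ρ) → ∃ u, u ∉ insert v ρ ∧ Fc V p (insert u (insert v ρ)) := by
    intro v hv hF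
    exact hC.exists_link hF (by rw [Finset.card_insert_of_notMem hv]; omega)
  have hconn : ∀ f : Module.Dual ℝ W, (∀ v ∈ ρ, f (p v) = 0) → f (p x) = 0 → f (p y) = 0 → f (p z) = 0 →
      f (p s) ≤ 0 → f (p t) ≤ 0 → ∀ a b, a ∉ ρ → b ∉ ρ → Fc V p (insert a ρ) → Fc V p (insert b ρ) →
      0 < f (p a) → 0 < f (p b) → A b = A a := by
    intro f f0 fx fy fz fs ft a b ha hb hFa hFb fa fb
    refine hC.climb hFρ f f0 ⟨x, hCV hx, hxr, fx⟩ hlink (fun v => A v = A a) ?_ ha hb hFa hFb fa fb rfl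
    intro v w hv hw hvw hF fv fw hSv
    rw [← hSv]
    symm
    have ne : ∀ v c, 0 < f (p v) → f (p c) ≤ 0 → v ≠ c := by
      rintro v c h1 h2 rfl; linarith
    exact step3 v w hv hw hvw hF (ne v x fv fx.le) (ne v y fv fy.le) (ne v z fv fz.le) (ne w x fw fx.le)
      (ne w y fw fy.le) (ne w z fw fz.le) (fun h => ne v s fv fs h.1) (fun h => ne v t fv ft h.1)
  have hxyz : ∀ g : Module.Dual ℝ W, g ≠ 0 → (∀ v ∈ ρ, g (p v) = 0) → g (p x) = 0 → g (p y) = 0 → g (p z) = 0 →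
      (∀ v ∈ V, 0 ≤ g (p v)) → False := by
    intro g g0 gr gx gy gz gp
    apply hnF
    refine ⟨Finset.sdiff_subset.trans hCV, g, g0, gp, ?_⟩
    intro c hc
    simp only [Finset.mem_sdiff, Finset.mem_insert, Finset.mem_singleton, not_or] at hc
    rcases hCc c hc.1 with h | rfl | rfl | rfl | h | h
    · exact gr c h
    · exact gx
    · exact gy
    · exact gz
    · exact absurd h hc.2.1
    · exact absurd h hc.2.2
  have Sr : ∀ v ∈ ρ, S (p v) = 0 := fun v hv => hS2 v (hrC v hv) ((hρ v).1 hv).2.2.2.2.1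
  have Tr : ∀ v ∈ ρ, T (p v) = 0 := fun v hv => hT2 v (hrC v hv) ((hρ v).1 hv).2.2.2.2.2
  have Sx := hS2 x hx hxs
  have Sy := hS2 y hy hys
  have Sz := hS2 z hz hzs
  have St := hS2 t ht (Ne.symm hst)
  have Tx := hT2 x hx hxt
  have Ty := hT2 y hy hyt
  have Tz := hT2 z hz hzt
  have Ts := hT2 s hs hst
  have S0 : S ≠ 0 := by rintro rfl; simp at hS1
  have T0 : T ≠ 0 := by rintro rfl; simp at hT1
  have sub1 : ∀ c, c = s ∨ c = t → Fc V p (insert x (insert c ρ)) := by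
    intro c hc
    refine hFy.mono ?_
    intro a ha
    simp only [Finset.mem_insert] at ha
    rw [Finset.mem_erase]
    rcases ha with rfl | rfl | ha
    · exact ⟨hxy, hx⟩
    · rcases hc with rfl | rfl
      · exact ⟨Ne.symm hys, hs⟩
      · exact ⟨Ne.symm hyt, ht⟩
    · exact ⟨((hρ a).1 ha).2.2.1, hrC a ha⟩
  have hFs : Fc V p (insert s ρ) := (sub1 s (Or.inl rfl)).mono (Finset.subset_insert _ _)
  have hFt : Fc V p (insert t ρ) := (sub1 t (Or.inr rfl)).mono (Finset.subset_insert _ _)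
  have ex1 : ∃ w, w ∉ insert t ρ ∧ Fc V p (insert w (insert t ρ)) ∧ S (p w) < 0 := by
    by_contra hcon
    push Not at hcon
    refine hxyz S S0 Sr Sx Sy Sz (hC.cone hFt ⟨x, ?_, sub1 t (Or.inr rfl)⟩ S ?_ hcon)
    · simp [hxt, hxr]
    · intro v hv
      rcases Finset.mem_insert.1 hv with rfl | hv
      · exact St
      · exact Sr v hv
  have ex2 : ∃ w, w ∉ insert s ρ ∧ Fc V p (insert w (insert s ρ)) ∧ T (p w) < 0 := by
    by_contra hcon
    push Not at hcon
    refine hxyz T T0 Tr Tx Ty Tz (hC.cone hFs ⟨x, ?_, sub1 s (Or.inl rfl)⟩ T ?_ hcon)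
    · simp [hxs, hxr]
    · intro v hv
      rcases Finset.mem_insert.1 hv with rfl | hv
      · exact Ts
      · exact Tr v hv
  obtain ⟨w, hwn, hwF, hwS⟩ := ex1
  obtain ⟨w', hwn', hwF', hwT⟩ := ex2
  simp only [Finset.mem_insert, not_or] at hwn hwn'
  have nz : ∀ (f : Module.Dual ℝ W) v c, f (p v) < 0 → 0 ≤ f (p c) → v ≠ c := by
    rintro f v c h1 h2 rfl; linarith
  have hwl : Fc V p (insert w ρ) := hwF.mono (by intro x; simp; tauto)
  have hwl' : Fc V p (insert w' ρ) := hwF'.mono (by intro x; simp; tauto)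
  have eAt : A t = A w := step3 t w htr hwn.2 (Ne.symm hwn.1) hwF (Ne.symm hxt) (Ne.symm hyt) (Ne.symm hzt)
    (nz S w x hwS Sx.ge) (nz S w y hwS Sy.ge) (nz S w z hwS Sz.ge) (fun h => hwn.1 h.2)
    (fun h => nz S w s hwS (by rw [hS1]; norm_num) h.2)
  have eAs : A s = A w' := step3 s w' hsr hwn'.2 (Ne.symm hwn'.1) hwF' (Ne.symm hxs) (Ne.symm hys) (Ne.symm hzs)
    (nz T w' x hwT Tx.ge) (nz T w' y hwT Ty.ge) (nz T w' z hwT Tz.ge)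
    (fun h => nz T w' t hwT (by rw [hT1]; norm_num) h.2) (fun h => hwn'.1 h.2)
  have D1 : ∀ a, a ∉ ρ → Fc V p (insert a ρ) → S (p a) < 0 → A a = A w := by
    intro a ha hFa hSa
    refine hconn (-S) (fun v hv => by simp [Sr v hv]) (by simp [Sx]) (by simp [Sy]) (by simp [Sz])
      (by simp [hS1]) (by simp [St]) w a hwn.2 ha hwl hFa (by simpa using hwS) (by simpa using hSa)
  have D2 : ∀ a, a ∉ ρ → Fc V p (insert a ρ) → T (p a) < 0 → A a = A w' := by
    intro a ha hFa hSa
    refine hconn (-T) (fun v hv => by simp [Tr v hv]) (by simp [Tx]) (by simp [Ty]) (by simp [Tz])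
      (by simp [Ts]) (by simp [hT1]) w' a hwn'.2 ha hwl' hFa (by simpa using hwT) (by simpa using hSa)
  have eA : A s = A t := by
    by_cases hI : ∃ u, u ∉ ρ ∧ Fc V p (insert u ρ) ∧ S (p u) < 0 ∧ T (p u) < 0
    · obtain ⟨u, h1, h2, h3, h4⟩ := hI
      rw [eAs, eAt, ← D1 u h1 h2 h3, ← D2 u h1 h2 h4]
    · push Not at hI
      obtain ⟨v1, hv1, hmin⟩ := Finset.exists_min_image
        (V.filter (fun u => u ∉ ρ ∧ Fc V p (insert u ρ) ∧ S (p u) < 0)) (fun u => T (p u) / (- S (p u)))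
        ⟨w, by simp only [Finset.mem_filter]; exact ⟨hwF.1 (by simp), hwn.2, hwl, hwS⟩⟩
      simp only [Finset.mem_filter] at hv1 hmin
      obtain ⟨-, hv1r, hv1F, hv1S⟩ := hv1
      set r := T (p v1) / (- S (p v1)) with hr
      have hr0 : 0 ≤ r := div_nonneg (hI v1 hv1r hv1F hv1S) (by linarith)
      have hg1 : r * S (p v1) + T (p v1) = 0 := by
        rw [hr]
        have : S (p v1) ≠ 0 := hv1S.ne
        field_simp
        ring
      have exv2 : ∃ v, v ∉ ρ ∧ Fc V p (insert v ρ) ∧ r * S (p v) + T (p v) < 0 := by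
        by_contra hcon
        push Not at hcon
        refine hxyz (r • S + T) ?_ ?_ (by simp [Sx, Tx]) (by simp [Sy, Ty]) (by simp [Sz, Tz])
          (hC.cone hFρ ⟨s, hsr, hFs⟩ (r • S + T) ?_ ?_)
        · intro h
          have := LinearMap.congr_fun h (p t)
          simp [St, hT1] at this
        · intro v hv; simp [Sr v hv, Tr v hv]
        · intro v hv; simp [Sr v hv, Tr v hv]
        · intro v hv hF; simpa using hcon v hv hF
      obtain ⟨v2, hv2r, hv2F, hg2⟩ := exv2
      have hS2' : 0 ≤ S (p v2) := by
        by_contra hcon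
        push Not at hcon
        have := hmin v2 ⟨hv2F.1 (by simp), hv2r, hv2F, hcon⟩
        rw [le_div_iff₀ (by linarith)] at this
        linarith
      have hT2' : T (p v2) < 0 := by
        have := mul_nonneg hr0 hS2'
        linarith
      obtain ⟨ε, he, he2⟩ : ∃ ε : ℝ, 0 < ε ∧ ε * S (p v2) < -(r * S (p v2) + T (p v2)) := by
        refine ⟨-(r * S (p v2) + T (p v2)) / (S (p v2) + 1), div_pos (by linarith) (by linarith), ?_⟩
        rw [div_mul_eq_mul_div, div_lt_iff₀ (by linarith)]
        nlinarith
      have e12 : A v2 = A v1 := by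
        refine hconn (-((r + ε) • S + T)) (fun v hv => by simp [Sr v hv, Tr v hv]) (by simp [Sx, Tx])
          (by simp [Sy, Ty]) (by simp [Sz, Tz]) (by simp [hS1, Ts]; linarith) (by simp [hT1, St])
          v1 v2 hv1r hv2r hv1F hv2F ?_ ?_
        · simp only [LinearMap.neg_apply, LinearMap.add_apply, LinearMap.smul_apply, smul_eq_mul]
          have := mul_pos_of_neg_of_neg hv1S (neg_lt_zero.2 he)
          nlinarith
        · simp only [LinearMap.neg_apply, LinearMap.add_apply, LinearMap.smul_apply, smul_eq_mul]
          nlinarith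
      rw [eAs, eAt, ← D1 v1 hv1r hv1F hv1S, ← D2 v2 hv2r hv2F hT2', e12]
  have hst2 : Fc V p (insert s (insert t ρ)) := by
    refine hFx.mono ?_
    intro a ha
    simp only [Finset.mem_insert] at ha
    rw [Finset.mem_erase]
    rcases ha with rfl | rfl | ha
    · exact ⟨Ne.symm hxs, hs⟩
    · exact ⟨Ne.symm hxt, ht⟩
    · exact ⟨((hρ a).1 ha).2.1, hrC a ha⟩
  have gs : s ∉ ρ ∧ s ≠ x ∧ s ≠ y ∧ s ≠ z ∧ Fc V p (insert s ρ) := ⟨hsr, Ne.symm hxs, Ne.symm hys, Ne.symm hzs, hFs⟩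
  have gt : t ∉ ρ ∧ t ≠ x ∧ t ≠ y ∧ t ≠ z ∧ Fc V p (insert t ρ) := ⟨htr, Ne.symm hxt, Ne.symm hyt, Ne.symm hzt, hFt⟩
  have a1 : A s (p s) = m s := hA2 s gs s (by simpa using hFs) (fun _ => hst) (fun h => absurd h hst)
  have a2 : A t (p t) = m t := hA2 t gt t (by simpa using hFt) (fun h => absurd h.symm hst) (fun _ => Ne.symm hst)
  have sk := hA1 s gs (p s + p t)
  simp only [map_add, LinearMap.add_apply, hA1 s gs] at sk
  rw [a1, eA, a2] at sk
  linarith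

end lemB

/-- centrally symmetric configuration in which every antipodal pair of edges can be flexed -/
structure CSc {ι W : Type} [DecidableEq ι] [AddCommGroup W] [Module ℝ W] (V : Finset ι) (p : ι → W)
    (n : ι → ι) (o : W) : Prop where
  cfg : Cfg V p
  nn : ∀ v, n (n v) = v
  nF : ∀ s, Fc V p s → Fc V p (s.image n)
  po : ∀ v ∈ V, p v + p (n v) = (2 : ℝ) • o
  op : ∀ φ : Module.Dual ℝ W, φ ≠ 0 → (∀ v ∈ V, 0 ≤ φ (p v)) → 0 < φ o
  ht : ∃ h : Module.Dual ℝ W, h o = 1 ∧ ∀ v ∈ V, h (p v) = 1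
  flex : ∀ u0 v0, u0 ≠ v0 → Fc V p {u0, v0} → ∃ M : ι → Module.Dual ℝ W,
    (∀ u ∈ V, M u (p u) = 0) ∧
    (∀ u w, u ≠ w → Fc V p {u, w} → ¬ (u = u0 ∧ w = v0) → ¬ (u = v0 ∧ w = u0) →
      ¬ (u = n u0 ∧ w = n v0) → ¬ (u = n v0 ∧ w = n u0) → M u (p w) + M w (p u) = 0) ∧
    M u0 (p v0) + M v0 (p u0) ≠ 0

section comb
variable {ι W : Type} [DecidableEq ι] [AddCommGroup W] [Module ℝ W] {V : Finset ι} {p : ι → W}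
  {n : ι → ι} {o : W}

theorem CSc.nF2 (h : CSc V p n o) {a b : ι} (hab : Fc V p {a, b}) : Fc V p {n a, n b} := by
  have := h.nF _ hab
  simpa [Finset.image_insert] using this

theorem CSc.anti (h : CSc V p n o) {s : Finset ι} (hs : Fc V p s) {v : ι} (hv : v ∈ s) (hn : n v ∈ s) :
    False := by
  obtain ⟨hsV, φ, h0, h1, h2⟩ := hs
  have h3 := h.op φ h0 h1
  have h4 := congrArg φ (h.po v (hsV hv))
  rw [map_add, h2 v hv, h2 _ hn, map_smul, smul_eq_mul] at h4
  linarith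

theorem CSc.fF [FiniteDimensional ℝ W] (h : CSc V p n o) {ρ : Finset ι} {x y : ι}
    (hx : Fc V p (insert x ρ)) (hy : Fc V p (insert y ρ)) (hxy : ¬ Fc V p (insert x (insert y ρ)))
    (he : Fc V p {x, y}) (hc : ρ.card + 4 ≤ Module.finrank ℝ W) :
    Fc V p (insert (n x) (insert (n y) ρ)) := by
  by_contra hcon
  have hne : x ≠ y := by
    rintro rfl
    exact hxy (by simpa using hx)
  obtain ⟨M, hM0, hM1, hM2⟩ := h.flex x y hne he
  obtain ⟨A, hA, hA2⟩ := h.cfg.rigid (hx.mono (Finset.subset_insert _ _)) hc M (by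
    intro u w huw
    by_cases e : u = w
    · subst e
      have : u ∈ V := huw.1 (Finset.mem_insert_self _ _)
      rw [hM0 u this, add_zero]
    · refine hM1 u w e (huw.mono ?_) ?_ ?_ ?_ ?_
      · intro z hz; simp only [Finset.mem_insert, Finset.mem_singleton] at hz ⊢; tauto
      · rintro ⟨rfl, rfl⟩; exact hxy huw
      · rintro ⟨rfl, rfl⟩; rw [Finset.insert_comm] at huw; exact hxy huw
      · rintro ⟨rfl, rfl⟩; exact hcon huw
      · rintro ⟨rfl, rfl⟩; rw [Finset.insert_comm] at huw; exact hcon huw)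
  apply hM2
  rw [← hA2 x hx, ← hA2 y hy]
  have h1 := hA (p x + p y)
  rw [map_add, map_add A, LinearMap.add_apply, LinearMap.add_apply, hA, hA] at h1
  linarith

/-- the clique `C` is a basis -/
theorem CSc.indep (h : CSc V p n o) {C : Finset ι} (hcl : ∀ a ∈ C, ∀ b ∈ C, Fc V p {a, b})
    (l : ι → ℝ) (hl : ∑ i ∈ C, l i • p i = 0) : ∀ i ∈ C, l i = 0 := by
  have hanti : ∀ a ∈ C, n a ∉ C := fun a ha hna => h.anti (hcl a ha _ hna) (v := a) (by simp) (by simp)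
  obtain ⟨H, hH1, hH2⟩ := h.ht
  have hCV : ∀ a ∈ C, a ∈ V := fun a ha => (hcl a ha a ha).1 (by simp)
  by_contra hcon
  push Not at hcon
  obtain ⟨i, hi, hli⟩ := hcon
  have hsum : ∑ j ∈ C, l j = 0 := by
    have := congrArg H hl
    rw [map_sum, map_zero] at this
    rw [← this]
    refine Finset.sum_congr rfl fun j hj => ?_
    rw [map_smul, hH2 j (hCV j hj), smul_eq_mul, mul_one]
  have : ∃ j ∈ C, j ≠ i ∧ l j ≠ 0 := by
    by_contra hc
    push Not at hc
    rw [Finset.sum_eq_single i (fun j hj hji => hc j hj hji) (fun hh => absurd hi hh)] at hsum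
    exact hli hsum
  obtain ⟨j, hj, hji, hlj⟩ := this
  obtain ⟨M, hM0, hM1, hM2⟩ := h.flex i j hji.symm (hcl i hi j hj)
  have hz : ∀ a ∈ C, ∀ b ∈ C, ¬ (a = i ∧ b = j) → ¬ (a = j ∧ b = i) → M a (p b) + M b (p a) = 0 := by
    intro a ha b hb h1 h2
    by_cases e : a = b
    · subst e; rw [hM0 a (hCV a ha), add_zero]
    · refine hM1 a b e (hcl a ha b hb) h1 h2 ?_ ?_
      · rintro ⟨rfl, rfl⟩; exact hanti i hi ha
      · rintro ⟨rfl, rfl⟩; exact hanti j hj ha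
  have hS : ∑ a ∈ C, ∑ b ∈ C, l a * l b * (M a (p b) + M b (p a)) = 0 := by
    have e1 : ∑ a ∈ C, ∑ b ∈ C, l a * l b * M a (p b) = 0 := by
      refine Finset.sum_eq_zero fun a ha => ?_
      have := congrArg (M a) hl
      rw [map_sum, map_zero] at this
      calc _ = l a * ∑ b ∈ C, M a (l b • p b) := by
            rw [Finset.mul_sum]; refine Finset.sum_congr rfl fun b _ => ?_
            rw [map_smul, smul_eq_mul]; ring
        _ = 0 := by rw [this, mul_zero]
    have e2 : ∑ a ∈ C, ∑ b ∈ C, l a * l b * M b (p a) = 0 := by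
      rw [Finset.sum_comm, ← e1]
      refine Finset.sum_congr rfl fun a _ => Finset.sum_congr rfl fun b _ => by ring
    simp only [mul_add, Finset.sum_add_distrib]
    rw [e1, e2, add_zero]
  have : ∑ a ∈ C, ∑ b ∈ C, l a * l b * (M a (p b) + M b (p a))
      = 2 * (l i * l j * (M i (p j) + M j (p i))) := by
    rw [← Finset.add_sum_erase _ _ hi, ← Finset.add_sum_erase _ _ (Finset.mem_erase.2 ⟨hji, hj⟩)]
    rw [Finset.sum_eq_single j, Finset.sum_eq_single i, Finset.sum_eq_zero]
    · ring
    · intro a ha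
      simp only [Finset.mem_erase] at ha
      refine Finset.sum_eq_zero fun b hb => ?_
      rw [hz a ha.2.2 b hb (fun hh => ha.2.1 hh.1) (fun hh => ha.1 hh.1), mul_zero]
    · intro b hb hbi
      rw [hz j hj b hb (fun hh => hji hh.1) (fun hh => hbi hh.2), mul_zero]
    · intro hh; exact absurd hi hh
    · intro b hb hbi
      rw [hz i hi b hb (fun hh => hbi hh.2) (fun hh => hji hh.1.symm), mul_zero]
    · intro hh; exact absurd hj hh
  rw [this] at hS
  have : l i * l j * (M i (p j) + M j (p i)) ≠ 0 := mul_ne_zero (mul_ne_zero hli hlj) hM2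
  apply this; linarith

/-- flexing the pair `(s, -x)` -/
theorem CSc.final_aux (h : CSc V p n o) {C : Finset ι} (hcl : ∀ a ∈ C, ∀ b ∈ C, Fc V p {a, b})
    {c : ι → ℝ} (hc : ∑ i ∈ C, c i • p i = o) {x y s : ι} (hx : x ∈ C) (hy : y ∈ C) (hs : s ∈ C)
    (hxy : x ≠ y) (hsx : s ≠ x) (hsy : s ≠ y) (hcs : c s ≠ 0)
    (hX : ∀ a ∈ C, a ≠ x → Fc V p {a, n x}) (hY : ∀ a ∈ C, a ≠ y → Fc V p {a, n y}) :
    2 * c y = 1 ∧ (2 * c x = 1 → False) := by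
  have hanti : ∀ a ∈ C, n a ∉ C := fun a ha hna => h.anti (hcl a ha _ hna) (v := a) (by simp) (by simp)
  have hCV : ∀ a ∈ C, a ∈ V := fun a ha => (hcl a ha a ha).1 (by simp)
  have ninj : ∀ a b, n a = n b → a = b := fun a b e => by rw [← h.nn a, e, h.nn]
  have nne : ∀ a ∈ C, ∀ b ∈ C, a ≠ n b := by
    intro a ha b hb e; exact hanti b hb (e ▸ ha)
  obtain ⟨M, hM0, hM1, hM2⟩ := h.flex s (n x) (nne s hs x hx) (hX s hs hsx)
  rw [h.nn] at hM1
  have hnx : n x ∈ V := (hX s hs hsx).1 (by simp)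
  have hny : n y ∈ V := (hY s hs hsy).1 (by simp)
  have hz : ∀ a ∈ C, ∀ b ∈ C, M a (p b) + M b (p a) = 0 := by
    intro a ha b hb
    by_cases e : a = b
    · subst e; rw [hM0 a (hCV a ha), add_zero]
    · refine hM1 a b e (hcl a ha b hb) ?_ ?_ ?_ ?_
      · rintro ⟨rfl, rfl⟩; exact hanti x hx hb
      · rintro ⟨rfl, rfl⟩; exact hanti x hx ha
      · rintro ⟨rfl, rfl⟩; exact hanti s hs ha
      · rintro ⟨rfl, rfl⟩; exact hanti s hs hb
  have hzx : ∀ a ∈ C, a ≠ x → a ≠ s → M a (p (n x)) + M (n x) (p a) = 0 := by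
    intro a ha h1 h2
    refine hM1 a (n x) (nne a ha x hx) (hX a ha h1) ?_ ?_ ?_ ?_
    · rintro ⟨e, -⟩; exact h2 e
    · rintro ⟨e, -⟩; exact nne a ha x hx e
    · rintro ⟨e, -⟩; exact nne a ha s hs e
    · rintro ⟨e, -⟩; exact h1 e
  have hzy : ∀ a ∈ C, a ≠ y → M a (p (n y)) + M (n y) (p a) = 0 := by
    intro a ha h1
    refine hM1 a (n y) (nne a ha y hy) (hY a ha h1) ?_ ?_ ?_ ?_
    · rintro ⟨-, e⟩; exact hxy (ninj _ _ e).symm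
    · rintro ⟨-, e⟩; exact nne s hs y hy e.symm
    · rintro ⟨-, e⟩; exact nne x hx y hy e.symm
    · rintro ⟨-, e⟩; exact hsy (ninj _ _ e).symm
  have hzxy : M (n x) (p (n y)) + M (n y) (p (n x)) = 0 := by
    refine hM1 (n x) (n y) (fun e => hxy (ninj _ _ e)) (h.nF2 (hcl x hx y hy)) ?_ ?_ ?_ ?_
    · rintro ⟨e, -⟩; exact nne s hs x hx e.symm
    · rintro ⟨-, e⟩; exact nne s hs y hy e.symm
    · rintro ⟨-, e⟩; exact nne x hx y hy e.symm
    · rintro ⟨e, -⟩; exact nne x hx x hx e.symm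
  have hpn : ∀ z ∈ C, p (n z) = ∑ i ∈ C, (2 * c i - if i = z then 1 else 0) • p i := by
    intro z hz
    have h1 := h.po z (hCV z hz)
    rw [eq_sub_of_add_eq' h1, ← hc, Finset.smul_sum]
    simp only [sub_smul, Finset.sum_sub_distrib, ite_smul, one_smul, zero_smul, Finset.sum_ite_eq', hz,
      if_true, mul_smul]
  -- general bilinear identity
  have key : ∀ a b : ι → ℝ, ∀ X Y : ι, p X = ∑ i ∈ C, a i • p i → p Y = ∑ i ∈ C, b i • p i →
      (∑ i ∈ C, a i * (M i (p Y) + M Y (p i))) + (∑ j ∈ C, b j * (M j (p X) + M X (p j)))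
        = M X (p Y) + M Y (p X) := by
    intro a b X Y ha hb
    have e1 : ∑ i ∈ C, a i * M Y (p i) = M Y (p X) := by
      rw [ha, map_sum]; refine Finset.sum_congr rfl fun i _ => by rw [map_smul, smul_eq_mul]
    have e2 : ∑ i ∈ C, b i * M X (p i) = M X (p Y) := by
      rw [hb, map_sum]; refine Finset.sum_congr rfl fun i _ => by rw [map_smul, smul_eq_mul]
    have e3 : ∑ i ∈ C, a i * M i (p Y) = ∑ i ∈ C, ∑ j ∈ C, a i * b j * M i (p j) := by
      refine Finset.sum_congr rfl fun i _ => ?_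
      rw [hb, map_sum, Finset.mul_sum]
      refine Finset.sum_congr rfl fun j _ => by rw [map_smul, smul_eq_mul, mul_assoc]
    have e4 : ∑ j ∈ C, b j * M j (p X) = ∑ i ∈ C, ∑ j ∈ C, a i * b j * M j (p i) := by
      rw [Finset.sum_comm]
      refine Finset.sum_congr rfl fun j _ => ?_
      rw [ha, map_sum, Finset.mul_sum]
      refine Finset.sum_congr rfl fun i _ => by rw [map_smul, smul_eq_mul]; ring
    simp only [mul_add, Finset.sum_add_distrib]
    rw [e1, e2, e3, e4]
    have : (∑ i ∈ C, ∑ j ∈ C, a i * b j * M i (p j)) + (∑ i ∈ C, ∑ j ∈ C, a i * b j * M j (p i)) = 0 := by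
      rw [← Finset.sum_add_distrib]
      refine Finset.sum_eq_zero fun i hi => ?_
      rw [← Finset.sum_add_distrib]
      refine Finset.sum_eq_zero fun j hj => ?_
      rw [← mul_add, hz i hi j hj, mul_zero]
    linarith
  have Sx : ∀ a : ι → ℝ, ∑ i ∈ C, a i * (M i (p (n x)) + M (n x) (p i))
      = a x * (M x (p (n x)) + M (n x) (p x)) + a s * (M s (p (n x)) + M (n x) (p s)) := by
    intro a
    rw [← Finset.add_sum_erase _ _ hx, ← Finset.add_sum_erase _ _ (Finset.mem_erase.2 ⟨hsx, hs⟩),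
      Finset.sum_eq_zero, add_zero]
    intro i hi
    simp only [Finset.mem_erase] at hi
    rw [hzx i hi.2.2 hi.2.1 hi.1, mul_zero]
  have Sy : ∀ a : ι → ℝ, ∑ i ∈ C, a i * (M i (p (n y)) + M (n y) (p i))
      = a y * (M y (p (n y)) + M (n y) (p y)) := by
    intro a
    rw [← Finset.add_sum_erase _ _ hy, Finset.sum_eq_zero, add_zero]
    intro i hi
    simp only [Finset.mem_erase] at hi
    rw [hzy i hi.2 hi.1, mul_zero]
  have k1 := key _ _ _ _ (hpn x hx) (hpn x hx)
  have k2 := key _ _ _ _ (hpn x hx) (hpn y hy)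
  have k3 := key _ _ _ _ (hpn y hy) (hpn y hy)
  rw [Sx, hM0 _ hnx] at k1
  rw [Sx, Sy, hzxy] at k2
  rw [Sy, hM0 _ hny] at k3
  simp only [if_true, hsx, hsy, hxy, hxy.symm, if_false] at k1 k2 k3
  set X := M x (p (n x)) + M (n x) (p x)
  set Y := M y (p (n y)) + M (n y) (p y)
  set Z := M s (p (n x)) + M (n x) (p s)
  have hZ : c s * Z ≠ 0 := mul_ne_zero hcs hM2
  constructor
  · by_contra hne
    have hY0 : Y = 0 := by
      have : (2 * c y - 1) * Y = 0 := by linarith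
      rcases mul_eq_zero.1 this with h1 | h1
      · exact absurd (by linarith) hne
      · exact h1
    rw [hY0] at k2
    apply hZ
    have hX0 : X = 0 := by linarith
    rw [hX0] at k1
    linarith
  · intro h1
    apply hZ
    rw [h1] at k1
    linarith

theorem CSc.final (h : CSc V p n o) {C : Finset ι} (hcl : ∀ a ∈ C, ∀ b ∈ C, Fc V p {a, b})
    {c : ι → ℝ} (hc : ∑ i ∈ C, c i • p i = o) {x y : ι} (hx : x ∈ C) (hy : y ∈ C)
    (hxy : x ≠ y)
    (hX : ∀ a ∈ C, a ≠ x → Fc V p {a, n x}) (hY : ∀ a ∈ C, a ≠ y → Fc V p {a, n y}) : False := by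
  have : ∃ s ∈ C, s ≠ x ∧ s ≠ y ∧ c s ≠ 0 := by
    by_contra hcon
    push Not at hcon
    obtain ⟨hV, φ, h0, h1, h2⟩ := hcl x hx y hy
    have h3 := h.op φ h0 h1
    rw [← hc, map_sum] at h3
    refine h3.ne' (Finset.sum_eq_zero fun i hi => ?_)
    rw [map_smul]
    by_cases ex : i = x
    · rw [ex, h2 x (by simp), smul_zero]
    by_cases ey : i = y
    · rw [ey, h2 y (by simp), smul_zero]
    rw [hcon i hi ex ey, zero_smul]
  obtain ⟨s, hs, hsx, hsy, hcs⟩ := this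
  have a1 := h.final_aux hcl hc hx hy hs hxy hsx hsy hcs hX hY
  have a2 := h.final_aux hcl hc hy hx hs hxy.symm hsy hsx hcs hY hX
  exact a1.2 a2.1

theorem CSc.main [FiniteDimensional ℝ W] (h : CSc V p n o)
    (hprime : ∀ μ : Finset ι, μ ⊆ V → ¬ Fc V p μ → (∀ ρ, ρ ⊂ μ → Fc V p ρ) → μ.card + 1 ≠ Module.finrank ℝ W)
    (hfr : 6 ≤ Module.finrank ℝ W) {C S : Finset ι} (hCc : C.card = Module.finrank ℝ W)
    (hCn : ¬ Fc V p C) (hSC : S ⊆ C) (hS3 : 3 ≤ S.card) (hS : ∀ x ∈ S, Fc V p (C.erase x)) : False := by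
  have hav : ∀ a b : ι, ∃ x ∈ S, x ≠ a ∧ x ≠ b := by
    intro a b
    by_contra hcon
    push Not at hcon
    have : S ⊆ {a, b} := by
      intro x hx
      by_cases e : x = a
      · simp [e]
      · simp [hcon x hx e]
    have := (Finset.card_le_card this).trans (Finset.card_le_two)
    omega
  have hcl : ∀ a ∈ C, ∀ b ∈ C, Fc V p {a, b} := by
    intro a ha b hb
    obtain ⟨x, hx, h1, h2⟩ := hav a b
    refine (hS x hx).mono ?_
    intro z hz
    simp only [Finset.mem_insert, Finset.mem_singleton] at hz
    rcases hz with rfl | rfl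
    · exact Finset.mem_erase.2 ⟨h1.symm, ha⟩
    · exact Finset.mem_erase.2 ⟨h2.symm, hb⟩
  have hCV : C ⊆ V := fun a ha => (hcl a ha a ha).1 (by simp)
  have hli : LinearIndependent ℝ (fun i : C => p i) := by
    rw [Fintype.linearIndependent_iff]
    intro g hg i
    have := h.indep hcl (fun j => if hj : j ∈ C then g ⟨j, hj⟩ else 0) (by
      rw [← Finset.sum_coe_sort, ← hg]
      refine Finset.sum_congr rfl fun j _ => ?_
      simp) i i.2
    simpa using this
  have hCne : Nonempty C := by
    have : 0 < C.card := by omega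
    obtain ⟨a, ha⟩ := Finset.card_pos.1 this
    exact ⟨⟨a, ha⟩⟩
  let B := basisOfLinearIndependentOfCardEqFinrank hli (by simpa using hCc)
  have hB : ∀ i, B i = p i := fun i => by simp [B]
  have hsp : ∀ φ : Module.Dual ℝ W, (∀ c ∈ C, φ (p c) = 0) → φ = 0 := by
    intro φ hφ
    refine B.ext fun i => ?_
    rw [hB, hφ _ i.2]; simp
  have hb : ∀ c ∈ C, ∃ α : Module.Dual ℝ W, α (p c) = 1 ∧ ∀ c' ∈ C, c' ≠ c → α (p c') = 0 := by
    intro c hc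
    refine ⟨B.coord ⟨c, hc⟩, ?_, ?_⟩
    · rw [show p c = B ⟨c, hc⟩ from (hB ⟨c, hc⟩).symm]; simp
    · intro c' hc' hne
      rw [show p c' = B ⟨c', hc'⟩ from (hB ⟨c', hc'⟩).symm]
      simp [Finsupp.single_apply, hne]
  obtain ⟨c, hc⟩ : ∃ c : ι → ℝ, ∑ i ∈ C, c i • p i = o := by
    refine ⟨fun j => if hj : j ∈ C then B.repr o ⟨j, hj⟩ else 0, ?_⟩
    rw [← Finset.sum_coe_sort]
    conv_rhs => rw [← B.sum_repr o]
    refine Finset.sum_congr rfl fun j _ => ?_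
    simp [hB]
  have hfin : ∀ x ∈ C, ∀ y ∈ C, x ≠ y → (∀ a ∈ C, a ≠ x → Fc V p {a, n x}) →
      (∀ a ∈ C, a ≠ y → Fc V p {a, n y}) → False := fun x hx y hy hxy hX hY =>
    h.final hcl hc hx hy hxy hX hY
  have hsum : ∑ i ∈ C, c i = 1 := by
    obtain ⟨H, hH1, hH2⟩ := h.ht
    rw [← hc, map_sum] at hH1
    rw [← hH1]
    refine Finset.sum_congr rfl fun i hi => ?_
    rw [map_smul, hH2 i (hCV hi), smul_eq_mul, mul_one]
  have half : ∀ w ∈ C, Fc V p (C.erase w) → 1 / 2 ≤ c w := by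
    rintro w hw ⟨-, φ, h0, h1, h2⟩
    have e1 : φ o = c w * φ (p w) := by
      rw [← hc, map_sum, Finset.sum_eq_single w]
      · rw [map_smul, smul_eq_mul]
      · intro i hi hiw
        rw [map_smul, h2 i (Finset.mem_erase.2 ⟨hiw, hi⟩), smul_zero]
      · intro hh; exact absurd hw hh
    have hn : n w ∈ V := by
      have := h.nF2 (hcl w hw w hw)
      exact this.1 (by simp)
    have e2 := congrArg φ (h.po w (hCV hw))
    rw [map_add, map_smul, smul_eq_mul, e1] at e2
    have e3 := h1 _ hn
    have e4 := h1 _ (hCV hw)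
    have e5 := h.op φ h0 h1
    have e6 : 0 < φ (p w) := by
      rcases e4.lt_or_eq with e | e
      · exact e
      · rw [e1, ← e, mul_zero] at e5; exact absurd e5 (lt_irrefl _)
    by_contra hlt
    push Not at hlt
    nlinarith
  -- missing faces
  have hmin : ∀ D : Finset ι, D ⊆ C → ¬ Fc V p D → ∃ μ, μ ⊆ D ∧ ¬ Fc V p μ ∧ (∀ ρ, ρ ⊂ μ → Fc V p ρ) := by
    intro D
    induction D using Finset.strongInduction with
    | H D ih =>
      intro hD hn
      by_cases hall : ∀ ρ, ρ ⊂ D → Fc V p ρ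
      · exact ⟨D, Finset.Subset.refl _, hn, hall⟩
      · push Not at hall
        obtain ⟨ρ, hρ, hρn⟩ := hall
        obtain ⟨μ, h1, h2⟩ := ih ρ hρ (hρ.1.trans hD) hρn
        exact ⟨μ, h1.trans hρ.1, h2⟩
  have hTμ : ∀ μ, μ ⊆ C → ¬ Fc V p μ → ∀ w ∈ C, Fc V p (C.erase w) → w ∈ μ := by
    intro μ hμ hn w hw hF
    by_contra hwμ
    exact hn (hF.mono (fun z hz => Finset.mem_erase.2 ⟨fun e => hwμ (e ▸ hz), hμ hz⟩))
  have hcard : ∀ μ, μ ⊆ C → ¬ Fc V p μ → (∀ ρ, ρ ⊂ μ → Fc V p ρ) → 2 ≤ (C \ μ).card := by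
    intro μ hμ hn hall
    have h1 := hprime μ (hμ.trans hCV) hn hall
    have h2 := Finset.card_sdiff_add_card_eq_card hμ
    by_contra hlt
    have h3 : (C \ μ).card = 0 := by omega
    have h4 : C = μ := by
      rw [Finset.card_eq_zero, Finset.sdiff_eq_empty_iff_subset] at h3
      exact Finset.Subset.antisymm h3 hμ
    have h5 : ∑ i ∈ C, (1 / 2 : ℝ) ≤ ∑ i ∈ C, c i :=
      Finset.sum_le_sum fun i hi => half i hi (h4 ▸ hall _ (Finset.erase_ssubset (h4 ▸ hi)))
    rw [hsum, Finset.sum_const, nsmul_eq_mul] at h5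
    have h6 : (6 : ℝ) ≤ (C.card : ℝ) := by rw [hCc]; exact_mod_cast hfr
    linarith
  have hSμ : ∀ μ, μ ⊆ C → ¬ Fc V p μ → S ⊆ μ := fun μ h1 h2 x hx => hTμ μ h1 h2 x (hSC hx) (hS x hx)
  have hadj : ∀ μ, μ ⊆ C → ¬ Fc V p μ → (∀ ρ, ρ ⊂ μ → Fc V p ρ) → ∀ x ∈ μ, ∀ a ∈ μ, a ≠ x →
      Fc V p {a, n x} := by
    intro μ hμ hn hall x hx a ha hax
    obtain ⟨y, hyS, hyx, hya⟩ := hav x a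
    have hy := hSμ μ hμ hn hyS
    have e1 : insert x ((μ.erase x).erase y) = μ.erase y := by
      ext z; simp only [Finset.mem_insert, Finset.mem_erase]
      by_cases hz : z = x
      · subst hz; simp [hyx.symm, hx]
      · simp [hz]
    have e2 : insert y ((μ.erase x).erase y) = μ.erase x :=
      Finset.insert_erase (Finset.mem_erase.2 ⟨hyx, hy⟩)
    have := h.fF (ρ := (μ.erase x).erase y) (x := x) (y := y)
      (by rw [e1]; exact hall _ (Finset.erase_ssubset hy))
      (by rw [e2]; exact hall _ (Finset.erase_ssubset hx))
      (by rw [e2, Finset.insert_erase hx]; exact hn) (hcl x (hμ hx) y (hμ hy)) (by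
        rw [Finset.card_erase_of_mem (Finset.mem_erase.2 ⟨hyx, hy⟩), Finset.card_erase_of_mem hx]
        have h1 := hcard μ hμ hn hall
        have h2 := Finset.card_sdiff_add_card_eq_card hμ
        have h3 := Finset.card_le_card (hSμ μ hμ hn)
        omega)
    refine this.mono ?_
    intro z hz
    simp only [Finset.mem_insert, Finset.mem_singleton, Finset.mem_erase] at hz ⊢
    rcases hz with rfl | rfl
    · exact Or.inr (Or.inr ⟨hya.symm, hax, ha⟩)
    · exact Or.inl rfl
  -- case A
  have hA : ∀ μ, μ ⊆ C → ¬ Fc V p μ → (∀ ρ, ρ ⊂ μ → Fc V p ρ) → (C \ μ).card ≤ 2 := by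
    intro μ hμ hn hall
    by_contra hlt
    push Not at hlt
    have hN : ∀ x ∈ S, ∀ a ∈ C, a ≠ x → Fc V p {a, n x} := by
      intro x hx a ha hax
      have hxμ := hSμ μ hμ hn hx
      by_cases haμ : a ∈ μ
      · exact hadj μ hμ hn hall x hxμ a haμ hax
      obtain ⟨y, hyS, hyx, hya⟩ := hav x a
      have hyμ := hSμ μ hμ hn hyS
      have h1 : 1 < ((C \ μ).erase a).card := by
        rw [Finset.card_erase_of_mem (Finset.mem_sdiff.2 ⟨ha, haμ⟩)]; omega
      obtain ⟨s, hs, t, ht, hst⟩ := Finset.one_lt_card.1 h1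
      simp only [Finset.mem_erase, Finset.mem_sdiff] at hs ht
      have hsx : s ≠ x := fun e => hs.2.2 (e ▸ hxμ)
      have htx : t ≠ x := fun e => ht.2.2 (e ▸ hxμ)
      have hsy : s ≠ y := fun e => hs.2.2 (e ▸ hyμ)
      have hty : t ≠ y := fun e => ht.2.2 (e ▸ hyμ)
      have hρc : ((((C.erase x).erase y).erase s).erase t).card = C.card - 4 := by
        rw [Finset.card_erase_of_mem, Finset.card_erase_of_mem, Finset.card_erase_of_mem,
          Finset.card_erase_of_mem (hSC hx)]
        · omega
        · simp [hyx, hSC hyS]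
        · simp [hsx, hsy, hs.2.1]
        · simp [hst.symm, htx, hty, ht.2.1]
      have := h.fF (ρ := (((C.erase x).erase y).erase s).erase t) (x := x) (y := y)
        ((hS y hyS).mono (by
          intro z hz
          simp only [Finset.mem_insert, Finset.mem_erase] at hz ⊢
          rcases hz with rfl | hz
          · exact ⟨hyx.symm, hSC hx⟩
          · exact ⟨hz.2.2.1, hz.2.2.2.2⟩))
        ((hS x hx).mono (by
          intro z hz
          simp only [Finset.mem_insert, Finset.mem_erase] at hz ⊢
          rcases hz with rfl | hz
          · exact ⟨hyx, hSC hyS⟩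
          · exact ⟨hz.2.2.2.1, hz.2.2.2.2⟩))
        (fun hF => hn (hF.mono (by
          intro z hz
          have hzs : z ≠ s := fun e => hs.2.2 (e ▸ hz)
          have hzt : z ≠ t := fun e => ht.2.2 (e ▸ hz)
          simp only [Finset.mem_insert, Finset.mem_erase]
          by_cases z1 : z = x
          · exact Or.inl z1
          by_cases z2 : z = y
          · exact Or.inr (Or.inl z2)
          exact Or.inr (Or.inr ⟨hzt, hzs, z2, z1, hμ hz⟩))))
        (hcl x (hSC hx) y (hSC hyS)) (by rw [hρc]; omega)
      refine this.mono ?_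
      intro z hz
      simp only [Finset.mem_insert, Finset.mem_singleton, Finset.mem_erase] at hz ⊢
      rcases hz with rfl | rfl
      · exact Or.inr (Or.inr ⟨ht.1.symm, hs.1.symm, hya.symm, hax, ha⟩)
      · exact Or.inl rfl
    obtain ⟨x, hx⟩ := Finset.card_pos.1 (show 0 < S.card by omega)
    obtain ⟨y, hy, hyx, -⟩ := hav x x
    exact hfin x (hSC hx) y (hSC hy) hyx.symm (hN x hx) (hN y hy)
  -- case B
  set T := C.filter (fun w => Fc V p (C.erase w)) with hT
  have hST : S ⊆ T := fun x hx => Finset.mem_filter.2 ⟨hSC hx, hS x hx⟩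
  have hB2 : ∀ μ, μ ⊆ C → ¬ Fc V p μ → (∀ ρ, ρ ⊂ μ → Fc V p ρ) → ∀ r ∈ μ, 3 ≤ (T.erase r).card →
      ∀ a ∈ C, a ≠ r → Fc V p {a, n r} := by
    intro μ hμ hn hall r hr hTr a ha har
    by_cases haμ : a ∈ μ
    · exact hadj μ hμ hn hall r hr a haμ har
    have hc2 : (C \ μ).card = 2 := le_antisymm (hA μ hμ hn hall) (hcard μ hμ hn hall)
    obtain ⟨x, y, z, hx, hy, hz, hxy, hxz, hyz⟩ := Finset.two_lt_card_iff.1 hTr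
    simp only [hT, Finset.mem_erase, Finset.mem_filter] at hx hy hz
    have hxμ := hTμ μ hμ hn x hx.2.1 hx.2.2
    have hyμ := hTμ μ hμ hn y hy.2.1 hy.2.2
    have hzμ := hTμ μ hμ hn z hz.2.1 hz.2.2
    obtain ⟨s, t, hst, hCμ⟩ := Finset.card_eq_two.1 hc2
    have hm : ∀ w, (w ∈ C ∧ w ∉ μ) ↔ (w = s ∨ w = t) := by
      intro w
      have : w ∈ C \ μ ↔ w ∈ ({s, t} : Finset ι) := by rw [hCμ]
      simpa using this
    have hs := (hm s).2 (Or.inl rfl)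
    have ht := (hm t).2 (Or.inr rfl)
    have hne : ∀ w ∈ μ, w ≠ s ∧ w ≠ t := fun w hw => ⟨fun e => hs.2 (e ▸ hw), fun e => ht.2 (e ▸ hw)⟩
    set ρ := ((μ.erase x).erase y).erase z with hρ
    have hρm : ∀ w, w ∈ ρ ↔ w ∈ C ∧ w ≠ x ∧ w ≠ y ∧ w ≠ z ∧ w ≠ s ∧ w ≠ t := by
      intro w
      simp only [hρ, Finset.mem_erase]
      have := hm w
      constructor
      · rintro ⟨h1, h2, h3, h4⟩
        exact ⟨hμ h4, h3, h2, h1, hne w h4⟩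
      · rintro ⟨h1, h2, h3, h4, h5, h6⟩
        exact ⟨h4, h3, h2, by tauto⟩
    have hρc : ρ.card = μ.card - 3 := by
      rw [hρ, Finset.card_erase_of_mem, Finset.card_erase_of_mem, Finset.card_erase_of_mem hxμ]
      · omega
      · simp [hxy.symm, hyμ]
      · simp [hxz.symm, hyz.symm, hzμ]
    have hμ3 : 3 ≤ μ.card := hS3.trans (Finset.card_le_card (hSμ μ hμ hn))
    have h2 := Finset.card_sdiff_add_card_eq_card hμ
    have hface : Fc V p (insert (n s) (insert (n t) ρ)) := by
      by_contra hcon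
      obtain ⟨M, hM0, hM1, hM2⟩ := h.flex s t hst (hcl s hs.1 t ht.1)
      refine hM2 (h.cfg.lemB (C := C) (ρ := ρ) (x := x) (y := y) (z := z) hCV hsp hb (by omega) hx.2.1 hy.2.1 hz.2.1
        hs.1 ht.1 ?_ hρm hx.2.2 hy.2.2 hz.2.2 ?_ M ?_)
      · have a1 := hne x hxμ
        have a2 := hne y hyμ
        have a3 := hne z hzμ
        simp [hxy, hxz, hyz, a1, a2, a3, hst]
      · intro hF
        refine hn (hF.mono ?_)
        intro w hw
        have := hne w hw
        simp [hμ hw, this]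
      · intro u w huw h1 h2
        by_cases e : u = w
        · subst e
          have : u ∈ V := huw.1 (Finset.mem_insert_self _ _)
          rw [hM0 u this, add_zero]
        · refine hM1 u w e (huw.mono ?_) h1 h2 ?_ ?_
          · intro z hz; simp only [Finset.mem_insert, Finset.mem_singleton] at hz ⊢; tauto
          · rintro ⟨rfl, rfl⟩; exact hcon huw
          · rintro ⟨rfl, rfl⟩; rw [Finset.insert_comm] at huw; exact hcon huw
    have hrρ : r ∈ ρ := (hρm r).2 ⟨hμ hr, hx.1.symm, hy.1.symm, hz.1.symm, hne r hr⟩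
    have hna : n a = n s ∨ n a = n t := by
      rcases (hm a).1 ⟨ha, haμ⟩ with rfl | rfl
      · exact Or.inl rfl
      · exact Or.inr rfl
    have h3 : Fc V p {n a, r} := by
      refine hface.mono ?_
      intro w hw
      simp only [Finset.mem_insert, Finset.mem_singleton] at hw ⊢
      rcases hw with rfl | rfl
      · tauto
      · exact Or.inr (Or.inr hrρ)
    have := h.nF2 h3
    rwa [h.nn] at this
  obtain ⟨μ, hμ, hn, hall⟩ := hmin C (Finset.Subset.refl _) hCn
  have hc2 : (C \ μ).card = 2 := le_antisymm (hA μ hμ hn hall) (hcard μ hμ hn hall)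
  have h2 := Finset.card_sdiff_add_card_eq_card hμ
  have hTμ' : T ⊆ μ := fun w hw => hTμ μ hμ hn w (Finset.mem_filter.1 hw).1 (Finset.mem_filter.1 hw).2
  have hT3 : 3 ≤ T.card := hS3.trans (Finset.card_le_card hST)
  by_cases hT4 : 4 ≤ T.card
  · obtain ⟨r, hr, r', hr', hrr⟩ := Finset.one_lt_card.1 (show 1 < T.card by omega)
    refine hfin r (hμ (hTμ' hr)) r' (hμ (hTμ' hr')) hrr (hB2 μ hμ hn hall r (hTμ' hr) ?_)
      (hB2 μ hμ hn hall r' (hTμ' hr') ?_)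
    · rw [Finset.card_erase_of_mem hr]; omega
    · rw [Finset.card_erase_of_mem hr']; omega
  · obtain ⟨r, hr, hrT⟩ := Finset.exists_mem_notMem_of_card_lt_card (show T.card < μ.card by omega)
    have hrn : ¬ Fc V p (C.erase r) := fun hF => hrT (Finset.mem_filter.2 ⟨hμ hr, hF⟩)
    obtain ⟨μ₂, hμ₂, hn₂, hall₂⟩ := hmin (C.erase r) (Finset.erase_subset _ _) hrn
    have hμ₂C : μ₂ ⊆ C := hμ₂.trans (Finset.erase_subset _ _)
    have hc3 : (C \ μ₂).card = 2 := le_antisymm (hA μ₂ hμ₂C hn₂ hall₂) (hcard μ₂ hμ₂C hn₂ hall₂)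
    have h3 := Finset.card_sdiff_add_card_eq_card hμ₂C
    obtain ⟨r₂, hr₂, hrT₂⟩ := Finset.exists_mem_notMem_of_card_lt_card (show T.card < μ₂.card by omega)
    refine hfin r (hμ hr) r₂ (hμ₂C hr₂) (fun e => (Finset.mem_erase.1 (hμ₂ hr₂)).1 e.symm)
      (hB2 μ hμ hn hall r hr ?_) (hB2 μ₂ hμ₂C hn₂ hall₂ r₂ hr₂ ?_)
    · rwa [Finset.erase_eq_of_notMem hrT]
    · rwa [Finset.erase_eq_of_notMem hrT₂]
end comb

section transl
variable {d : ℕ}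

/-- homogenization -/
def pp (v : Fin d → ℝ) : (Fin d → ℝ) × ℝ := (v, 1)

/-- homogeneous functional of an affine functional -/
def hom (f : (Fin d → ℝ) →ₗ[ℝ] ℝ) (c : ℝ) : Module.Dual ℝ ((Fin d → ℝ) × ℝ) :=
  c • LinearMap.snd ℝ (Fin d → ℝ) ℝ - f.comp (LinearMap.fst ℝ (Fin d → ℝ) ℝ)

theorem hom_apply (f : (Fin d → ℝ) →ₗ[ℝ] ℝ) (c : ℝ) (x : Fin d → ℝ) (r : ℝ) :
    hom f c (x, r) = c * r - f x := by
  simp [hom]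

theorem exists_hom (φ : Module.Dual ℝ ((Fin d → ℝ) × ℝ)) : ∃ f c, φ = hom f c := by
  refine ⟨-(φ.comp (LinearMap.inl ℝ (Fin d → ℝ) ℝ)), φ (0, 1), ?_⟩
  refine LinearMap.ext fun ⟨x, r⟩ => ?_
  rw [hom_apply]
  have : ((x, r) : (Fin d → ℝ) × ℝ) = (x, 0) + r • ((0 : Fin d → ℝ), (1 : ℝ)) := by simp
  rw [this, map_add, map_smul, smul_eq_mul]
  simp only [LinearMap.neg_apply, LinearMap.comp_apply, LinearMap.inl_apply]
  ring

theorem pp_sp (P : SPolytope d) (φ : Module.Dual ℝ ((Fin d → ℝ) × ℝ)) (h : ∀ v ∈ P.V, φ (pp v) = 0) :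
    φ = 0 := by
  obtain ⟨f, c, rfl⟩ := exists_hom φ
  let L : AffineSubspace ℝ (Fin d → ℝ) :=
    { carrier := {x | f x = c}
      smul_vsub_vadd_mem' := by
        intro r a b e ha hb he
        simp only [Set.mem_setOf_eq] at *
        simp [ha, hb, he] }
  have h1 : affineSpan ℝ (P.V : Set (Fin d → ℝ)) ≤ L := by
    rw [affineSpan_le]
    intro v hv
    have := h v hv
    rw [pp, hom_apply] at this
    show f v = c
    linarith
  rw [P.span_top] at h1
  have h2 : ∀ x, f x = c := fun x => h1 (AffineSubspace.mem_top ℝ _ x)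
  have h3 : c = 0 := by rw [← h2 0, map_zero]
  refine LinearMap.ext fun ⟨x, r⟩ => ?_
  rw [hom_apply, h2, h3]; simp

theorem hom_le_hull (P : SPolytope d) {f : (Fin d → ℝ) →ₗ[ℝ] ℝ} {c : ℝ}
    (h : ∀ v ∈ P.V, 0 ≤ hom f c (pp v)) : ∀ y ∈ polyBody P.V, f y ≤ c := by
  intro y hy
  have : polyBody P.V ⊆ {x | f x ≤ c} := by
    refine convexHull_min ?_ (convex_halfSpace_le f.isLinear c)
    intro v hv
    have := h v hv
    rw [pp, hom_apply] at this
    show f v ≤ c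
    linarith
  exact this hy

theorem proper_of_hom (P : SPolytope d) {f : (Fin d → ℝ) →ₗ[ℝ] ℝ} {c : ℝ}
    (h : ∀ v ∈ P.V, 0 ≤ hom f c (pp v)) (h0 : hom f c ≠ 0) :
    IsProperFace P.V {y ∈ polyBody P.V | f y = c} := by
  refine ⟨⟨f, c, hom_le_hull P h, rfl⟩, fun e => h0 (pp_sp P _ fun v hv => ?_)⟩
  have hv' : v ∈ polyBody P.V := subset_convexHull ℝ _ hv
  rw [← e] at hv'
  rw [pp, hom_apply, hv'.2]; ring

theorem bface_iff (P : SPolytope d) (s : Finset (Fin d → ℝ)) : BFace P s ↔ Fc P.V pp s := by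
  constructor
  · rintro ⟨hs, F, ⟨⟨f, c, hle, rfl⟩, hne⟩, hsF⟩
    refine ⟨hs, hom f c, ?_, ?_, ?_⟩
    · intro e
      apply hne
      have hc : c = 0 := by
        have := LinearMap.congr_fun e (0, 1)
        rw [hom_apply] at this; simpa using this
      have hf : ∀ x, f x = 0 := by
        intro x
        have := LinearMap.congr_fun e (x, 0)
        rw [hom_apply] at this; simpa using this
      ext y
      simp [hf, hc]
    · intro v hv
      have := hle v (subset_convexHull ℝ _ hv)
      rw [pp, hom_apply]; linarith
    · intro v hv
      have := (hsF hv).2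
      rw [pp, hom_apply, this]; ring
  · rintro ⟨hs, φ, h0, h1, h2⟩
    obtain ⟨f, c, rfl⟩ := exists_hom φ
    refine ⟨hs, _, proper_of_hom P h1 h0, fun v hv => ⟨subset_convexHull ℝ _ (hs hv), ?_⟩⟩
    have := h2 v hv
    rw [pp, hom_apply] at this
    linarith

theorem pp_cfg (P : SPolytope d) : Cfg P.V (pp (d := d)) where
  sp := pp_sp P
  simp := by
    intro φ h1 h0 v hv hφv
    obtain ⟨f, c, rfl⟩ := exists_hom φ
    have hai := (P.simplicial _ (proper_of_hom P h1 h0)).1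
    set F := {y ∈ polyBody P.V | f y = c} with hF
    have hmem : ∀ u ∈ P.V, hom f c (pp u) = 0 → u ∈ (P.V : Set (Fin d → ℝ)) ∩ F := by
      intro u hu h
      rw [pp, hom_apply] at h
      exact ⟨hu, subset_convexHull ℝ _ hu, by linarith⟩
    have hli : LinearIndependent ℝ
        (fun x : {y : Fin d → ℝ // y ∈ (P.V : Set (Fin d → ℝ)) ∩ F} => pp (x : Fin d → ℝ)) := by
      rw [linearIndependent_iff']
      intro s g hg
      rw [affineIndependent_iff] at hai
      have e1 := congrArg Prod.fst hg
      have e2 := congrArg Prod.snd hg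
      simp only [Prod.fst_sum, Prod.snd_sum, pp, Prod.smul_fst, Prod.smul_snd, smul_eq_mul, mul_one,
        Prod.fst_zero, Prod.snd_zero] at e1 e2
      exact hai s g e2 e1
    let vv : {y : Fin d → ℝ // y ∈ (P.V : Set (Fin d → ℝ)) ∩ F} := ⟨v, hmem v hv hφv⟩
    obtain ⟨α, hα⟩ := LinearMap.exists_extend ((Finsupp.lapply vv).comp hli.repr)
    have hα2 : ∀ u, α (pp (u : {y : Fin d → ℝ // y ∈ (P.V : Set (Fin d → ℝ)) ∩ F}).1)
        = (Finsupp.single u (1 : ℝ)) vv := by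
      intro u
      have hu : pp u.1 ∈ Submodule.span ℝ (Set.range
          (fun x : {y : Fin d → ℝ // y ∈ (P.V : Set (Fin d → ℝ)) ∩ F} => pp (x : Fin d → ℝ))) :=
        Submodule.subset_span ⟨u, rfl⟩
      have := LinearMap.congr_fun hα ⟨_, hu⟩
      simp only [LinearMap.comp_apply, Submodule.subtype_apply] at this
      rw [this, hli.repr_eq_single u ⟨_, hu⟩ rfl]
      rfl
    refine ⟨α, ?_, ?_⟩
    · rw [hα2 vv]; simp
    · intro u hu huv hφu
      rw [hα2 ⟨u, hmem u hu hφu⟩, Finsupp.single_apply, if_neg]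
      intro e
      exact huv (congrArg Subtype.val e)

theorem pp_po (v : Fin d → ℝ) : pp v + pp (-v) = (2 : ℝ) • ((0 : Fin d → ℝ), (1 : ℝ)) := by
  simp only [pp, Prod.mk_add_mk, Prod.smul_mk, smul_zero, add_neg_cancel]
  norm_num

theorem pp_op (P : SPolytope d) (hcs : IsCS P) (φ : Module.Dual ℝ ((Fin d → ℝ) × ℝ)) (h0 : φ ≠ 0)
    (h1 : ∀ v ∈ P.V, 0 ≤ φ (pp v)) : 0 < φ ((0 : Fin d → ℝ), (1 : ℝ)) := by
  by_contra hcon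
  push Not at hcon
  apply h0
  refine pp_sp P _ fun v hv => ?_
  have e := congrArg φ (pp_po v)
  rw [map_add, map_smul, smul_eq_mul] at e
  have a1 := h1 v hv
  have a2 := h1 _ (hcs v hv)
  linarith

theorem pp_nF (P : SPolytope d) (hcs : IsCS P) (s : Finset (Fin d → ℝ)) (hs : Fc P.V pp s) :
    Fc P.V pp (s.image (fun v => -v)) := by
  obtain ⟨hsV, φ, h0, h1, h2⟩ := hs
  obtain ⟨f, c, rfl⟩ := exists_hom φ
  have key : ∀ v : Fin d → ℝ, hom (-f) c (pp v) = hom f c (pp (-v)) := by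
    intro v; simp only [pp, hom_apply, LinearMap.neg_apply, map_neg]
  refine ⟨?_, hom (-f) c, ?_, ?_, ?_⟩
  · intro v hv
    obtain ⟨u, hu, rfl⟩ := Finset.mem_image.1 hv
    exact hcs u (hsV hu)
  · intro e
    apply h0
    refine pp_sp P _ fun v hv => ?_
    have := key (-v)
    rw [neg_neg, e] at this
    rw [← this]; rfl
  · intro v hv
    rw [key]; exact h1 _ (hcs v hv)
  · intro v hv
    obtain ⟨u, hu, rfl⟩ := Finset.mem_image.1 hv
    rw [key, neg_neg, h2 u hu]

theorem pp_vertex (hd : 0 < d) (P : SPolytope d) (hcs : IsCS P) {v : Fin d → ℝ} (hv : v ∈ P.V) :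
    Fc P.V pp {v} := by
  have hcl : IsClosed (convexHull ℝ ((P.V.erase v : Finset (Fin d → ℝ)) : Set (Fin d → ℝ))) :=
    (Finset.finite_toSet _).isClosed_convexHull ℝ
  obtain ⟨f, u, h1, h2⟩ := geometric_hahn_banach_closed_point (convex_convexHull ℝ _) hcl (P.extreme v hv)
  have hpos : ∀ w ∈ P.V, w ≠ v → 0 < hom (f : (Fin d → ℝ) →ₗ[ℝ] ℝ) (f v) (pp w) := by
    intro w hw hwv
    have := h1 w (subset_convexHull ℝ _ (by simp [hw, hwv]))
    rw [pp, hom_apply]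
    simp only [ContinuousLinearMap.coe_coe]
    linarith
  have hz : hom (f : (Fin d → ℝ) →ₗ[ℝ] ℝ) (f v) (pp v) = 0 := by
    rw [pp, hom_apply]; simp
  refine ⟨by simpa using hv, hom (f : (Fin d → ℝ) →ₗ[ℝ] ℝ) (f v), ?_, ?_, ?_⟩
  · intro e
    have hall : ∀ w ∈ P.V, w = v := by
      intro w hw
      by_contra hne
      have := hpos w hw hne
      rw [e] at this
      exact lt_irrefl _ this
    have hv0 : v = 0 := self_eq_neg.1 (hall _ (hcs v hv)).symm
    have := pp_sp P (hom (LinearMap.proj (⟨0, hd⟩ : Fin d)) 0) (by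
      intro w hw
      rw [hall w hw, hv0, pp, hom_apply]; simp)
    have := LinearMap.congr_fun this ((fun _ => 1), 0)
    rw [hom_apply] at this
    simp at this
  · intro w hw
    by_cases e : w = v
    · rw [e, hz]
    · exact (hpos w hw e).le
  · intro w hw
    rw [Finset.mem_singleton.1 hw, hz]
end transl

section flexing
variable {d : ℕ}

theorem half_count {α : Type} (S : Finset α) (g : α → α) (t : α → ℝ) (hg : ∀ a ∈ S, g a ∈ S)
    (hgg : ∀ a, g (g a) = a) (ht : ∀ a ∈ S, t (g a) = - t a) (h0 : ∀ a ∈ S, t a ≠ 0) :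
    2 * (S.filter (fun a => 0 < t a)).card = S.card := by
  have h1 := Finset.card_filter_add_card_filter_not (s := S) (fun a => 0 < t a)
  have h2 : (S.filter (fun a => 0 < t a)).card = (S.filter (fun a => ¬ 0 < t a)).card := by
    refine Finset.card_bij (fun a _ => g a) ?_ ?_ ?_
    · intro a ha
      simp only [Finset.mem_filter] at ha ⊢
      refine ⟨hg a ha.1, ?_⟩
      rw [ht a ha.1]; linarith [ha.2]
    · intro a _ b _ e
      rw [← hgg a, e, hgg]
    · intro b hb
      simp only [Finset.mem_filter] at hb
      refine ⟨g b, ?_, hgg b⟩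
      simp only [Finset.mem_filter]
      refine ⟨hg b hb.1, ?_⟩
      rw [ht b hb.1]
      have := h0 b hb.1
      have h3 : t b < 0 := lt_of_le_of_ne (not_lt.1 hb.2) this
      linarith
  omega

def dotL (a : Fin d → ℝ) : (Fin d → ℝ) →ₗ[ℝ] ℝ where
  toFun x := a ⬝ᵥ x
  map_add' := dotProduct_add a
  map_smul' := fun r x => by simp

/-- velocities as functionals -/
def MM (m : (Fin d → ℝ) → (Fin d → ℝ)) (v : Fin d → ℝ) : Module.Dual ℝ ((Fin d → ℝ) × ℝ) :=
  hom (-(dotL (m v))) (-(m v ⬝ᵥ v))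

theorem MM_apply (m : (Fin d → ℝ) → (Fin d → ℝ)) (v x : Fin d → ℝ) (r : ℝ) :
    MM m v (x, r) = m v ⬝ᵥ x - (m v ⬝ᵥ v) * r := by
  rw [MM, hom_apply]
  simp only [LinearMap.neg_apply, dotL, LinearMap.coe_mk, AddHom.coe_mk]
  ring

theorem MM_self (m : (Fin d → ℝ) → (Fin d → ℝ)) (v : Fin d → ℝ) : MM m v (pp v) = 0 := by
  rw [pp, MM_apply]; ring

theorem MM_strain (m : (Fin d → ℝ) → (Fin d → ℝ)) (u w : Fin d → ℝ) :
    MM m u (pp w) + MM m w (pp u) = -((m u - m w) ⬝ᵥ (u - w)) := by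
  rw [pp, pp, MM_apply, MM_apply]
  simp only [sub_dotProduct, dotProduct_sub]
  ring

/-- extension by zero -/
def ext0 (S : Finset (Fin d → ℝ)) (m : {v // v ∈ S} → (Fin d → ℝ)) (v : Fin d → ℝ) : Fin d → ℝ :=
  if h : v ∈ S then m ⟨v, h⟩ else 0

/-- even extension -/
def evx (S : Finset (Fin d → ℝ)) (m : {v // v ∈ S} → (Fin d → ℝ)) (v : Fin d → ℝ) : Fin d → ℝ :=
  ext0 S m v + ext0 S m (-v)

theorem evx_neg (S : Finset (Fin d → ℝ)) (m : {v // v ∈ S} → (Fin d → ℝ)) (v : Fin d → ℝ) :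
    evx S m (-v) = evx S m v := by
  rw [evx, evx, neg_neg, add_comm]

theorem evx_add (S : Finset (Fin d → ℝ)) (m m' : {v // v ∈ S} → (Fin d → ℝ)) (v : Fin d → ℝ) :
    evx S (m + m') v = evx S m v + evx S m' v := by
  have : ∀ v, ext0 S (m + m') v = ext0 S m v + ext0 S m' v := by
    intro v; unfold ext0; split_ifs <;> simp
  rw [evx, evx, evx, this, this]; abel

theorem evx_smul (S : Finset (Fin d → ℝ)) (r : ℝ) (m : {v // v ∈ S} → (Fin d → ℝ)) (v : Fin d → ℝ) :
    evx S (r • m) v = r • evx S m v := by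
  have : ∀ v, ext0 S (r • m) v = r • ext0 S m v := by
    intro v; unfold ext0; split_ifs <;> simp
  rw [evx, evx, this, this, smul_add]

/-- half rigidity map -/
def RR (S : Finset (Fin d → ℝ)) (E : Finset (Finset (Fin d → ℝ))) :
    ({v // v ∈ S} → (Fin d → ℝ)) →ₗ[ℝ] ({e // e ∈ E} → ℝ) where
  toFun m e := ∑ u ∈ e.1, ∑ w ∈ e.1, (evx S m u - evx S m w) ⬝ᵥ (u - w)
  map_add' m m' := by
    funext e
    simp only [Pi.add_apply, evx_add]
    rw [← Finset.sum_add_distrib]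
    refine Finset.sum_congr rfl fun u _ => ?_
    rw [← Finset.sum_add_distrib]
    refine Finset.sum_congr rfl fun w _ => ?_
    rw [← add_dotProduct]; congr 1; abel
  map_smul' r m := by
    funext e
    simp only [Pi.smul_apply, evx_smul, RingHom.id_apply, smul_eq_mul]
    rw [Finset.mul_sum]
    refine Finset.sum_congr rfl fun u _ => ?_
    rw [Finset.mul_sum]
    refine Finset.sum_congr rfl fun w _ => ?_
    rw [← smul_sub, smul_dotProduct, smul_eq_mul]

theorem RR_pair (S : Finset (Fin d → ℝ)) (E : Finset (Finset (Fin d → ℝ))) (m : {v // v ∈ S} → (Fin d → ℝ))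
    {a b : Fin d → ℝ} (hab : a ≠ b) (he : ({a, b} : Finset (Fin d → ℝ)) ∈ E) :
    RR S E m ⟨{a, b}, he⟩ = 2 * ((evx S m a - evx S m b) ⬝ᵥ (a - b)) := by
  show ∑ u ∈ ({a, b} : Finset (Fin d → ℝ)), ∑ w ∈ ({a, b} : Finset (Fin d → ℝ)),
    (evx S m u - evx S m w) ⬝ᵥ (u - w) = _
  rw [Finset.sum_pair hab, Finset.sum_pair hab, Finset.sum_pair hab]
  simp only [sub_dotProduct, dotProduct_sub]
  ring

theorem pp_anti (P : SPolytope d) (hcs : IsCS P) {s : Finset (Fin d → ℝ)} (hs : Fc P.V pp s)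
    {v : Fin d → ℝ} (hv : v ∈ s) (hn : -v ∈ s) : False := by
  obtain ⟨hsV, φ, h0, h1, h2⟩ := hs
  have h3 := pp_op P hcs φ h0 h1
  have h4 := congrArg φ (pp_po v)
  rw [map_add, h2 v hv, h2 _ hn, map_smul, smul_eq_mul] at h4
  linarith

theorem evx_const (hd : 5 ≤ d) (P : SPolytope d) (hcs : IsCS P) (m : (Fin d → ℝ) → (Fin d → ℝ))
    (hev : ∀ v, m (-v) = m v)
    (hm : ∀ u w, u ≠ w → Fc P.V pp {u, w} → (m u - m w) ⬝ᵥ (u - w) = 0) :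
    ∃ k, ∀ v ∈ P.V, m v = k := by
  have hV : ∀ v ∈ P.V, Fc P.V pp {v} := fun v hv => pp_vertex (by omega) P hcs hv
  by_cases hne : P.V.Nonempty
  swap
  · refine ⟨0, fun v hv => absurd ⟨v, hv⟩ hne⟩
  obtain ⟨v1, hv1⟩ := hne
  obtain ⟨A, -, hA2⟩ := (pp_cfg P).rigid (ρ := ∅) ((hV v1 hv1).mono (by simp)) (by
    simp only [Finset.card_empty, Module.finrank_prod, Module.finrank_fin_fun, Module.finrank_self]
    omega) (MM m) (by
      intro u w huw
      by_cases e : u = w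
      · subst e; rw [MM_self, add_zero]
      · rw [MM_strain, hm u w e (by simpa using huw), neg_zero])
  have hA3 : ∀ v ∈ P.V, A (pp v) = MM m v := fun v hv => hA2 v (by simpa using hV v hv)
  have key : ∀ v ∈ P.V, ∀ x : Fin d → ℝ, m v ⬝ᵥ x = A ((0 : Fin d → ℝ), (1 : ℝ)) (x, 0) := by
    intro v hv x
    have h1 := congrArg (fun z => A z (x, 0)) (pp_po v)
    simp only [map_add, map_smul, LinearMap.add_apply, LinearMap.smul_apply, smul_eq_mul] at h1
    rw [hA3 v hv, hA3 _ (hcs v hv), MM_apply, MM_apply, hev] at h1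
    linarith
  refine ⟨m v1, fun v hv => ?_⟩
  refine dotProduct_eq _ _ fun x => ?_
  rw [key v hv, key v1 hv1]

theorem pp_flex (hd : 5 ≤ d) (P : SPolytope d) (hcs : IsCS P)
    (hg2 : g2 P = (d.choose 2 : ℤ) - (d : ℤ)) (u0 v0 : Fin d → ℝ) (hne : u0 ≠ v0)
    (he : Fc P.V pp {u0, v0}) : ∃ M : (Fin d → ℝ) → Module.Dual ℝ ((Fin d → ℝ) × ℝ),
    (∀ u ∈ P.V, M u (pp u) = 0) ∧
    (∀ u w, u ≠ w → Fc P.V pp {u, w} → ¬ (u = u0 ∧ w = v0) → ¬ (u = v0 ∧ w = u0) →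
      ¬ (u = -u0 ∧ w = -v0) → ¬ (u = -v0 ∧ w = -u0) → M u (pp w) + M w (pp u) = 0) ∧
    M u0 (pp v0) + M v0 (pp u0) ≠ 0 := by
  have hedge : ∀ e, e ∈ edgeFinset P ↔ e.card = 2 ∧ Fc P.V pp e := by
    intro e
    rw [edgeFinset, Finset.mem_filter, bface_iff, Finset.mem_powerset]
    exact ⟨fun h => h.2, fun h => ⟨h.2.1, h⟩⟩
  have hpair : ∀ a b : Fin d → ℝ, a ≠ b → Fc P.V pp {a, b} → {a, b} ∈ edgeFinset P := fun a b h1 h2 =>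
    (hedge _).2 ⟨Finset.card_pair h1, h2⟩
  have hV : ∀ v ∈ P.V, Fc P.V pp {v} := fun v hv => pp_vertex (by omega) P hcs hv
  have hV0 : ∀ v ∈ P.V, v ≠ 0 := by
    rintro v hv rfl
    exact pp_anti P hcs (hV _ hv) (v := 0) (by simp) (by simp)
  let sm : Finset (Fin d → ℝ) → (Fin d → ℝ) := fun e => ∑ u ∈ e, u
  have hE0 : ∀ e ∈ edgeFinset P, sm e ≠ 0 := by
    intro e hee h0
    obtain ⟨h1, h2⟩ := (hedge e).1 hee
    obtain ⟨a, b, hab, rfl⟩ := Finset.card_eq_two.1 h1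
    simp only [sm, Finset.sum_pair hab] at h0
    have hb : b = -a := (neg_eq_of_add_eq_zero_right h0).symm
    exact pp_anti P hcs h2 (v := a) (by simp) (by simp [hb])
  obtain ⟨θ, hθ⟩ : ∃ θ : Module.Dual ℝ (Fin d → ℝ),
      ∀ z : {z // z ∈ P.V ∪ (edgeFinset P).image sm}, θ z.1 ≠ 0 := by
    refine Module.exists_dual_forall_apply_ne_zero
      (fun z : {z // z ∈ P.V ∪ (edgeFinset P).image sm} => z.1) ?_
    rintro ⟨z, hz⟩
    rcases Finset.mem_union.1 hz with h | h
    · exact hV0 z h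
    · obtain ⟨e, he, rfl⟩ := Finset.mem_image.1 h
      exact hE0 e he
  let ng : Finset (Fin d → ℝ) → Finset (Fin d → ℝ) := fun e => e.image (fun v => -v)
  have ngng : ∀ e, ng (ng e) = e := by
    intro e
    ext z
    simp only [ng, Finset.mem_image]
    constructor
    · rintro ⟨a, ⟨b, hb, rfl⟩, rfl⟩
      rwa [neg_neg]
    · intro hz
      exact ⟨-z, ⟨z, hz, rfl⟩, neg_neg z⟩
  have ngE : ∀ e ∈ edgeFinset P, ng e ∈ edgeFinset P := by
    intro e he
    rw [hedge] at he ⊢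
    refine ⟨?_, pp_nF P hcs _ he.2⟩
    rw [Finset.card_image_of_injective _ neg_injective, he.1]
  have smng : ∀ e, sm (ng e) = - sm e := by
    intro e
    simp only [sm, ng]
    rw [Finset.sum_image (fun a _ b _ h => neg_injective h), Finset.sum_neg_distrib]
  set S := P.V.filter (fun v => 0 < θ v) with hS
  set E := (edgeFinset P).filter (fun e => 0 < θ (sm e)) with hE
  have cS : 2 * S.card = P.V.card := half_count P.V (fun v => -v) (fun v => θ v) hcs neg_neg
    (fun a _ => map_neg θ a) (fun a ha => hθ ⟨a, Finset.mem_union_left _ ha⟩)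
  have cE : 2 * E.card = (edgeFinset P).card := half_count (edgeFinset P) ng (fun e => θ (sm e)) ngE ngng
    (fun a _ => by rw [smng, map_neg])
    (fun a ha => hθ ⟨sm a, Finset.mem_union_right _ (Finset.mem_image_of_mem _ ha)⟩)
  have hSn : ∀ v ∈ S, -v ∉ S := by
    intro v hv hn
    have a := (Finset.mem_filter.1 hv).2
    have b := (Finset.mem_filter.1 hn).2
    rw [map_neg] at b; linarith
  have hcount : E.card + d = S.card * d := by
    rw [g2, f1, f0, ← cS, ← cE] at hg2
    have : ((d + 1).choose 2 : ℤ) = (d.choose 2 : ℤ) + d := by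
      rw [Nat.choose_succ_succ' d 1]; simp; ring
    rw [this] at hg2
    have h3 : ((E.card : ℤ)) + d = S.card * d := by
      push_cast at hg2; linarith
    exact_mod_cast h3
  -- each edge or its negative lies in `E`
  have hEor : ∀ e ∈ edgeFinset P, e ∈ E ∨ ng e ∈ E := by
    intro e hee
    have h1 : θ (sm e) ≠ 0 := hθ ⟨sm e, Finset.mem_union_right _ (Finset.mem_image_of_mem _ hee)⟩
    rcases lt_or_gt_of_ne h1 with h | h
    · right
      refine Finset.mem_filter.2 ⟨ngE e hee, ?_⟩
      rw [smng, map_neg]; linarith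
    · left; exact Finset.mem_filter.2 ⟨hee, h⟩
  have ngp : ∀ a b : Fin d → ℝ, ng {a, b} = {-a, -b} := by
    intro a b; simp [ng, Finset.image_insert]
  have hval : ∀ (m : {v // v ∈ S} → (Fin d → ℝ)) (a b : Fin d → ℝ), a ≠ b → Fc P.V pp {a, b} →
      ∃ e : {e // e ∈ E}, (e.1 = {a, b} ∨ e.1 = {-a, -b}) ∧
        (RR S E m e = 2 * ((evx S m a - evx S m b) ⬝ᵥ (a - b)) ∨
         RR S E m e = -(2 * ((evx S m a - evx S m b) ⬝ᵥ (a - b)))) := by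
    intro m a b hab hF
    rcases hEor _ (hpair a b hab hF) with h | h
    · exact ⟨⟨_, h⟩, Or.inl rfl, Or.inl (RR_pair S E m hab h)⟩
    · rw [ngp] at h
      refine ⟨⟨_, h⟩, Or.inr rfl, Or.inr ?_⟩
      rw [RR_pair S E m (fun e => hab (neg_injective e)) h, evx_neg, evx_neg]
      simp only [dotProduct_sub, dotProduct_neg]
      ring
  have hker : Module.finrank ℝ (LinearMap.ker (RR S E)) ≤ d := by
    let cst : (Fin d → ℝ) →ₗ[ℝ] ({v // v ∈ S} → (Fin d → ℝ)) := LinearMap.pi fun _ => LinearMap.id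
    have hle : LinearMap.ker (RR S E) ≤ LinearMap.range cst := by
      intro m hm
      rw [LinearMap.mem_ker] at hm
      obtain ⟨k, hk⟩ := evx_const hd P hcs (evx S m) (evx_neg S m) (by
        intro u w huw hF
        obtain ⟨e, -, h⟩ := hval m u w huw hF
        rw [hm] at h
        simp only [Pi.zero_apply] at h
        rcases h with h | h <;> linarith)
      refine ⟨k, ?_⟩
      funext ⟨v, hv⟩
      have h1 := hk v (Finset.mem_filter.1 hv).1
      rw [evx, ext0, ext0, dif_pos hv, dif_neg (hSn v hv), add_zero] at h1
      rw [h1]; rfl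
    refine (Submodule.finrank_mono hle).trans ?_
    refine (LinearMap.finrank_range_le cst).trans ?_
    simp
  have hsurj : LinearMap.range (RR S E) = ⊤ := by
    apply Submodule.eq_top_of_finrank_eq
    refine le_antisymm (Submodule.finrank_le _) ?_
    have h1 := LinearMap.finrank_range_add_finrank_ker (RR S E)
    have h2 : Module.finrank ℝ ({v // v ∈ S} → (Fin d → ℝ)) = S.card * d := by
      rw [Module.finrank_pi_fintype]; simp
    have h3 : Module.finrank ℝ ({e // e ∈ E} → ℝ) = E.card := by simp
    rw [h2] at h1; rw [h3]; omega
  obtain ⟨m, hm⟩ : ∃ m, RR S E m = fun e => if e.1 = {u0, v0} ∨ e.1 = {-u0, -v0} then 1 else 0 := by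
    have : (fun e : {e // e ∈ E} => if e.1 = {u0, v0} ∨ e.1 = {-u0, -v0} then (1 : ℝ) else 0) ∈
      LinearMap.range (RR S E) := by rw [hsurj]; trivial
    exact this
  refine ⟨MM (evx S m), fun u _ => MM_self _ _, ?_, ?_⟩
  · intro u w huw hF n1 n2 n3 n4
    obtain ⟨e, h1, h2⟩ := hval m u w huw hF
    have hz : RR S E m e = 0 := by
      rw [hm]
      simp only [ite_eq_right_iff, one_ne_zero, imp_false]
      have pr : ∀ a b c d' : Fin d → ℝ, ({a, b} : Finset (Fin d → ℝ)) = {c, d'} →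
          (a = c ∧ b = d') ∨ (a = d' ∧ b = c) := by
        intro a b c d' h
        have : ({a, b} : Set (Fin d → ℝ)) = {c, d'} := by
          have := congrArg (fun s : Finset (Fin d → ℝ) => (s : Set (Fin d → ℝ))) h
          simpa using this
        exact Set.pair_eq_pair_iff.1 this
      have e1 : ∀ a b : Fin d → ℝ, -a = b → a = -b := fun a b h => by rw [← h, neg_neg]
      rintro (h | h) <;> rcases h1 with h1 | h1 <;> rw [h1] at h <;>
        rcases pr _ _ _ _ h with ⟨q1, q2⟩ | ⟨q1, q2⟩
      · exact n1 ⟨q1, q2⟩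
      · exact n2 ⟨q1, q2⟩
      · exact n3 ⟨e1 _ _ q1, e1 _ _ q2⟩
      · exact n4 ⟨e1 _ _ q1, e1 _ _ q2⟩
      · exact n3 ⟨q1, q2⟩
      · exact n4 ⟨q1, q2⟩
      · exact n1 ⟨neg_injective q1, neg_injective q2⟩
      · exact n2 ⟨neg_injective q1, neg_injective q2⟩
    rw [MM_strain]
    rw [hz] at h2
    rcases h2 with h2 | h2 <;> linarith
  · obtain ⟨e, h1, h2⟩ := hval m u0 v0 hne he
    rw [hm] at h2
    simp only [if_pos h1] at h2
    rw [MM_strain]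
    intro h
    rcases h2 with h2 | h2 <;> linarith
end flexing

theorem pp_csc {d : ℕ} (hd : 5 ≤ d) (P : SPolytope d) (hcs : IsCS P)
    (hg2 : g2 P = (d.choose 2 : ℤ) - (d : ℤ)) :
    CSc P.V (pp (d := d)) (fun v => -v) ((0 : Fin d → ℝ), (1 : ℝ)) where
  cfg := pp_cfg P
  nn := neg_neg
  nF := pp_nF P hcs
  po := fun v _ => pp_po v
  op := pp_op P hcs
  ht := ⟨LinearMap.snd ℝ _ _, rfl, fun _ _ => rfl⟩
  flex := pp_flex hd P hcs hg2

/-- Let `d ≥ 5` and let `P` be a prime cs simplicial `d`-polytope with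
`g₂(P) = C(d,2) - d`. Then there is no nonempty face `τ` of `∂P` with `|τ| ≤ d - 2`
whose link is the boundary of a simplex, i.e. no face `τ` with `1 ≤ |τ| ≤ d - 2` and
vertex set `σ` of size `d + 1 - |τ|` such that the faces of `lk(τ)` are exactly the
proper subsets of `σ`. -/
theorem stmt16 {d : ℕ} (hd : 5 ≤ d) (P : SPolytope d) (hp : IsPrimePoly P) (hcs : IsCS P)
    (hg2 : g2 P = (d.choose 2 : ℤ) - (d : ℤ)) :
    ¬ ∃ (τ σ : Finset (Fin d → ℝ)), BFace P τ ∧ 1 ≤ τ.card ∧ τ.card ≤ d - 2 ∧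
      σ.card = d + 1 - τ.card ∧
      (∀ ρ : Finset (Fin d → ℝ), LinkFace P τ ρ ↔ ρ ⊂ σ) := by
  rintro ⟨τ, σ, hτ, h1, h2, h3, hL⟩
  have hfr : Module.finrank ℝ ((Fin d → ℝ) × ℝ) = d + 1 := by simp
  have hss : ∀ x ∈ σ, ({x} : Finset (Fin d → ℝ)) ⊂ σ := by
    intro x hx
    refine (Finset.ssubset_iff_subset_ne).2 ⟨by simpa using hx, fun e => ?_⟩
    have := congrArg Finset.card e
    rw [Finset.card_singleton] at this
    omega
  have hdis : Disjoint σ τ := by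
    rw [Finset.disjoint_left]
    intro x hx hxτ
    have := ((hL {x}).2 (hss x hx)).1
    rw [Finset.disjoint_left] at this
    exact this (by simp) hxτ
  refine (pp_csc hd P hcs hg2).main (C := σ ∪ τ) (S := σ) ?_ ?_ ?_ ?_ ?_ ?_ ?_
  · intro μ hμ hn hall hc
    refine hp ⟨μ, ⟨hμ, ?_, ?_⟩, ?_⟩
    · rwa [bface_iff]
    · intro ρ hρ; rw [bface_iff]; exact hall ρ hρ
    · omega
  · omega
  · rw [Finset.card_union_of_disjoint hdis]; omega
  · rw [← bface_iff]
    intro hF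
    exact (ssubset_irrefl σ) ((hL σ).1 ⟨hdis, hF⟩)
  · exact Finset.subset_union_left
  · omega
  · intro x hx
    have := ((hL (σ.erase x)).2 (Finset.erase_ssubset hx)).2
    rw [bface_iff] at this
    refine this.mono ?_
    intro z hz
    simp only [Finset.mem_erase, Finset.mem_union] at hz ⊢
    tauto
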